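/- arXiv:1906.10432 — 6 statements merged into one kernel-verified Lean document; each statement's English description precedes it below -/
import Mathlib

section
/- Let H be a fixed d×d Hermitian matrix and let x be a centered real random variable satisfying E[exp(θ·x)] ≤ exp(b²·θ²/2) for all θ ∈ ℝ and some b > 0. Then for every θ ∈ ℝ, the matrix moment generating function satisfies E[exp(x·θ·H)] ⪯ exp(θ²·b²·H²/2), where exp denotes the matrix exponential and ⪯ the Loewner (positive semidefinite) order. -/
open MeasureTheory ProbabilityTheory Real Matrix

/-- **Proposition 3.2 (matrix sub-Gaussian mgf bound).** Let `H` be a fixed `d × d` Hermitian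
matrix and `x` a centered real random variable with sub-Gaussian mgf parameter `b`, i.e.
`E[exp(θ x)] ≤ exp(b² θ²/2)` for all `θ`. Then for every `θ ∈ ℝ`,
`E[exp(x θ H)] ⪯ exp(θ² b² H²/2)` in the Loewner (positive semidefinite) order, where `exp`
is the matrix exponential and the expectation of a random matrix is taken entrywise. -/
theorem matrix_subGaussian_mgf_bound
    {d : ℕ} {Ω : Type*} [MeasurableSpace Ω] (μ : Measure Ω) [IsProbabilityMeasure μ]
    (H : Matrix (Fin d) (Fin d) ℝ) (hH : H.IsHermitian)
    (x : Ω → ℝ) (hx : Measurable x) (hcent : ∫ ω, x ω ∂μ = 0)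
    (b : ℝ) (hb : 0 < b)
    (hmgf : ∀ θ : ℝ, ∫⁻ ω, ENNReal.ofReal (Real.exp (θ * x ω)) ∂μ ≤
      ENNReal.ofReal (Real.exp (b ^ 2 * θ ^ 2 / 2))) :
    ∀ θ : ℝ,
      (NormedSpace.exp ((θ ^ 2 * b ^ 2 / 2) • H ^ 2) -
        Matrix.of (fun i j => ∫ ω, NormedSpace.exp ((x ω * θ) • H) i j ∂μ)).PosSemidef := by
  intro θ
  obtain ⟨U, D, hU, hU', hHd⟩ : ∃ (U : Matrix (Fin d) (Fin d) ℝ) (D : Fin d → ℝ),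
      U * Uᴴ = 1 ∧ Uᴴ * U = 1 ∧ H = U * diagonal D * Uᴴ := by
    refine ⟨hH.eigenvectorUnitary, hH.eigenvalues, ?_, ?_, ?_⟩
    · exact Unitary.mul_star_self_of_mem hH.eigenvectorUnitary.2
    · exact Unitary.star_mul_self_of_mem hH.eigenvectorUnitary.2
    · have := hH.spectral_theorem
      rw [Unitary.conjStarAlgAut_apply] at this
      exact this
  have hinv : U⁻¹ = Uᴴ := Matrix.inv_eq_right_inv hU
  have hunit : IsUnit U := ⟨⟨U, Uᴴ, hU, hU'⟩, rfl⟩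
  have hexp : ∀ E : Fin d → ℝ, NormedSpace.exp (U * diagonal E * Uᴴ) =
      U * diagonal (fun k => Real.exp (E k)) * Uᴴ := by
    intro E
    rw [← hinv, Matrix.exp_conj _ _ hunit, Matrix.exp_diagonal]
    congr 3
    funext k
    rw [Pi.coe_exp, Real.exp_eq_exp_ℝ]
  have h1 : ∀ c : ℝ, c • H = U * diagonal (fun k => c * D k) * Uᴴ := by
    intro c
    have : diagonal (fun k => c * D k) = c • diagonal D := by
      rw [← diagonal_smul]; rfl
    rw [this, hHd]; simp
  have h2 : ∀ c : ℝ, c • H ^ 2 = U * diagonal (fun k => c * (D k) ^ 2) * Uᴴ := by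
    intro c
    have e : H ^ 2 = U * diagonal (fun k => (D k) ^ 2) * Uᴴ := by
      have : U * diagonal D * Uᴴ * (U * diagonal D * Uᴴ)
          = U * diagonal D * (Uᴴ * U) * diagonal D * Uᴴ := by
        simp only [Matrix.mul_assoc]
      rw [pow_two, hHd, this, hU', Matrix.mul_one, Matrix.mul_assoc U, diagonal_mul_diagonal]
      simp only [pow_two]
    have : diagonal (fun k => c * (D k) ^ 2) = c • diagonal (fun k => (D k) ^ 2) := by
      rw [← diagonal_smul]; rfl
    rw [this, e]; simp
  have hint : ∀ t : ℝ, Integrable (fun ω => Real.exp (t * x ω)) μ := by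
    intro t
    refine ⟨by fun_prop, ?_⟩
    rw [hasFiniteIntegral_iff_ofReal (Filter.Eventually.of_forall fun ω => (Real.exp_pos _).le)]
    exact (hmgf t).trans_lt ENNReal.ofReal_lt_top
  have hle : ∀ t : ℝ, ∫ ω, Real.exp (t * x ω) ∂μ ≤ Real.exp (b ^ 2 * t ^ 2 / 2) := by
    intro t
    rw [integral_eq_lintegral_of_nonneg_ae
      (Filter.Eventually.of_forall fun ω => (Real.exp_pos _).le) (hint t).1]
    exact ENNReal.toReal_le_of_le_ofReal (Real.exp_pos _).le (hmgf t)
  have hE : Matrix.of (fun i j => ∫ ω, NormedSpace.exp ((x ω * θ) • H) i j ∂μ) =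
      U * diagonal (fun k => ∫ ω, Real.exp (θ * D k * x ω) ∂μ) * Uᴴ := by
    ext i j
    rw [Matrix.of_apply, Matrix.mul_apply]
    simp only [h1, hexp, Matrix.mul_apply (M := U * _), Matrix.mul_diagonal]
    have e : ∀ ω k, x ω * θ * D k = θ * D k * x ω := fun ω k => by ring
    simp only [e]
    rw [integral_finsetSum]
    · refine Finset.sum_congr rfl fun k _ => ?_
      rw [integral_mul_const, integral_const_mul]
    · intro k _
      exact ((hint _).const_mul _).mul_const _
  rw [hE, h2, hexp, ← Matrix.sub_mul, ← Matrix.mul_sub, diagonal_sub]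
  refine PosSemidef.mul_mul_conjTranspose_same (PosSemidef.diagonal fun k => ?_) U
  have := hle (θ * D k)
  have e : θ ^ 2 * b ^ 2 / 2 * D k ^ 2 = b ^ 2 * (θ * D k) ^ 2 / 2 := by ring
  simp only [Pi.zero_apply, e]
  linarith
end

section
/- Let {H_k : k = 1, …, K} be a finite sequence of fixed d×d Hermitian matrices, and let {x_k : k = 1, …, K} be independent centered real random variables each satisfying E[exp(θ·x_k)] ≤ exp(b²·θ²/2) for all θ ∈ ℝ and some fixed b > 0. Set ρ = ‖Σ_k H_k²‖ (operator norm). Then for all t ≥ 0, P( λ_max(Σ_k x_k·H_k) ≥ t ) ≤ d·exp( -t²/(2·b²·ρ) ), where λ_max denotes the largest eigenvalue. -/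
open MeasureTheory ProbabilityTheory Real Matrix

/-- The operator (spectral) norm of a real matrix: the norm of the induced continuous
linear map between Euclidean spaces. -/
noncomputable def opNorm {m n : Type*} [Fintype m] [Fintype n] [DecidableEq n]
    (B : Matrix m n ℝ) : ℝ :=
  ‖LinearMap.toContinuousLinearMap (Matrix.toEuclideanLin B)‖

/-- The largest eigenvalue of a (Hermitian) real matrix, as the supremum of its spectrum. -/
noncomputable def lambdaMax {d : Type*} [Fintype d] [DecidableEq d]
    (A : Matrix d d ℝ) : ℝ :=
  sSup (spectrum ℝ A)

lemma scal_int (t s : ℝ) (ht : 0 < t) (hs : 0 < s) :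
    ∫ u in (0:ℝ)..1, u * (s - t) ^ 2 / (u * s + (1 - u) * t) =
      t * (Real.log t - Real.log s) - t + s := by
  have hpos : ∀ u ∈ Set.uIcc (0:ℝ) 1, 0 < u * s + (1 - u) * t := by
    intro u hu
    rw [Set.uIcc_of_le zero_le_one] at hu
    obtain ⟨h0, h1⟩ := hu
    rcases h0.eq_or_lt with h | h
    · subst h; simpa using ht
    · have : 0 ≤ (1 - u) * t := mul_nonneg (by linarith) ht.le
      have := mul_pos h hs
      linarith
  have := intervalIntegral.integral_eq_sub_of_hasDerivAt
    (f := fun u => (s - t) * u - t * Real.log (u * s + (1 - u) * t))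
    (f' := fun u => u * (s - t) ^ 2 / (u * s + (1 - u) * t)) (a := 0) (b := 1) ?_ ?_
  · rw [this]; simp; ring
  · intro u hu
    have hp := hpos u hu
    have h1 : HasDerivAt (fun u : ℝ => u * s + (1 - u) * t) (s - t) u := by
      have := ((hasDerivAt_id u).mul_const s).add (((hasDerivAt_id u).const_sub 1).mul_const t)
      exact this.congr_deriv (by ring)
    have h2 := ((hasDerivAt_id u).const_mul (s - t)).sub ((h1.log hp.ne').const_mul t)
    refine h2.congr_deriv ?_
    have hp' := hp.ne'
    rw [mul_one, ← mul_div_assoc, sub_div' hp', div_left_inj' hp']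
    ring
  · apply ContinuousOn.intervalIntegrable
    apply ContinuousOn.div (by fun_prop) (by fun_prop)
    intro u hu; exact (hpos u hu).ne'

lemma scal_cont (t s : ℝ) (ht : 0 < t) (hs : 0 < s) :
    IntervalIntegrable (fun u : ℝ => u * (s - t) ^ 2 / (u * s + (1 - u) * t)) volume 0 1 := by
  apply ContinuousOn.intervalIntegrable
  apply ContinuousOn.div (by fun_prop) (by fun_prop)
  intro u hu
  rw [Set.uIcc_of_le zero_le_one] at hu
  obtain ⟨h0, h1⟩ := hu
  rcases h0.eq_or_lt with h | h
  · subst h; simpa using ht.ne'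
  · have : 0 ≤ (1 - u) * t := mul_nonneg (by linarith) ht.le
    have := mul_pos h hs
    linarith

lemma rowsum {n : Type*} [Fintype n] [DecidableEq n] (U V : Matrix n n ℝ)
    (hV : V * Vᵀ = 1) (x y : n → ℝ) (i : n) :
    ∑ j, (Uᵀ * diagonal x * V) i j * (Uᵀ * diagonal y * V) i j = ∑ k, U k i ^ 2 * (x k * y k) := by
  have h : (Uᵀ * diagonal x * V) * (Uᵀ * diagonal y * V)ᵀ =
      Uᵀ * diagonal (fun k => x k * y k) * U := by
    rw [transpose_mul, transpose_mul, diagonal_transpose, transpose_transpose]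
    calc _ = Uᵀ * diagonal x * (V * Vᵀ) * diagonal y * U := by simp only [Matrix.mul_assoc]
      _ = _ := by rw [hV, Matrix.mul_one, Matrix.mul_assoc Uᵀ, diagonal_mul_diagonal]
  have h2 := congrFun (congrFun h i) i
  rw [Matrix.mul_apply] at h2
  simp only [transpose_apply] at h2
  rw [h2, Matrix.mul_apply]
  apply Finset.sum_congr rfl
  intro k _
  rw [mul_diagonal, transpose_apply]; ring

lemma colsum {n : Type*} [Fintype n] [DecidableEq n] (U V : Matrix n n ℝ)
    (hU : U * Uᵀ = 1) (x y : n → ℝ) (j : n) :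
    ∑ i, (Uᵀ * diagonal x * V) i j * (Uᵀ * diagonal y * V) i j = ∑ k, V k j ^ 2 * (x k * y k) := by
  rw [← rowsum V U hU x y j]
  have : ∀ z : n → ℝ, ∀ i, (Uᵀ * diagonal z * V) i j = (Vᵀ * diagonal z * U) j i := by
    intro z i
    rw [← transpose_apply (Vᵀ * diagonal z * U), transpose_mul, transpose_mul, diagonal_transpose,
      transpose_transpose, Matrix.mul_assoc]
  simp only [this]

lemma gt_diag {n : Type*} [Fintype n] [DecidableEq n] (U V : Matrix n n ℝ)
    (hU : U * Uᵀ = 1) (hV : V * Vᵀ = 1) (g m δ : n → ℝ)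
    (h : V * diagonal m * Vᵀ = U * diagonal g * Uᵀ + diagonal δ) :
    ∑ j, Real.exp (m j) ≤ ∑ k, Real.exp (δ k) * ∑ i, U k i ^ 2 * Real.exp (g i) := by
  have hU' : Uᵀ * U = 1 := mul_eq_one_comm.mp hU
  have hV' : Vᵀ * V = 1 := mul_eq_one_comm.mp hV
  have rowone : ∀ W : Matrix n n ℝ, W * Wᵀ = 1 → ∀ k, ∑ i, W k i ^ 2 = 1 := by
    intro W hW k
    have := congrFun (congrFun hW k) k
    rw [Matrix.mul_apply] at this
    simpa [sq] using this
  have spos : ∀ W : Matrix n n ℝ, W * Wᵀ = 1 → ∀ (g : n → ℝ) k,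
      0 < ∑ i, W k i ^ 2 * Real.exp (g i) := by
    intro W hW g k
    have h0 : 0 ≤ ∑ i, W k i ^ 2 * Real.exp (g i) :=
      Finset.sum_nonneg fun i _ => by positivity
    rcases h0.eq_or_lt with h | h
    · rw [eq_comm, Finset.sum_eq_zero_iff_of_nonneg (fun i _ => by positivity)] at h
      have h1 := rowone W hW k
      rw [Finset.sum_eq_zero] at h1
      · norm_num at h1
      · intro i hi
        have := h i hi
        simpa [(Real.exp_pos _).ne'] using this
    · exact h
  set S : n → ℝ := fun k => ∑ i, U k i ^ 2 * Real.exp (g i) with hS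
  set T : n → ℝ := fun k => ∑ j, V k j ^ 2 * Real.exp (m j) with hT
  have hSp : ∀ k, 0 < S k := spos U hU g
  have hTp : ∀ k, 0 < T k := spos V hV m
  set X : (n → ℝ) → n → n → ℝ := fun x => Uᵀ * diagonal x * V with hX
  have row : ∀ x y i, ∑ j, X x i j * X y i j = ∑ k, U k i ^ 2 * (x k * y k) :=
    fun x y i => rowsum U V hV x y i
  have col : ∀ x y j, ∑ i, X x i j * X y i j = ∑ k, V k j ^ 2 * (x k * y k) :=
    fun x y i => colsum U V hU x y i
  set C : n → n → ℝ := X 1 with hC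
  have sumS : ∀ x y, ∑ i, ∑ j, Real.exp (g i) * (X x i j * X y i j) = ∑ k, S k * (x k * y k) := by
    intro x y
    simp only [← Finset.mul_sum, row, hS, Finset.sum_mul]
    simp only [Finset.mul_sum]
    rw [Finset.sum_comm]
    exact Finset.sum_congr rfl fun _ _ => Finset.sum_congr rfl fun _ _ => by ring
  have sumT : ∀ x y, ∑ i, ∑ j, Real.exp (m j) * (X x i j * X y i j) = ∑ k, T k * (x k * y k) := by
    intro x y
    rw [Finset.sum_comm]
    simp only [← Finset.mul_sum, col, hT, Finset.sum_mul]
    simp only [Finset.mul_sum]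
    rw [Finset.sum_comm]
    exact Finset.sum_congr rfl fun _ _ => Finset.sum_congr rfl fun _ _ => by ring
  have hdelta : ∀ i j, C i j * (m j - g i) = X δ i j := by
    intro i j
    have e : Uᵀ * (V * diagonal m * Vᵀ) * V = Uᵀ * (U * diagonal g * Uᵀ + diagonal δ) * V := by rw [h]
    have e1 : Uᵀ * (V * diagonal m * Vᵀ) * V = Uᵀ * V * diagonal m := by
      calc _ = Uᵀ * V * diagonal m * (Vᵀ * V) := by simp only [Matrix.mul_assoc]
        _ = _ := by rw [hV', Matrix.mul_one]
    have e2 : Uᵀ * (U * diagonal g * Uᵀ + diagonal δ) * V =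
        diagonal g * (Uᵀ * V) + Uᵀ * diagonal δ * V := by
      rw [Matrix.mul_add, Matrix.add_mul]
      congr 1
      calc _ = (Uᵀ * U) * diagonal g * (Uᵀ * V) := by simp only [Matrix.mul_assoc]
        _ = _ := by rw [hU', Matrix.one_mul]
    rw [e1, e2] at e
    have e3 := congrFun (congrFun e i) j
    rw [Matrix.mul_diagonal, Matrix.add_apply, Matrix.diagonal_mul] at e3
    have hCU : C i j = (Uᵀ * V) i j := by
      simp [hC, hX]
    have : X δ i j = (Uᵀ * diagonal δ * V) i j := rfl
    rw [hCU, this]; linarith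
  -- the key inequality
  have key : ∀ u ∈ Set.Icc (0:ℝ) 1,
      ∑ k, u * (S k - T k) ^ 2 / (u * S k + (1 - u) * T k) ≤
      ∑ i, ∑ j, C i j ^ 2 * (u * (Real.exp (g i) - Real.exp (m j)) ^ 2 /
        (u * Real.exp (g i) + (1 - u) * Real.exp (m j))) := by
    rintro u ⟨h0, h1⟩
    have cpos : ∀ s t : ℝ, 0 < s → 0 < t → 0 < u * s + (1 - u) * t := by
      intro s t hs ht
      rcases h0.eq_or_lt with h | h
      · subst h; simpa using ht
      · have : 0 ≤ (1 - u) * t := mul_nonneg (by linarith) ht.le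
        have := mul_pos h hs
        linarith
    set x : n → ℝ := fun k => (S k - T k) / (u * S k + (1 - u) * T k) with hx
    have l1 : ∑ k, u * (S k - T k) ^ 2 / (u * S k + (1 - u) * T k) =
        u * (2 * (∑ k, S k * ((1 : n → ℝ) k * x k) - ∑ k, T k * ((1 : n → ℝ) k * x k))
          - (u * ∑ k, S k * (x k * x k) + (1 - u) * ∑ k, T k * (x k * x k))) := by
      simp only [Finset.mul_sum, ← Finset.sum_sub_distrib, ← Finset.sum_add_distrib]
      apply Finset.sum_congr rfl
      intro k _
      have := cpos _ _ (hSp k) (hTp k)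
      simp only [hx, Pi.one_apply]
      field_simp
      ring
    rw [l1, ← sumS, ← sumT, ← sumS, ← sumT]
    simp only [Finset.mul_sum, ← Finset.sum_sub_distrib, ← Finset.sum_add_distrib]
    apply Finset.sum_le_sum
    intro i _
    apply Finset.sum_le_sum
    intro j _
    have hp := cpos _ _ (Real.exp_pos (g i)) (Real.exp_pos (m j))
    change _ ≤ X 1 i j ^ 2 * _
    generalize X 1 i j = c
    generalize X x i j = z
    generalize Real.exp (g i) = s at *
    generalize Real.exp (m j) = t at *
    rw [← sub_nonneg]
    have : c ^ 2 * (u * (s - t) ^ 2 / (u * s + (1 - u) * t)) -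
        u * (2 * (s * (c * z) - t * (c * z)) - (u * (s * (z * z)) + (1 - u) * (t * (z * z)))) =
        u * (c * (s - t) - (u * s + (1 - u) * t) * z) ^ 2 / (u * s + (1 - u) * t) := by
      have hp' := hp.ne'
      rw [← mul_div_assoc, div_sub' hp', div_left_inj' hp']
      ring
    rw [this]
    positivity
  -- integrate
  have hint := intervalIntegral.integral_mono_on (μ := volume) (zero_le_one (α := ℝ))
    (IntervalIntegrable.sum Finset.univ fun k _ => scal_cont (T k) (S k) (hTp k) (hSp k))
    (IntervalIntegrable.sum Finset.univ fun i _ => IntervalIntegrable.sum Finset.univ fun j _ =>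
      (scal_cont (Real.exp (m j)) (Real.exp (g i)) (Real.exp_pos _) (Real.exp_pos _)).const_mul (C i j ^ 2))
    (by intro u hu; simpa only [Finset.sum_apply] using key u hu)
  simp only [Finset.sum_apply] at hint
  rw [intervalIntegral.integral_finsetSum (fun k _ => scal_cont (T k) (S k) (hTp k) (hSp k)),
    intervalIntegral.integral_finsetSum (fun i _ => by
      simpa only [Finset.sum_fn] using IntervalIntegrable.sum Finset.univ fun j _ =>
      (scal_cont (Real.exp (m j)) (Real.exp (g i)) (Real.exp_pos _) (Real.exp_pos _)).const_mul (C i j ^ 2))] at hint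
  have e4 : ∀ i, (∫ u in (0:ℝ)..1, ∑ j, C i j ^ 2 * (u * (Real.exp (g i) - Real.exp (m j)) ^ 2 /
        (u * Real.exp (g i) + (1 - u) * Real.exp (m j)))) =
      ∑ j, C i j ^ 2 * (Real.exp (m j) * (m j - g i) - Real.exp (m j) + Real.exp (g i)) := by
    intro i
    rw [intervalIntegral.integral_finsetSum (fun j _ => 
      (scal_cont (Real.exp (m j)) (Real.exp (g i)) (Real.exp_pos _) (Real.exp_pos _)).const_mul (C i j ^ 2))]
    apply Finset.sum_congr rfl
    intro j _
    rw [intervalIntegral.integral_const_mul, scal_int _ _ (Real.exp_pos _) (Real.exp_pos _),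
      Real.log_exp, Real.log_exp]
  simp only [e4, scal_int _ _ (hTp _) (hSp _)] at hint
  have e5 : ∑ i, ∑ j, C i j ^ 2 * (Real.exp (m j) * (m j - g i) - Real.exp (m j) + Real.exp (g i)) =
      ∑ k, T k * ((1 : n → ℝ) k * δ k) - ∑ k, T k * ((1 : n → ℝ) k * (1 : n → ℝ) k)
        + ∑ k, S k * ((1 : n → ℝ) k * (1 : n → ℝ) k) := by
    rw [← sumS, ← sumT, ← sumT]
    simp only [← Finset.sum_sub_distrib, ← Finset.sum_add_distrib]
    apply Finset.sum_congr rfl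
    intro i _
    apply Finset.sum_congr rfl
    intro j _
    rw [← hdelta]
    change C i j ^ 2 * _ = _ * (C i j * _) - _ * (C i j * C i j) + _ * (C i j * C i j)
    ring
  rw [e5] at hint
  have e6 : ∑ j, Real.exp (m j) = ∑ k, T k := by
    simp only [hT]
    rw [Finset.sum_comm]
    apply Finset.sum_congr rfl
    intro j _
    have := rowone Vᵀ (by simpa using hV') j
    simp only [transpose_apply] at this
    rw [← Finset.sum_mul, this, one_mul]
  rw [e6]
  have e7 : ∀ k, T k * (δ k + Real.log (S k) - Real.log (T k)) ≤ Real.exp (δ k) * S k - T k := by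
    intro k
    have hy : 0 < Real.exp (δ k) * S k := mul_pos (Real.exp_pos _) (hSp k)
    have := Real.log_le_sub_one_of_pos (div_pos hy (hTp k))
    rw [Real.log_div hy.ne' (hTp k).ne', Real.log_mul (Real.exp_pos _).ne' (hSp k).ne',
      Real.log_exp] at this
    have := mul_le_mul_of_nonneg_left this (hTp k).le
    rwa [mul_sub (T k) _ 1, mul_div_cancel₀ _ (hTp k).ne', mul_one] at this
  have e8 := Finset.sum_le_sum fun k (_ : k ∈ Finset.univ) => e7 k
  simp only [Pi.one_apply, one_mul, mul_one, mul_sub, mul_add, Finset.sum_sub_distrib, Finset.sum_add_distrib] at *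
  linarith

/-- trace of the matrix exponential -/
noncomputable def trexp {n : Type*} [Fintype n] [DecidableEq n] (A : Matrix n n ℝ) : ℝ :=
  (NormedSpace.exp A).trace

lemma exists_diag {n : Type*} [Fintype n] [DecidableEq n] {A : Matrix n n ℝ}
    (hA : A.IsHermitian) :
    ∃ U : Matrix n n ℝ, U * Uᵀ = 1 ∧ A = U * diagonal hA.eigenvalues * Uᵀ := by
  refine ⟨hA.eigenvectorUnitary, ?_, ?_⟩
  · have := Unitary.coe_mul_star_self hA.eigenvectorUnitary
    rwa [Unitary.coe_star, star_eq_conjTranspose, conjTranspose_eq_transpose_of_trivial] at this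
  · have := hA.spectral_theorem
    rw [Unitary.conjStarAlgAut_apply, star_eq_conjTranspose,
      conjTranspose_eq_transpose_of_trivial] at this
    exact this

lemma trexp_conj {n : Type*} [Fintype n] [DecidableEq n] (U A : Matrix n n ℝ)
    (hU : U * Uᵀ = 1) : trexp (U * A * Uᵀ) = trexp A := by
  have h : U⁻¹ = Uᵀ := inv_eq_right_inv hU
  have hu : IsUnit U := IsUnit.of_mul_eq_one _ hU
  unfold trexp
  rw [← h, exp_conj U A hu, trace_mul_cycle, h, mul_eq_one_comm.mp hU, Matrix.one_mul]

lemma trexp_diagonal {n : Type*} [Fintype n] [DecidableEq n] (a : n → ℝ) :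
    trexp (diagonal a) = ∑ i, Real.exp (a i) := by
  unfold trexp
  rw [exp_diagonal, trace_diagonal]
  simp [Pi.coe_exp, Real.exp_eq_exp_ℝ]

lemma trexp_diag {n : Type*} [Fintype n] [DecidableEq n] (U : Matrix n n ℝ) (a : n → ℝ)
    (hU : U * Uᵀ = 1) : trexp (U * diagonal a * Uᵀ) = ∑ i, Real.exp (a i) := by
  rw [trexp_conj U _ hU, trexp_diagonal]

lemma trexp_cont {n : Type*} [Fintype n] [DecidableEq n] :
    Continuous (trexp : Matrix n n ℝ → ℝ) := by
  have h : Continuous (NormedSpace.exp : Matrix n n ℝ → Matrix n n ℝ) := by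
    let _ : NormedRing (Matrix n n ℝ) := Matrix.linftyOpNormedRing
    let _ : NormedAlgebra ℝ (Matrix n n ℝ) := Matrix.linftyOpNormedAlgebra
    let _ : NormedAlgebra ℚ (Matrix n n ℝ) := NormedAlgebra.restrictScalars ℚ ℝ _
    exact NormedSpace.exp_continuous
  exact h.matrix_trace

lemma trexp_step_pt {n : Type*} [Fintype n] [DecidableEq n] (L H : Matrix n n ℝ)
    (hL : L.IsHermitian) (hH : H.IsHermitian) (c : ℝ) :
    ∃ (h S : n → ℝ), (∀ k, 0 ≤ S k) ∧ ∑ k, S k = trexp (L + c • H ^ 2) ∧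
      ∀ y : ℝ, trexp (L + y • H) ≤ ∑ k, Real.exp (y * h k - c * h k ^ 2) * S k := by
  obtain ⟨W, hW, hHW⟩ := exists_diag hH
  set h := hH.eigenvalues
  have hW' : Wᵀ * W = 1 := mul_eq_one_comm.mp hW
  have hherm : ∀ B : Matrix n n ℝ, B.IsHermitian → (Wᵀ * B * W).IsHermitian := by
    intro B hB
    rw [IsHermitian, conjTranspose_eq_transpose_of_trivial] at *
    rw [transpose_mul, transpose_mul, transpose_transpose, hB, Matrix.mul_assoc]
  have hG := hherm (L + c • H ^ 2) (hL.add ((hH.pow 2).smul (by simp [IsSelfAdjoint])))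
  obtain ⟨U, hU, hGU⟩ := exists_diag hG
  set g := hG.eigenvalues
  have hWc : ∀ B, trexp (Wᵀ * B * W) = trexp B := fun B => by
    have := trexp_conj Wᵀ B (by rwa [transpose_transpose])
    rwa [transpose_transpose] at this
  have hU' : Uᵀ * U = 1 := mul_eq_one_comm.mp hU
  refine ⟨h, fun k => ∑ i, U k i ^ 2 * Real.exp (g i), fun k => Finset.sum_nonneg fun i _ =>
    by positivity, ?_, ?_⟩
  · rw [← hWc, hGU, trexp_diag U _ hU, Finset.sum_comm]
    apply Finset.sum_congr rfl
    intro i _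
    have := congrFun (congrFun hU' i) i
    rw [Matrix.mul_apply] at this
    simp only [transpose_apply, one_apply_eq, ← sq] at this
    rw [← Finset.sum_mul, this, one_mul]
  · intro y
    have hM := hherm (L + y • H) (hL.add (hH.smul (by simp [IsSelfAdjoint])))
    obtain ⟨V, hV, hMV⟩ := exists_diag hM
    rw [← hWc, hMV, trexp_diag V _ hV]
    apply gt_diag U V hU hV
    rw [← hMV, ← hGU]
    have hd : Wᵀ * H * W = diagonal h := by
      rw [hHW]
      calc _ = (Wᵀ * W) * diagonal h * (Wᵀ * W) := by simp only [Matrix.mul_assoc]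
        _ = _ := by rw [hW', Matrix.one_mul, Matrix.mul_one]
    have hd2 : Wᵀ * H ^ 2 * W = diagonal (fun k => h k ^ 2) := by
      calc _ = Wᵀ * H * (W * Wᵀ) * H * W := by rw [hW, sq]; simp only [Matrix.mul_assoc, Matrix.one_mul]
        _ = (Wᵀ * H * W) * (Wᵀ * H * W) := by simp only [Matrix.mul_assoc]
        _ = _ := by rw [hd, diagonal_mul_diagonal]; simp only [sq]
    simp only [Matrix.mul_add, Matrix.add_mul, Matrix.mul_smul, Matrix.smul_mul, hd, hd2]
    rw [add_assoc]
    congr 1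
    rw [← diagonal_smul, ← diagonal_smul, diagonal_add]
    congr 1
    ext k
    simp

lemma trexp_step {n : Type*} [Fintype n] [DecidableEq n] (L H : Matrix n n ℝ)
    (hL : L.IsHermitian) (hH : H.IsHermitian) (b θ : ℝ) (ν : Measure ℝ)
    (hν : ∀ θ : ℝ, ∫⁻ y, ENNReal.ofReal (Real.exp (θ * y)) ∂ν ≤
      ENNReal.ofReal (Real.exp (b ^ 2 * θ ^ 2 / 2))) :
    ∫⁻ y, ENNReal.ofReal (trexp (L + (θ * y) • H)) ∂ν ≤
      ENNReal.ofReal (trexp (L + (b ^ 2 * θ ^ 2 / 2) • H ^ 2)) := by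
  obtain ⟨h, S, hS0, hS, hpt⟩ := trexp_step_pt L H hL hH (b ^ 2 * θ ^ 2 / 2)
  rw [← hS]
  set c := b ^ 2 * θ ^ 2 / 2 with hc
  calc _ ≤ ∫⁻ y, ∑ k, ENNReal.ofReal (Real.exp ((θ * h k) * y)) *
          ENNReal.ofReal (Real.exp (-(c * h k ^ 2)) * S k) ∂ν := by
        apply lintegral_mono
        intro y
        refine (ENNReal.ofReal_le_ofReal (hpt (θ * y))).trans ?_
        rw [ENNReal.ofReal_sum_of_nonneg (fun k _ => mul_nonneg (Real.exp_pos _).le (hS0 k))]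
        apply Finset.sum_le_sum
        intro k _
        rw [← ENNReal.ofReal_mul (Real.exp_pos _).le, ← mul_assoc, ← Real.exp_add]
        apply le_of_eq
        congr 3
        ring
    _ = ∑ k, (∫⁻ y, ENNReal.ofReal (Real.exp ((θ * h k) * y)) ∂ν) *
          ENNReal.ofReal (Real.exp (-(c * h k ^ 2)) * S k) := by
        rw [lintegral_finsetSum _ (fun k _ => by fun_prop)]
        apply Finset.sum_congr rfl
        intro k _
        rw [lintegral_mul_const _ (by fun_prop)]
    _ ≤ ∑ k, ENNReal.ofReal (S k) := by
        apply Finset.sum_le_sum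
        intro k _
        refine (mul_le_mul_left (hν (θ * h k)) _).trans ?_
        rw [← ENNReal.ofReal_mul (Real.exp_pos _).le, ← mul_assoc, ← Real.exp_add]
        apply le_of_eq
        have : b ^ 2 * (θ * h k) ^ 2 / 2 + -(c * h k ^ 2) = 0 := by rw [hc]; ring
        rw [this, Real.exp_zero, one_mul]
    _ = _ := by rw [ENNReal.ofReal_sum_of_nonneg (fun k _ => hS0 k)]

lemma herm_sum {n ι : Type*} [Fintype n] [Fintype ι] (c : ι → ℝ)
    (H : ι → Matrix n n ℝ) (hH : ∀ k, (H k).IsHermitian) : (∑ k, c k • H k).IsHermitian := by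
  rw [IsHermitian, conjTranspose_sum]
  exact Finset.sum_congr rfl fun k _ => by rw [conjTranspose_smul, (hH k).eq]; simp

lemma trexp_pi {n : Type*} [Fintype n] [DecidableEq n] (b θ : ℝ) {K : ℕ} :
    ∀ (L : Matrix n n ℝ) (_ : L.IsHermitian) (H : Fin K → Matrix n n ℝ)
    (_ : ∀ k, (H k).IsHermitian) (ν : Fin K → Measure ℝ) [∀ k, IsProbabilityMeasure (ν k)]
    (_ : ∀ k, ∀ θ : ℝ, ∫⁻ y, ENNReal.ofReal (Real.exp (θ * y)) ∂(ν k) ≤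
      ENNReal.ofReal (Real.exp (b ^ 2 * θ ^ 2 / 2))),
    ∫⁻ y, ENNReal.ofReal (trexp (L + ∑ k, (θ * y k) • H k)) ∂(Measure.pi ν) ≤
      ENNReal.ofReal (trexp (L + (b ^ 2 * θ ^ 2 / 2) • ∑ k, H k ^ 2)) := by
  induction K with
  | zero =>
    intro L _ H _ ν _ _
    simp
  | succ K ih =>
    intro L hL H hH ν _ hν
    have hmp := (measurePreserving_piFinSuccAbove ν 0).symm
    simp only [Fin.zero_succAbove] at hmp
    rw [← hmp.lintegral_comp_emb (MeasurableEquiv.measurableEmbedding _)]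
    have hm : Measurable fun p : ℝ × (Fin K → ℝ) =>
        ENNReal.ofReal (trexp (L + ((θ * p.1) • H 0 + ∑ k : Fin K, (θ * p.2 k) • H k.succ))) := by
      apply ENNReal.measurable_ofReal.comp
      apply Continuous.measurable
      apply trexp_cont.comp
      fun_prop
    have e : ∀ p : ℝ × (Fin K → ℝ), ∑ k, (θ * ((MeasurableEquiv.piFinSuccAbove (fun _ => ℝ) 0).symm p) k) • H k
        = (θ * p.1) • H 0 + ∑ k : Fin K, (θ * p.2 k) • H k.succ := by
      intro p
      rw [Fin.sum_univ_succ]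
      simp [MeasurableEquiv.piFinSuccAbove]
    simp only [e]
    rw [lintegral_prod_symm _ hm.aemeasurable]
    have hsum : ∀ y : Fin K → ℝ, (∑ k : Fin K, (θ * y k) • H k.succ).IsHermitian := by
      intro y
      exact herm_sum _ _ fun k => hH k.succ
    have hL2 : (L + (b ^ 2 * θ ^ 2 / 2) • H 0 ^ 2).IsHermitian :=
      hL.add (((hH 0).pow 2).smul (by simp [IsSelfAdjoint]))
    calc _ ≤ ∫⁻ y, ENNReal.ofReal (trexp ((L + (b ^ 2 * θ ^ 2 / 2) • H 0 ^ 2) +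
              ∑ k : Fin K, (θ * y k) • H k.succ)) ∂(Measure.pi fun k : Fin K => ν k.succ) := by
          refine lintegral_mono fun y => ?_
          have := trexp_step (L + ∑ k : Fin K, (θ * y k) • H k.succ) (H 0) (hL.add (hsum y)) (hH 0)
            b θ (ν 0) (hν 0)
          rw [add_right_comm] at this
          refine le_trans (le_of_eq (lintegral_congr fun z => ?_)) this
          rw [add_assoc L, add_comm (∑ k : Fin K, (θ * y k) • H k.succ)]
      _ ≤ ENNReal.ofReal (trexp ((L + (b ^ 2 * θ ^ 2 / 2) • H 0 ^ 2) +
              (b ^ 2 * θ ^ 2 / 2) • ∑ k : Fin K, H k.succ ^ 2)) :=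
          ih (L + (b ^ 2 * θ ^ 2 / 2) • H 0 ^ 2) hL2 (fun k : Fin K => H k.succ)
            (fun k => hH k.succ) (fun k : Fin K => ν k.succ) (fun k => hν k.succ)
      _ = _ := by rw [Fin.sum_univ_succ, smul_add, add_assoc]

lemma trexp_eig {n : Type*} [Fintype n] [DecidableEq n] {A : Matrix n n ℝ}
    (hA : A.IsHermitian) (θ : ℝ) : trexp (θ • A) = ∑ i, Real.exp (θ * hA.eigenvalues i) := by
  obtain ⟨U, hU, h⟩ := exists_diag hA
  have : θ • A = U * diagonal (θ • hA.eigenvalues) * Uᵀ := by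
    rw [diagonal_smul, Matrix.mul_smul, Matrix.smul_mul, ← h]
  rw [this, trexp_diag U _ hU]
  simp

lemma le_trexp {n : Type*} [Fintype n] [DecidableEq n] [Nonempty n] {A : Matrix n n ℝ}
    (hA : A.IsHermitian) (θ t : ℝ) (hθ : 0 ≤ θ) (ht : t ≤ lambdaMax A) :
    Real.exp (θ * t) ≤ trexp (θ • A) := by
  unfold lambdaMax at ht
  rw [hA.spectrum_real_eq_range_eigenvalues] at ht
  obtain ⟨i, hi⟩ := (Set.range_nonempty hA.eigenvalues).csSup_mem (Set.finite_range _)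
  rw [← hi] at ht
  rw [trexp_eig hA]
  refine le_trans ?_ (Finset.single_le_sum (f := fun i => Real.exp (θ * hA.eigenvalues i))
    (fun i _ => (Real.exp_pos _).le) (Finset.mem_univ i))
  exact Real.exp_le_exp.mpr (mul_le_mul_of_nonneg_left ht hθ)

lemma eig_le_opNorm {n : Type*} [Fintype n] [DecidableEq n] {A : Matrix n n ℝ}
    (hA : A.IsHermitian) (i : n) : hA.eigenvalues i ≤ opNorm A := by
  unfold opNorm
  have h := (LinearMap.toContinuousLinearMap (Matrix.toEuclideanLin A)).le_opNorm
    (hA.eigenvectorBasis i)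
  have h2 : (LinearMap.toContinuousLinearMap (Matrix.toEuclideanLin A)) (hA.eigenvectorBasis i) =
      hA.eigenvalues i • hA.eigenvectorBasis i := by
    have := hA.mulVec_eigenvectorBasis i
    ext j
    simpa [Matrix.toEuclideanLin, Matrix.toLpLin_apply] using congrFun this j
  rw [h2, norm_smul, hA.eigenvectorBasis.norm_eq_one, mul_one, mul_one] at h
  exact (le_abs_self _).trans h

/-- **Theorem 3.3 (tail bound for matrix sub-Gaussian series).** Let `H₁, …, H_K` be fixed
`d × d` Hermitian matrices and `x₁, …, x_K` independent centered real random variables with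
sub-Gaussian mgf parameter `b`. With `ρ = ‖Σ_k H_k²‖`, for all `t ≥ 0` we have
`P(λ_max(Σ_k x_k H_k) ≥ t) ≤ d · exp(-t²/(2 b² ρ))`. -/
theorem matrix_subGaussian_series_tail
    {K d : ℕ} (hd : 0 < d) {Ω : Type*} [MeasurableSpace Ω]
    (μ : Measure Ω) [IsProbabilityMeasure μ]
    (H : Fin K → Matrix (Fin d) (Fin d) ℝ) (hH : ∀ k, (H k).IsHermitian)
    (x : Fin K → Ω → ℝ) (hmeas : ∀ k, Measurable (x k))
    (hindep : iIndepFun x μ)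
    (hcent : ∀ k, ∫ ω, x k ω ∂μ = 0)
    (b : ℝ) (hb : 0 < b)
    (hmgf : ∀ k, ∀ θ : ℝ, ∫⁻ ω, ENNReal.ofReal (Real.exp (θ * x k ω)) ∂μ ≤
      ENNReal.ofReal (Real.exp (b ^ 2 * θ ^ 2 / 2))) :
    ∀ t ≥ 0,
      μ {ω | lambdaMax (∑ k, x k ω • H k) ≥ t} ≤
        ENNReal.ofReal
          (d * Real.exp (-t ^ 2 / (2 * b ^ 2 * opNorm (∑ k, H k ^ 2)))) := by
  intro t ht
  have : Nonempty (Fin d) := ⟨⟨0, hd⟩⟩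
  set P := ∑ k, H k ^ 2 with hP
  have hPh : P.IsHermitian := isSelfAdjoint_sum _ fun k _ => (hH k).pow 2
  have hρ0 : 0 ≤ opNorm P := norm_nonneg _
  rcases hρ0.eq_or_lt with hρ | hρ
  · rw [← hρ]
    simp only [mul_zero, div_zero, Real.exp_zero, mul_one]
    refine prob_le_one.trans ?_
    rw [← ENNReal.ofReal_one]
    exact ENNReal.ofReal_le_ofReal (by exact_mod_cast hd)
  set ρ := opNorm P with hρd
  set θ := t / (b ^ 2 * ρ) with hθ
  have hθ0 : 0 ≤ θ := by positivity
  have hprob : ∀ k, IsProbabilityMeasure (μ.map (x k)) := fun k =>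
    Measure.isProbabilityMeasure_map (hmeas k).aemeasurable
  have hmap := (iIndepFun_iff_map_fun_eq_pi_map (fun k => (hmeas k).aemeasurable)).mp hindep
  have hmain := trexp_pi b θ 0 isHermitian_zero H hH (fun k => μ.map (x k)) (by
    intro k θ
    rw [lintegral_map (by fun_prop) (hmeas k)]
    exact hmgf k θ)
  rw [← hmap, lintegral_map (by
    apply ENNReal.measurable_ofReal.comp
    apply Continuous.measurable
    apply trexp_cont.comp
    fun_prop) (by fun_prop)] at hmain
  simp only [zero_add] at hmain
  have hsm : ∀ ω, ∑ k, (θ * x k ω) • H k = θ • ∑ k, x k ω • H k := fun ω => by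
    simp only [Finset.smul_sum, smul_smul]
  simp only [hsm] at hmain
  have hup : trexp ((b ^ 2 * θ ^ 2 / 2) • P) ≤ d * Real.exp (b ^ 2 * θ ^ 2 / 2 * ρ) := by
    rw [trexp_eig hPh]
    calc _ ≤ ∑ _i : Fin d, Real.exp (b ^ 2 * θ ^ 2 / 2 * ρ) := by
          apply Finset.sum_le_sum
          intro i _
          exact Real.exp_le_exp.mpr (mul_le_mul_of_nonneg_left (eig_le_opNorm hPh i) (by positivity))
      _ = _ := by simp
  have hmf : Measurable fun ω => ENNReal.ofReal (trexp (θ • ∑ k, x k ω • H k)) := by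
    apply ENNReal.measurable_ofReal.comp
    have : Continuous fun y : Fin K → ℝ => trexp (θ • ∑ k, y k • H k) := by
      apply trexp_cont.comp
      fun_prop
    exact this.measurable.comp (measurable_pi_lambda _ hmeas)
  have hE0 : ENNReal.ofReal (Real.exp (θ * t)) ≠ 0 := by
    simp [Real.exp_pos]
  calc _ ≤ μ {ω | ENNReal.ofReal (Real.exp (θ * t)) ≤
        ENNReal.ofReal (trexp (θ • ∑ k, x k ω • H k))} := by
        apply measure_mono
        intro ω hω
        apply ENNReal.ofReal_le_ofReal
        refine le_trexp ?_ θ t hθ0 hω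
        exact herm_sum _ _ hH
    _ ≤ (∫⁻ ω, ENNReal.ofReal (trexp (θ • ∑ k, x k ω • H k)) ∂μ) /
        ENNReal.ofReal (Real.exp (θ * t)) :=
        meas_ge_le_lintegral_div hmf.aemeasurable hE0 ENNReal.ofReal_ne_top
    _ ≤ ENNReal.ofReal (d * Real.exp (b ^ 2 * θ ^ 2 / 2 * ρ)) /
        ENNReal.ofReal (Real.exp (θ * t)) :=
        ENNReal.div_le_div_right (hmain.trans (ENNReal.ofReal_le_ofReal hup)) _
    _ = _ := by
        rw [← ENNReal.ofReal_div_of_pos (Real.exp_pos _), mul_div_assoc, ← Real.exp_sub]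
        congr 3
        rw [hθ]
        field_simp
        ring
end

section
/- Let {D_k : k = 1, …, K} be a finite sequence of fixed m×n matrices, and let {x_k : k = 1, …, K} be independent centered real random variables each satisfying E[exp(θ·x_k)] ≤ exp(b²·θ²/2) for all θ ∈ ℝ and some fixed b > 0. Set ρ = max{ ‖Σ_k D_k D_k^*‖, ‖Σ_k D_k^* D_k‖ }. Then for all t ≥ 0, P( ‖Σ_k x_k·D_k‖ ≥ t ) ≤ (m+n)·exp( -t²/(2·b²·ρ) ), where ‖·‖ denotes the operator (spectral) norm. -/
open MeasureTheory ProbabilityTheory Real Matrix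

set_option linter.unusedSectionVars false
set_option linter.style.haveILetI false

section
open NormedSpace Filter Topology
variable {𝔸 : Type*} [NormedRing 𝔸] [NormedAlgebra ℝ 𝔸] [CompleteSpace 𝔸] [NormOneClass 𝔸]

lemma gt_pow_sub (X Y : 𝔸) (c : ℝ) (hX : ‖X‖ ≤ c) (hY : ‖Y‖ ≤ c) (hc : 1 ≤ c) (n : ℕ) :
    ‖X ^ n - Y ^ n‖ ≤ n * c ^ n * ‖X - Y‖ := by
  induction n with
  | zero => simp
  | succ n ih =>
    have e : X ^ (n+1) - Y ^ (n+1) = X ^ n * (X - Y) + (X ^ n - Y ^ n) * Y := by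
      rw [pow_succ, pow_succ]; noncomm_ring
    have h1 : ‖X ^ n‖ ≤ c ^ n := (norm_pow_le X n).trans (by gcongr)
    have h0 := norm_nonneg (X - Y)
    have hcn : c ^ n ≤ c ^ (n+1) := pow_le_pow_right₀ hc (by simp)
    have hcp : 0 ≤ c ^ n := by positivity
    rw [e]
    calc _ ≤ ‖X ^ n‖ * ‖X - Y‖ + ‖X ^ n - Y ^ n‖ * ‖Y‖ :=
          (norm_add_le _ _).trans (add_le_add (norm_mul_le _ _) (norm_mul_le _ _))
      _ ≤ c ^ (n+1) * ‖X - Y‖ + (n * c ^ n * ‖X - Y‖) * c := by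
          gcongr
          exact h1.trans hcn
      _ = _ := by push_cast; ring

lemma gt_norm_exp (A : 𝔸) : ‖NormedSpace.exp A‖ ≤ Real.exp ‖A‖ := by
  rw [exp_eq_tsum (𝕂 := ℝ), Real.exp_eq_exp_ℝ, exp_eq_tsum (𝕂 := ℝ)]
  refine tsum_of_norm_bounded (g := fun n : ℕ => ((n.factorial : ℝ)⁻¹) • ‖A‖ ^ n) ?_ ?_
  · exact (expSeries_summable' (𝕂 := ℝ) ‖A‖).hasSum
  · intro n
    rw [norm_smul, smul_eq_mul]
    gcongr
    · simp
    · exact norm_pow_le _ _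

lemma gt_trotter (A B : 𝔸) :
    Tendsto (fun n : ℕ => (NormedSpace.exp ((n:ℝ)⁻¹ • A) * NormedSpace.exp ((n:ℝ)⁻¹ • B)) ^ n) atTop (𝓝 (NormedSpace.exp (A + B))) := by
  have d1 : HasDerivAt (fun t : ℝ => NormedSpace.exp (t • A) * NormedSpace.exp (t • B) - NormedSpace.exp (t • (A + B))) 0 0 := by
    have h1 := hasDerivAt_exp_smul_const A (0:ℝ)
    have h2 := hasDerivAt_exp_smul_const B (0:ℝ)
    have h3 := hasDerivAt_exp_smul_const (A + B) (0:ℝ)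
    have h4 := (h1.mul h2).sub h3
    have e : NormedSpace.exp ((0:ℝ) • A) * A * NormedSpace.exp ((0:ℝ) • B) + NormedSpace.exp ((0:ℝ) • A) * (NormedSpace.exp ((0:ℝ) • B) * B)
        - NormedSpace.exp ((0:ℝ) • (A + B)) * (A + B) = 0 := by simp
    rw [e] at h4
    exact h4
  have hs := d1.tendsto_slope_zero
  have ht : Tendsto (fun n : ℕ => (n:ℝ)⁻¹) atTop (𝓝[≠] 0) := by
    refine tendsto_nhdsWithin_iff.2 ⟨tendsto_inv_atTop_nhds_zero_nat, ?_⟩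
    filter_upwards [eventually_gt_atTop 0] with n hn
    simp; omega
  have hs2 := (hs.comp ht).norm.const_mul (Real.exp (‖A‖ + ‖B‖))
  simp only [norm_zero, mul_zero] at hs2
  rw [tendsto_iff_norm_sub_tendsto_zero]
  refine squeeze_zero' (Eventually.of_forall fun _ => norm_nonneg _) ?_ hs2
  filter_upwards [eventually_gt_atTop 0] with n hn
  have hn' : (0:ℝ) < n := by exact_mod_cast hn
  have hY : NormedSpace.exp (A + B) = (NormedSpace.exp ((n:ℝ)⁻¹ • (A + B))) ^ n := by
    letI : NormedAlgebra ℚ 𝔸 := NormedAlgebra.restrictScalars ℚ ℝ 𝔸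
    rw [← NormedSpace.exp_nsmul]
    congr 1
    rw [← Nat.cast_smul_eq_nsmul ℝ, smul_smul, mul_inv_cancel₀ hn'.ne', one_smul]
  have key := gt_pow_sub (NormedSpace.exp ((n:ℝ)⁻¹ • A) * NormedSpace.exp ((n:ℝ)⁻¹ • B)) (NormedSpace.exp ((n:ℝ)⁻¹ • (A + B)))
    (Real.exp ((n:ℝ)⁻¹ * (‖A‖ + ‖B‖))) ?_ ?_ ?_ n
  · rw [hY]
    refine key.trans (le_of_eq ?_)
    rw [← Real.exp_nat_mul, mul_inv_cancel_left₀ hn'.ne']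
    simp [norm_smul]
    ring
  · rw [mul_add, Real.exp_add]
    refine (norm_mul_le _ _).trans ?_
    gcongr
    · refine (gt_norm_exp _).trans (le_of_eq ?_); rw [norm_smul]; simp
    · refine (gt_norm_exp _).trans (le_of_eq ?_); rw [norm_smul]; simp
  · refine (gt_norm_exp _).trans ?_
    rw [norm_smul, norm_inv, Real.norm_natCast]
    gcongr
    exact norm_add_le _ _
  · exact Real.one_le_exp (by positivity)

end

section
open NormedSpace Filter Topology
variable {d : Type*} [Fintype d] [DecidableEq d]

lemma gt_cs (X Y : Matrix d d ℝ) :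
    (X * Yᵀ).trace ≤ √((X * Xᵀ).trace) * √((Y * Yᵀ).trace) := by
  have e : ∀ X Y : Matrix d d ℝ, (X * Yᵀ).trace = ∑ p : d × d, X p.1 p.2 * Y p.1 p.2 := by
    intro X Y
    simp [Matrix.trace, Matrix.mul_apply, Fintype.sum_prod_type]
  rw [e, e, e]
  have := Real.sum_mul_le_sqrt_mul_sqrt Finset.univ (fun p : d × d => X p.1 p.2) (fun p : d × d => Y p.1 p.2)
  simpa [pow_two] using this

lemma gt_trace_pow_comm (X Y : Matrix d d ℝ) (n : ℕ) (hn : n ≠ 0) :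
    ((X * Y) ^ n).trace = ((Y * X) ^ n).trace := by
  obtain ⟨k, rfl⟩ := Nat.exists_eq_succ_of_ne_zero hn
  have : (X * Y) ^ (k+1) = X * ((Y * X) ^ k * Y) := by
    rw [pow_succ', mul_assoc]
    congr 1
    induction k with
    | zero => simp
    | succ k ih => rw [pow_succ', pow_succ' (Y * X)]; simp only [mul_assoc]; rw [ih (by simp)]
  rw [Nat.succ_eq_add_one, this, Matrix.trace_mul_comm, pow_succ, mul_assoc]

/-- W k : |tr Z^(2^(k+1))| ≤ tr (Z Zᵀ)^(2^k). -/
def GTW (d : Type*) [Fintype d] [DecidableEq d] (k : ℕ) : Prop :=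
  ∀ Z : Matrix d d ℝ, (Z ^ (2 ^ (k+1))).trace ≤ ((Z * Zᵀ) ^ (2 ^ k)).trace

lemma gt_chain (k : ℕ) (h : ∀ j < k, GTW d j) (P Q : Matrix d d ℝ) (hP : Pᵀ = P) (hQ : Qᵀ = Q) :
    ((P * Q) ^ (2 ^ k)).trace ≤ (P ^ (2 ^ k) * Q ^ (2 ^ k)).trace := by
  induction k generalizing P Q with
  | zero => simp
  | succ k ih =>
    have h1 := h k (by simp) (P * Q)
    have h2 : ((P * Q) * (P * Q)ᵀ) = P * (Q ^ 2 * P) := by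
      rw [Matrix.transpose_mul, hP, hQ]; simp [pow_two, mul_assoc]
    rw [h2, gt_trace_pow_comm P (Q ^ 2 * P) _ (by positivity), mul_assoc, ← pow_two,
      gt_trace_pow_comm (Q ^ 2) (P ^ 2) _ (by positivity)] at h1
    have h3 := ih (fun j hj => h j (by omega)) (P ^ 2) (Q ^ 2)
      (by rw [Matrix.transpose_pow, hP]) (by rw [Matrix.transpose_pow, hQ])
    rw [← pow_mul, ← pow_mul, ← pow_succ'] at h3
    exact h1.trans h3

lemma gt_W (k : ℕ) : GTW d k := by
  induction k using Nat.strong_induction_on with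
  | _ k ih =>
  intro Z
  rcases k with _ | k
  · have := gt_cs Z Zᵀ
    simp only [Matrix.transpose_transpose] at this
    rw [Matrix.trace_mul_comm Zᵀ Z, Real.mul_self_sqrt] at this
    · simpa [pow_two] using this
    · simp only [Matrix.trace, Matrix.diag, Matrix.mul_apply, Matrix.transpose_apply]
      exact Finset.sum_nonneg fun _ _ => Finset.sum_nonneg fun _ _ => mul_self_nonneg _
  · have h1 := ih k (by simp) (Z ^ 2)
    have e : Z ^ 2 * (Z ^ 2)ᵀ = Z * ((Z * Zᵀ) * Zᵀ) := by
      simp [pow_two, mul_assoc]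
    rw [e, gt_trace_pow_comm Z _ _ (by positivity), mul_assoc] at h1
    have hP : (Z * Zᵀ)ᵀ = Z * Zᵀ := by simp
    have hQ : (Zᵀ * Z)ᵀ = Zᵀ * Z := by simp
    have h2 := gt_chain k (fun j hj => ih j (by omega)) _ _ hP hQ
    have h3 := gt_cs ((Z * Zᵀ) ^ 2 ^ k) ((Zᵀ * Z) ^ 2 ^ k)
    rw [Matrix.transpose_pow, Matrix.transpose_pow, hP, hQ, ← pow_two, ← pow_two, ← pow_mul,
      ← pow_mul, ← pow_succ, gt_trace_pow_comm Zᵀ Z _ (by positivity), Real.mul_self_sqrt] at h3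
    · rw [← pow_mul, ← pow_succ'] at h1
      exact h1.trans (h2.trans h3)
    · have : (Z * Zᵀ) ^ 2 ^ (k+1) = ((Z * Zᵀ) ^ 2 ^ k) * ((Z * Zᵀ) ^ 2 ^ k)ᵀ := by
        rw [Matrix.transpose_pow, hP, ← pow_two, ← pow_mul, ← pow_succ]
      rw [this]
      simp only [Matrix.trace, Matrix.diag, Matrix.mul_apply, Matrix.transpose_apply]
      exact Finset.sum_nonneg fun _ _ => Finset.sum_nonneg fun _ _ => mul_self_nonneg _

lemma gt_trotter_matrix [Nonempty d] (A B : Matrix d d ℝ) :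
    Tendsto (fun n : ℕ => (NormedSpace.exp ((n:ℝ)⁻¹ • A) * NormedSpace.exp ((n:ℝ)⁻¹ • B)) ^ n) atTop (𝓝 (NormedSpace.exp (A + B))) := by
  letI : NormedRing (Matrix d d ℝ) := Matrix.linftyOpNormedRing
  letI : NormedAlgebra ℝ (Matrix d d ℝ) := Matrix.linftyOpNormedAlgebra
  haveI : NormOneClass (Matrix d d ℝ) := Matrix.linfty_opNormOneClass
  exact gt_trotter A B

lemma golden_thompson (A B : Matrix d d ℝ) (hA : Aᵀ = A) (hB : Bᵀ = B) :
    (NormedSpace.exp (A + B)).trace ≤ (NormedSpace.exp A * NormedSpace.exp B).trace := by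
  cases isEmpty_or_nonempty d
  · simp [Matrix.trace]
  have h := gt_trotter_matrix A B
  have h2 := h.comp (tendsto_pow_atTop_atTop_of_one_lt (r := 2) (by norm_num))
  have h3 := ((continuous_id.matrix_trace).tendsto _).comp h2
  refine le_of_tendsto h3 (Eventually.of_forall fun k => ?_)
  have := gt_chain k (fun j _ => gt_W j) (NormedSpace.exp (((2 ^ k : ℕ) : ℝ)⁻¹ • A)) (NormedSpace.exp (((2 ^ k : ℕ) : ℝ)⁻¹ • B))
    (by rw [← Matrix.exp_transpose, Matrix.transpose_smul, hA])
    (by rw [← Matrix.exp_transpose, Matrix.transpose_smul, hB])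
  rw [← Matrix.exp_nsmul, ← Matrix.exp_nsmul] at this
  have e : ∀ A : Matrix d d ℝ, (2 ^ k) • (((2 ^ k : ℕ) : ℝ)⁻¹ • A) = A := by
    intro A
    rw [← Nat.cast_smul_eq_nsmul ℝ, smul_smul, mul_inv_cancel₀ (by positivity), one_smul]
  rw [e, e] at this
  exact this

end

section C
variable {d : Type*} [Fintype d] [DecidableEq d]

lemma sg_spec (A : Matrix d d ℝ) (hA : Aᵀ = A) : ∃ (U : Matrix d d ℝ) (a : d → ℝ),
    Uᵀ * U = 1 ∧ U * Uᵀ = 1 ∧ A = U * diagonal a * Uᵀ := by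
  have h : A.IsHermitian := by rw [Matrix.IsHermitian, Matrix.conjTranspose_eq_transpose_of_trivial, hA]
  refine ⟨h.eigenvectorUnitary, h.eigenvalues, ?_, ?_, ?_⟩
  · have := Unitary.coe_star_mul_self h.eigenvectorUnitary
    rwa [Matrix.star_eq_conjTranspose, Matrix.conjTranspose_eq_transpose_of_trivial] at this
  · have := Unitary.coe_mul_star_self h.eigenvectorUnitary
    rwa [Unitary.coe_star, Matrix.star_eq_conjTranspose, Matrix.conjTranspose_eq_transpose_of_trivial] at this
  · have := h.spectral_theorem
    rw [Unitary.conjStarAlgAut_apply, Matrix.star_eq_conjTranspose,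
      Matrix.conjTranspose_eq_transpose_of_trivial] at this
    exact this

lemma sg_exp_spec (U : Matrix d d ℝ) (a : d → ℝ) (h2 : U * Uᵀ = 1) :
    NormedSpace.exp (U * diagonal a * Uᵀ) = U * diagonal (fun i => Real.exp (a i)) * Uᵀ := by
  have hu : IsUnit U := (Matrix.isUnit_iff_isUnit_det _).2 (Matrix.isUnit_det_of_right_inverse h2)
  have hi : U⁻¹ = Uᵀ := Matrix.inv_eq_right_inv h2
  have := Matrix.exp_conj U (diagonal a) hu
  rw [hi] at this
  rw [this, Matrix.exp_diagonal]
  congr 3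
  funext i
  rw [Pi.coe_exp, Real.exp_eq_exp_ℝ]

lemma sg_trace_spec (U : Matrix d d ℝ) (a : d → ℝ) (h1 : Uᵀ * U = 1) :
    (U * diagonal a * Uᵀ).trace = ∑ i, a i := by
  rw [Matrix.trace_mul_comm, ← mul_assoc, h1, one_mul, Matrix.trace_diagonal]

lemma sg_quad (U : Matrix d d ℝ) (a : d → ℝ) (v : d → ℝ) :
    v ⬝ᵥ ((U * diagonal a * Uᵀ) *ᵥ v) = ∑ i, a i * (Uᵀ *ᵥ v) i ^ 2 := by
  rw [← Matrix.mulVec_mulVec, ← Matrix.mulVec_mulVec, Matrix.dotProduct_mulVec,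
    ← Matrix.mulVec_transpose]
  simp only [dotProduct, Matrix.mulVec_diagonal]
  exact Finset.sum_congr rfl fun i _ => by ring

lemma sg_quad_one (U : Matrix d d ℝ) (h2 : U * Uᵀ = 1) (v : d → ℝ) :
    v ⬝ᵥ v = ∑ i, (Uᵀ *ᵥ v) i ^ 2 := by
  have := sg_quad U (fun _ => 1) v
  simpa [h2] using this

lemma sg_lower (Y : Matrix d d ℝ) (hY : Yᵀ = Y) (v : d → ℝ) :
    v ⬝ᵥ (Y *ᵥ v) ≤ Real.log (NormedSpace.exp Y).trace * (v ⬝ᵥ v) := by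
  obtain ⟨U, a, h1, h2, rfl⟩ := sg_spec Y hY
  rw [sg_exp_spec U a h2, sg_trace_spec _ _ h1, sg_quad, sg_quad_one U h2, Finset.mul_sum]
  refine Finset.sum_le_sum fun i _ => mul_le_mul_of_nonneg_right ?_ (sq_nonneg _)
  have h : Real.exp (a i) ≤ ∑ j, Real.exp (a j) :=
    Finset.single_le_sum (f := fun j => Real.exp (a j)) (fun j _ => (Real.exp_pos _).le) (Finset.mem_univ i)
  exact (Real.le_log_iff_exp_le (lt_of_lt_of_le (Real.exp_pos _) h)).2 h

lemma sg_trace_exp_pos [Nonempty d] (Y : Matrix d d ℝ) (hY : Yᵀ = Y) :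
    0 < (NormedSpace.exp Y).trace := by
  obtain ⟨U, a, h1, h2, rfl⟩ := sg_spec Y hY
  rw [sg_exp_spec U a h2, sg_trace_spec _ _ h1]
  exact Finset.sum_pos (fun _ _ => Real.exp_pos _) Finset.univ_nonempty

lemma sg_upper (V : Matrix d d ℝ) (hV : Vᵀ = V) (r : ℝ)
    (h : ∀ v : d → ℝ, v ⬝ᵥ (V *ᵥ v) ≤ r * (v ⬝ᵥ v)) :
    (NormedSpace.exp V).trace ≤ Fintype.card d * Real.exp r := by
  obtain ⟨U, a, h1, h2, rfl⟩ := sg_spec V hV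
  rw [sg_exp_spec U a h2, sg_trace_spec _ _ h1]
  have : ∑ i : d, Real.exp (a i) ≤ ∑ i : d, Real.exp r := by
    refine Finset.sum_le_sum fun i _ => Real.exp_le_exp.2 ?_
    have := h (U *ᵥ Pi.single i 1)
    rw [sg_quad, sg_quad_one U h2, Matrix.mulVec_mulVec, h1] at this
    simpa [Matrix.one_apply, ite_pow] using this
  simpa using this

lemma sg_exp_diag_nonneg (M U : Matrix d d ℝ) (hM : Mᵀ = M) (i : d) :
    0 ≤ (Uᵀ * NormedSpace.exp M * U) i i := by
  obtain ⟨W, a, h1, h2, rfl⟩ := sg_spec M hM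
  rw [sg_exp_spec W a h2]
  have : Uᵀ * (W * diagonal (fun i => Real.exp (a i)) * Wᵀ) * U
      = (Uᵀ * W) * diagonal (fun i => Real.exp (a i)) * (Uᵀ * W)ᵀ := by
    simp [Matrix.transpose_mul, mul_assoc]
  rw [this, Matrix.mul_apply]
  refine Finset.sum_nonneg fun j _ => ?_
  rw [Matrix.mul_diagonal, Matrix.transpose_apply]
  nlinarith [mul_nonneg (Real.exp_pos (a j)).le (mul_self_nonneg ((Uᵀ * W) i j))]

lemma sg_step (A : Matrix d d ℝ) (hA : Aᵀ = A) (c : ℝ) : ∃ (U : Matrix d d ℝ) (a : d → ℝ),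
    U * Uᵀ = 1 ∧ ∀ (M : Matrix d d ℝ), Mᵀ = M → ∀ x : ℝ,
      (NormedSpace.exp (M + x • A)).trace ≤
        ∑ i, (Uᵀ * NormedSpace.exp (M + (c/2) • (A * A)) * U) i i *
          Real.exp (x * a i - c / 2 * a i ^ 2) := by
  obtain ⟨U, a, h1, h2, rfl⟩ := sg_spec A hA
  refine ⟨U, a, h2, fun M hM x => ?_⟩
  set A := U * diagonal a * Uᵀ with hAdef
  have hAA : A * A = U * diagonal (fun i => a i ^ 2) * Uᵀ := by
    calc A * A = U * diagonal a * (Uᵀ * U) * diagonal a * Uᵀ := by simp [hAdef, mul_assoc]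
      _ = _ := by rw [h1, mul_one, mul_assoc U, Matrix.diagonal_mul_diagonal]; simp [pow_two]
  have hW : x • A - (c/2) • (A * A) = U * diagonal (fun i => x * a i - c / 2 * a i ^ 2) * Uᵀ := by
    rw [hAA, hAdef]
    have : diagonal (fun i => x * a i - c / 2 * a i ^ 2) =
        x • diagonal a - (c/2) • diagonal (fun i => a i ^ 2) := by
      ext i j; by_cases hij : i = j <;> simp [hij]
    rw [this]; simp [mul_sub, sub_mul]
  have gt := golden_thompson (M + (c/2) • (A * A)) (x • A - (c/2) • (A * A))
    (by simp [hM, hA]) (by simp [hA])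
  rw [hW, sg_exp_spec U _ h2] at gt
  have e1 : M + (c/2) • (A * A) + U * diagonal (fun i => x * a i - c / 2 * a i ^ 2) * Uᵀ = M + x • A := by
    rw [← hW]; abel
  rw [e1] at gt
  refine gt.trans (le_of_eq ?_)
  rw [← mul_assoc, Matrix.trace_mul_comm, ← mul_assoc, ← mul_assoc]
  simp only [Matrix.trace, Matrix.diag, Matrix.mul_diagonal]

lemma sg_trace_conj (U M : Matrix d d ℝ) (h2 : U * Uᵀ = 1) :
    ∑ i, (Uᵀ * M * U) i i = M.trace := by
  have : (Uᵀ * M * U).trace = M.trace := by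
    rw [Matrix.trace_mul_comm, ← mul_assoc, h2, one_mul]
  exact this

lemma sg_exp_cont : Continuous (NormedSpace.exp : Matrix d d ℝ → Matrix d d ℝ) := by
  let : NormedRing (Matrix d d ℝ) := Matrix.linftyOpNormedRing
  let : NormedAlgebra ℝ (Matrix d d ℝ) := Matrix.linftyOpNormedAlgebra
  let : NormedAlgebra ℚ (Matrix d d ℝ) := NormedAlgebra.restrictScalars ℚ ℝ _
  exact NormedSpace.exp_continuous

end C
section D
variable {d : Type*} [Fintype d] [DecidableEq d]

lemma sg_expect {ι : Type*} [DecidableEq ι] {Ω : Type*} [MeasurableSpace Ω]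
    (μ : Measure Ω) [IsProbabilityMeasure μ]
    (A : ι → Matrix d d ℝ) (hA : ∀ k, (A k)ᵀ = A k)
    (x : ι → Ω → ℝ) (hmeas : ∀ k, Measurable (x k)) (hindep : iIndepFun x μ) (c : ℝ)
    (hmgf : ∀ k, ∀ θ : ℝ, ∫⁻ ω, ENNReal.ofReal (Real.exp (θ * x k ω)) ∂μ ≤
      ENNReal.ofReal (Real.exp (c * θ ^ 2 / 2))) (s : Finset ι) :
    ∀ H : Matrix d d ℝ, Hᵀ = H →
    ∫⁻ ω, ENNReal.ofReal (NormedSpace.exp (H + ∑ k ∈ s, x k ω • A k)).trace ∂μ ≤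
      ENNReal.ofReal (NormedSpace.exp (H + (c/2) • ∑ k ∈ s, A k * A k)).trace := by
  induction s using Finset.induction_on with
  | empty => intro H _; simp
  | insert k s hk ih =>
    intro H hH
    obtain ⟨U, a, h2, hstep⟩ := sg_step (A k) (hA k) c
    have hsym : ∀ y : ι → ℝ, (∑ j ∈ s, y j • A j)ᵀ = ∑ j ∈ s, y j • A j := by
      intro y; simp [Matrix.transpose_sum, hA]
    set H' := H + (c/2) • (A k * A k) with hH'
    have hH's : H'ᵀ = H' := by simp [hH', hH, hA]
    let F : d → (s → ℝ) → ℝ := fun i y => (Uᵀ * NormedSpace.exp (H' + ∑ j : s, y j • A j) * U) i i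
    have hFc : ∀ i, Continuous (F i) := by
      intro i
      have h1 : Continuous fun y : s → ℝ => NormedSpace.exp (H' + ∑ j : s, y j • A j) :=
        sg_exp_cont.comp (by fun_prop)
      have h3 : Continuous fun y : s → ℝ => Uᵀ * NormedSpace.exp (H' + ∑ j : s, y j • A j) * U :=
        (continuous_const.matrix_mul h1).matrix_mul continuous_const
      exact h3.matrix_elem i i
    have hFsum : ∀ i ω, F i (fun j : s => x j ω) =
        (Uᵀ * NormedSpace.exp (H' + ∑ j ∈ s, x j ω • A j) * U) i i := by
      intro i ω
      simp only [F]
      rw [Finset.sum_coe_sort s (fun j => x j ω • A j)]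
    have hF0 : ∀ i ω, 0 ≤ F i (fun j : s => x j ω) := by
      intro i ω
      rw [hFsum]
      exact sg_exp_diag_nonneg _ _ (by rw [Matrix.transpose_add, hH's, hsym fun j => x j ω]) i
    let G : d → ℝ → ℝ := fun i z => Real.exp (z * a i - c / 2 * a i ^ 2)
    have hGm : ∀ i, Measurable (G i) := fun i => by fun_prop
    have hxm : Measurable (fun ω (j : s) => x j ω) := measurable_pi_lambda _ fun j => hmeas j
    have hG1 : ∀ i, ∫⁻ ω, ENNReal.ofReal (G i (x k ω)) ∂μ ≤ 1 := by
      intro i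
      have e : ∀ ω, ENNReal.ofReal (G i (x k ω)) =
          ENNReal.ofReal (Real.exp (- (c / 2 * a i ^ 2))) * ENNReal.ofReal (Real.exp (a i * x k ω)) := by
        intro ω
        rw [← ENNReal.ofReal_mul (Real.exp_pos _).le, ← Real.exp_add]
        simp only [G]
        congr 2; ring
      simp_rw [e]
      rw [lintegral_const_mul _ (by have := hmeas k; fun_prop)]
      calc _ ≤ ENNReal.ofReal (Real.exp (- (c / 2 * a i ^ 2))) *
            ENNReal.ofReal (Real.exp (c * a i ^ 2 / 2)) := by gcongr; exact hmgf k (a i)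
        _ = 1 := by
          rw [← ENNReal.ofReal_mul (Real.exp_pos _).le, ← Real.exp_add]
          ring_nf; simp
    have hind : IndepFun (fun ω (j : s) => x j ω) (x k) μ := by
      have h := hindep.indepFun_finset s {k} (by simpa using hk) hmeas
      exact h.comp (φ := id) (ψ := fun y : (({k} : Finset ι) → ℝ) => y ⟨k, by simp⟩)
        measurable_id (measurable_pi_apply _)
    have hprod : ∀ i, ∫⁻ ω, ENNReal.ofReal (F i (fun j : s => x j ω)) * ENNReal.ofReal (G i (x k ω)) ∂μ
        ≤ ∫⁻ ω, ENNReal.ofReal (F i (fun j : s => x j ω)) ∂μ := by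
      intro i
      have hm1 : Measurable fun y => ENNReal.ofReal (F i y) := (hFc i).measurable.ennreal_ofReal
      have hm2 : Measurable fun y => ENNReal.ofReal (G i y) := (hGm i).ennreal_ofReal
      have := lintegral_mul_eq_lintegral_mul_lintegral_of_indepFun (hm1.comp hxm) (hm2.comp (hmeas k))
        (hind.comp hm1 hm2)
      simp only [Pi.mul_apply, Function.comp_apply] at this
      rw [this]
      exact mul_le_of_le_one_right' (hG1 i)
    calc ∫⁻ ω, ENNReal.ofReal (NormedSpace.exp (H + ∑ j ∈ insert k s, x j ω • A j)).trace ∂μ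
        ≤ ∫⁻ ω, ∑ i, ENNReal.ofReal (F i (fun j : s => x j ω)) * ENNReal.ofReal (G i (x k ω)) ∂μ := by
          refine lintegral_mono fun ω => ?_
          have h := hstep (H + ∑ j ∈ s, x j ω • A j)
            (by rw [Matrix.transpose_add, hH, hsym fun j => x j ω]) (x k ω)
          have e1 : H + ∑ j ∈ insert k s, x j ω • A j = H + ∑ j ∈ s, x j ω • A j + x k ω • A k := by
            rw [Finset.sum_insert hk]; abel
          have e2 : H + ∑ j ∈ s, x j ω • A j + (c/2) • (A k * A k) = H' + ∑ j ∈ s, x j ω • A j := by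
            rw [hH']; abel
          rw [← e1, e2] at h
          refine (ENNReal.ofReal_le_ofReal h).trans (le_of_eq ?_)
          rw [ENNReal.ofReal_sum_of_nonneg]
          · refine Finset.sum_congr rfl fun i _ => ?_
            rw [← hFsum, ENNReal.ofReal_mul (hF0 i ω)]
          · intro i _
            rw [← hFsum]
            exact mul_nonneg (hF0 i ω) (Real.exp_pos _).le
      _ = ∑ i, ∫⁻ ω, ENNReal.ofReal (F i (fun j : s => x j ω)) * ENNReal.ofReal (G i (x k ω)) ∂μ := by
          refine lintegral_finsetSum _ fun i _ => ?_
          exact ((hFc i).measurable.comp hxm).ennreal_ofReal.mul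
            ((hGm i).comp (hmeas k)).ennreal_ofReal
      _ ≤ ∑ i, ∫⁻ ω, ENNReal.ofReal (F i (fun j : s => x j ω)) ∂μ :=
          Finset.sum_le_sum fun i _ => hprod i
      _ = ∫⁻ ω, ∑ i, ENNReal.ofReal (F i (fun j : s => x j ω)) ∂μ := by
          refine (lintegral_finsetSum _ fun i _ => ?_).symm
          exact ((hFc i).measurable.comp hxm).ennreal_ofReal
      _ = ∫⁻ ω, ENNReal.ofReal (NormedSpace.exp (H' + ∑ j ∈ s, x j ω • A j)).trace ∂μ := by
          refine lintegral_congr fun ω => ?_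
          rw [← ENNReal.ofReal_sum_of_nonneg fun i _ => hF0 i ω]
          simp_rw [hFsum]
          rw [sg_trace_conj _ _ h2]
      _ ≤ _ := ih H' hH's
      _ = _ := by
          rw [hH', Finset.sum_insert hk, smul_add, add_assoc]

end D

section E
variable {m n : Type*} [Fintype m] [Fintype n] [DecidableEq m] [DecidableEq n]

lemma sg_norm_sq (w : n → ℝ) : ‖WithLp.toLp 2 w‖ ^ 2 = w ⬝ᵥ w := by
  rw [EuclideanSpace.norm_sq_eq]
  simp [dotProduct, pow_two]

lemma sg_opNorm_quad (S : Matrix n n ℝ) (u : n → ℝ) :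
    u ⬝ᵥ (S *ᵥ u) ≤ opNorm S * (u ⬝ᵥ u) := by
  have h1 := (LinearMap.toContinuousLinearMap (Matrix.toEuclideanLin S)).le_opNorm (WithLp.toLp 2 u)
  have h2 := real_inner_le_norm (WithLp.toLp 2 u)
    (LinearMap.toContinuousLinearMap (Matrix.toEuclideanLin S) (WithLp.toLp 2 u))
  have e : inner ℝ (WithLp.toLp 2 u)
    (LinearMap.toContinuousLinearMap (Matrix.toEuclideanLin S) (WithLp.toLp 2 u)) = u ⬝ᵥ (S *ᵥ u) := by
    simp [PiLp.inner_apply, dotProduct, mul_comm, Matrix.toLpLin_apply]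
  rw [e] at h2
  rw [← sg_norm_sq]
  unfold opNorm
  have := norm_nonneg (WithLp.toLp 2 u)
  nlinarith

/-- dilation -/
def sgDil (B : Matrix m n ℝ) : Matrix (m ⊕ n) (m ⊕ n) ℝ := Matrix.fromBlocks 0 B Bᵀ 0

lemma sgDil_symm (B : Matrix m n ℝ) : (sgDil B)ᵀ = sgDil B := by
  simp [sgDil, Matrix.fromBlocks_transpose]

lemma sgDil_sum {ι : Type*} (s : Finset ι) (y : ι → ℝ) (B : ι → Matrix m n ℝ) :
    sgDil (∑ k ∈ s, y k • B k) = ∑ k ∈ s, y k • sgDil (B k) := by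
  ext i j
  rcases i with i | i <;> rcases j with j | j <;> simp [sgDil, Matrix.sum_apply]

lemma sgDil_quad (B : Matrix m n ℝ) (u : m → ℝ) (w : n → ℝ) :
    Sum.elim u w ⬝ᵥ (sgDil B *ᵥ Sum.elim u w) = 2 * (u ⬝ᵥ (B *ᵥ w)) := by
  rw [sgDil, Matrix.fromBlocks_mulVec]
  simp only [Sum.elim_comp_inl, Sum.elim_comp_inr, sumElim_dotProduct_sumElim]
  have : w ⬝ᵥ (Bᵀ *ᵥ u) = u ⬝ᵥ (B *ᵥ w) := by
    rw [Matrix.mulVec_transpose, Matrix.dotProduct_mulVec, dotProduct_comm]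
  simp [this]; ring

lemma sgDil_norm [Nonempty (m ⊕ n)] (B : Matrix m n ℝ) (θ : ℝ) (hθ : 0 < θ) :
    Real.exp (θ * opNorm B) ≤ (NormedSpace.exp (θ • sgDil B)).trace := by
  have hs : (θ • sgDil B)ᵀ = θ • sgDil B := by rw [Matrix.transpose_smul, sgDil_symm]
  have hpos := sg_trace_exp_pos _ hs
  rw [← Real.le_log_iff_exp_le hpos]
  have hl := sg_lower _ hs
  set R := Real.log (NormedSpace.exp (θ • sgDil B)).trace
  have hq : ∀ u w, 2 * θ * (u ⬝ᵥ (B *ᵥ w)) ≤ R * (u ⬝ᵥ u + w ⬝ᵥ w) := by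
    intro u w
    have := hl (Sum.elim u w)
    rw [Matrix.smul_mulVec, dotProduct_smul, sgDil_quad, sumElim_dotProduct_sumElim, smul_eq_mul] at this
    linarith
  have hR : 0 ≤ R := by
    obtain ⟨i⟩ := ‹Nonempty (m ⊕ n)›
    rcases i with i | i
    · have := hq (Pi.single i 1) 0
      simpa using this
    · have := hq 0 (Pi.single i 1)
      simpa using this
  rw [mul_comm, ← le_div_iff₀ hθ]
  refine ContinuousLinearMap.opNorm_le_bound _ (by positivity) fun w => ?_
  have e : LinearMap.toContinuousLinearMap (Matrix.toEuclideanLin B) w = WithLp.toLp 2 (B *ᵥ w.ofLp) := by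
    simp [Matrix.toLpLin_apply]
  rw [e]
  set p := ‖WithLp.toLp 2 (B *ᵥ w.ofLp)‖ with hp
  set q := ‖w‖ with hq'
  have hp2 : p ^ 2 = (B *ᵥ w.ofLp) ⬝ᵥ (B *ᵥ w.ofLp) := sg_norm_sq _
  have hq2 : q ^ 2 = w.ofLp ⬝ᵥ w.ofLp := sg_norm_sq _
  have hp0 : 0 ≤ p := norm_nonneg _
  have hq0 : 0 ≤ q := norm_nonneg _
  rcases hp0.eq_or_lt with h | hp0
  · rw [← h]; positivity
  rcases hq0.eq_or_lt with h | hq0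
  · have : w = 0 := norm_eq_zero.1 h.symm
    exfalso
    apply hp0.ne'
    rw [hp, this]; simp
  have := hq (q • (B *ᵥ w.ofLp)) (p • w.ofLp)
  simp only [Matrix.mulVec_smul, smul_dotProduct, dotProduct_smul, smul_eq_mul, ← hp2, ← hq2] at this
  rw [div_mul_eq_mul_div, le_div_iff₀ hθ]
  have h3 : (2 * p ^ 2 * q) * (p * θ) ≤ (2 * p ^ 2 * q) * (R * q) := by nlinarith
  exact le_of_mul_le_mul_left h3 (by positivity)

lemma sgDil_sq (B : Matrix m n ℝ) : sgDil B * sgDil B = Matrix.fromBlocks (B * Bᴴ) 0 0 (Bᴴ * B) := by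
  simp [sgDil, Matrix.fromBlocks_multiply, Matrix.conjTranspose_eq_transpose_of_trivial]

lemma sgDil_sq_quad {ι : Type*} (s : Finset ι) (B : ι → Matrix m n ℝ) (v : m ⊕ n → ℝ) :
    v ⬝ᵥ ((∑ k ∈ s, sgDil (B k) * sgDil (B k)) *ᵥ v) ≤
      max (opNorm (∑ k ∈ s, B k * (B k)ᴴ)) (opNorm (∑ k ∈ s, (B k)ᴴ * B k)) * (v ⬝ᵥ v) := by
  have e : ∑ k ∈ s, sgDil (B k) * sgDil (B k) =
      Matrix.fromBlocks (∑ k ∈ s, B k * (B k)ᴴ) 0 0 (∑ k ∈ s, (B k)ᴴ * B k) := by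
    simp_rw [sgDil_sq]
    ext i j
    rcases i with i | i <;> rcases j with j | j <;> simp [Matrix.sum_apply]
  obtain ⟨u, w, rfl⟩ : ∃ u w, v = Sum.elim u w := ⟨v ∘ Sum.inl, v ∘ Sum.inr, by simp⟩
  rw [e, Matrix.fromBlocks_mulVec]
  simp only [Sum.elim_comp_inl, Sum.elim_comp_inr, sumElim_dotProduct_sumElim, Matrix.zero_mulVec,
    add_zero, zero_add, mul_add]
  have hu : 0 ≤ u ⬝ᵥ u := by rw [← sg_norm_sq]; positivity
  have hw : 0 ≤ w ⬝ᵥ w := by rw [← sg_norm_sq]; positivity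
  refine add_le_add ((sg_opNorm_quad _ u).trans ?_) ((sg_opNorm_quad _ w).trans ?_)
  · exact mul_le_mul_of_nonneg_right (le_max_left _ _) hu
  · exact mul_le_mul_of_nonneg_right (le_max_right _ _) hw

end E

/-- **Corollary 3.4 (rectangular matrix sub-Gaussian series).** Let `D₁, …, D_K` be fixed
`m × n` matrices and `x₁, …, x_K` independent centered real random variables with
sub-Gaussian mgf parameter `b`. With
`ρ = max{‖Σ_k D_k D_k^*‖, ‖Σ_k D_k^* D_k‖}`, for all `t ≥ 0` we have
`P(‖Σ_k x_k D_k‖ ≥ t) ≤ (m + n) · exp(-t²/(2 b² ρ))`. -/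
theorem rectangular_matrix_subGaussian_series_tail
    {K m n : ℕ} (hmn : 0 < m + n) {Ω : Type*} [MeasurableSpace Ω]
    (μ : Measure Ω) [IsProbabilityMeasure μ]
    (D : Fin K → Matrix (Fin m) (Fin n) ℝ)
    (x : Fin K → Ω → ℝ) (hmeas : ∀ k, Measurable (x k))
    (hindep : iIndepFun x μ)
    (hcent : ∀ k, ∫ ω, x k ω ∂μ = 0)
    (b : ℝ) (hb : 0 < b)
    (hmgf : ∀ k, ∀ θ : ℝ, ∫⁻ ω, ENNReal.ofReal (Real.exp (θ * x k ω)) ∂μ ≤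
      ENNReal.ofReal (Real.exp (b ^ 2 * θ ^ 2 / 2))) :
    ∀ t ≥ 0,
      μ {ω | opNorm (∑ k, x k ω • D k) ≥ t} ≤
        ENNReal.ofReal ((m + n) * Real.exp (-t ^ 2 /
          (2 * b ^ 2 *
            max (opNorm (∑ k, D k * (D k)ᴴ)) (opNorm (∑ k, (D k)ᴴ * D k))))) := by
  intro t ht
  set ρ := max (opNorm (∑ k, D k * (D k)ᴴ)) (opNorm (∑ k, (D k)ᴴ * D k)) with hρ
  have hρ0 : 0 ≤ ρ := le_max_of_le_left (norm_nonneg _)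
  have hmn1 : (1:ℝ) ≤ m + n := by exact_mod_cast hmn
  have triv : -t ^ 2 / (2 * b ^ 2 * ρ) = 0 → μ {ω | opNorm (∑ k, x k ω • D k) ≥ t} ≤
      ENNReal.ofReal ((m + n) * Real.exp (-t ^ 2 / (2 * b ^ 2 * ρ))) := by
    intro h
    rw [h, Real.exp_zero, mul_one]
    refine prob_le_one.trans ?_
    rw [← ENNReal.ofReal_one]
    exact ENNReal.ofReal_le_ofReal hmn1
  rcases hρ0.eq_or_lt with h0 | hρ0
  · exact triv (by rw [← h0]; simp)
  rcases ht.eq_or_lt with h0 | ht0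
  · exact triv (by rw [← h0]; simp)
  clear triv
  have : Nonempty (Fin m ⊕ Fin n) := by
    rw [← Fintype.card_pos_iff]; simpa using hmn
  set θ := t / (b ^ 2 * ρ) with hθ
  have hθ0 : 0 < θ := by positivity
  have hE := sg_expect μ (fun k => θ • sgDil (D k))
    (fun k => by rw [Matrix.transpose_smul, sgDil_symm]) x hmeas hindep (b ^ 2) hmgf Finset.univ 0 (by simp)
  have hsum : ∀ ω, ∑ k, x k ω • θ • sgDil (D k) = θ • sgDil (∑ k, x k ω • D k) := by
    intro ω
    rw [sgDil_sum, Finset.smul_sum]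
    exact Finset.sum_congr rfl fun k _ => smul_comm _ _ _
  simp only [zero_add, hsum] at hE
  have hsq : (b ^ 2 / 2) • ∑ k, (θ • sgDil (D k)) * (θ • sgDil (D k)) =
      (b ^ 2 / 2 * θ ^ 2) • ∑ k, sgDil (D k) * sgDil (D k) := by
    simp only [smul_mul_smul_comm, ← Finset.smul_sum, smul_smul]
    congr 1; ring
  have hU : (NormedSpace.exp ((b ^ 2 / 2) • ∑ k, (θ • sgDil (D k)) * (θ • sgDil (D k)))).trace ≤
      (m + n) * Real.exp (b ^ 2 / 2 * θ ^ 2 * ρ) := by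
    rw [hsq]
    refine (sg_upper _ ?_ (b ^ 2 / 2 * θ ^ 2 * ρ) fun v => ?_).trans (le_of_eq (by simp))
    · simp [Matrix.transpose_sum, sgDil_symm]
    · rw [Matrix.smul_mulVec, dotProduct_smul, smul_eq_mul, mul_assoc _ ρ]
      exact mul_le_mul_of_nonneg_left (sgDil_sq_quad _ _ v) (by positivity)
  have hE2 := hE.trans (ENNReal.ofReal_le_ofReal hU)
  have hmark := meas_ge_le_lintegral_div (μ := μ)
    (f := fun ω => ENNReal.ofReal (NormedSpace.exp (θ • sgDil (∑ k, x k ω • D k))).trace)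
    (by
      have hc : Continuous fun y : Fin K → ℝ =>
          (NormedSpace.exp (∑ k, y k • θ • sgDil (D k))).trace :=
        Continuous.matrix_trace (sg_exp_cont.comp (by fun_prop))
      have := (hc.measurable.comp (measurable_pi_lambda (fun ω k => x k ω) hmeas)).ennreal_ofReal
      simp only [Function.comp_apply, hsum] at this
      exact this.aemeasurable)
    (ε := ENNReal.ofReal (Real.exp (θ * t)))
    (by simpa using Real.exp_pos _) ENNReal.ofReal_ne_top
  calc μ {ω | opNorm (∑ k, x k ω • D k) ≥ t}
      ≤ μ {ω | ENNReal.ofReal (Real.exp (θ * t)) ≤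
          ENNReal.ofReal (NormedSpace.exp (θ • sgDil (∑ k, x k ω • D k))).trace} := by
        refine measure_mono fun ω hω => ?_
        refine ENNReal.ofReal_le_ofReal (le_trans ?_ (sgDil_norm _ θ hθ0))
        exact Real.exp_le_exp.2 (mul_le_mul_of_nonneg_left hω hθ0.le)
    _ ≤ _ := hmark
    _ ≤ ENNReal.ofReal ((m + n) * Real.exp (b ^ 2 / 2 * θ ^ 2 * ρ)) / ENNReal.ofReal (Real.exp (θ * t)) := by
        gcongr
    _ = _ := by
        rw [← ENNReal.ofReal_div_of_pos (Real.exp_pos _), mul_div_assoc, ← Real.exp_sub]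
        congr 3
        rw [hθ]
        field_simp
        ring
end

section
/- Let B be an m×n random matrix with m ≥ n whose entries x_{ij} are i.i.d. centered random variables satisfying E[exp(θ·x_{ij})] ≤ exp(b²·θ²/2) for all θ ∈ ℝ and some fixed b > 0. Then for all t ≥ 0, P(‖B‖ > t) ≤ (m+n)·exp( -t²/(2·b²·m) ), where ‖B‖ denotes the operator (spectral) norm of B. -/
open MeasureTheory ProbabilityTheory Real Matrix

theorem aux_pow_sub {A : Type*} [NormedRing A] [NormOneClass A] (U V : A) (M : ℝ) (hM : 1 ≤ M)
    (hU : ‖U‖ ≤ M) (hV : ‖V‖ ≤ M) (n : ℕ) : ‖U ^ n - V ^ n‖ ≤ n * ‖U - V‖ * M ^ n := by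
  induction n with
  | zero => simp
  | succ n ih =>
    have e : U ^ (n+1) - V ^ (n+1) = (U ^ n - V ^ n) * U + V ^ n * (U - V) := by
      rw [pow_succ, pow_succ]; noncomm_ring
    rw [e]
    have h1 : ‖(U ^ n - V ^ n) * U‖ ≤ (n * ‖U - V‖ * M ^ n) * M :=
      (norm_mul_le _ _).trans (by gcongr)
    have h2 : ‖V ^ n * (U - V)‖ ≤ M ^ n * ‖U - V‖ :=
      (norm_mul_le _ _).trans (by gcongr; exact (norm_pow_le _ _).trans (by gcongr))
    have h3 : M ^ n * ‖U - V‖ ≤ M ^ (n+1) * ‖U - V‖ := by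
      gcongr
      simp
    refine (norm_add_le _ _).trans ?_
    push_cast
    calc _ ≤ (n * ‖U - V‖ * M ^ n) * M + M ^ (n+1) * ‖U - V‖ := by linarith
      _ = _ := by ring

open NormedSpace Filter Topology in
theorem aux_trotter {A : Type*} [NormedRing A] [NormOneClass A] [NormedAlgebra ℝ A]
    [CompleteSpace A] (X Y : A) :
    Tendsto (fun j : ℕ => (exp (((2:ℝ)^j)⁻¹ • X) * exp (((2:ℝ)^j)⁻¹ • Y)) ^ (2 ^ j)) atTop
      (𝓝 (exp (X + Y))) := by
  have hs : Tendsto (fun j : ℕ => ((2:ℝ)^j)⁻¹) atTop (𝓝[≠] 0) := by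
    rw [tendsto_nhdsWithin_iff]
    refine ⟨tendsto_inv_atTop_zero.comp (tendsto_pow_atTop_atTop_of_one_lt (by norm_num)), ?_⟩
    exact Eventually.of_forall fun j => by simp
  have hs0 := tendsto_nhdsWithin_iff.1 hs |>.1
  let g : ℝ → A := fun t => exp (t • X) * exp (t • Y)
  let h : ℝ → A := fun t => exp (t • (X + Y))
  have hg : HasDerivAt g (X + Y) 0 := by
    have := (hasDerivAt_exp_smul_const X (0:ℝ)).mul (hasDerivAt_exp_smul_const Y (0:ℝ))
    convert! this using 1
    simp
  have hh : HasDerivAt h (X + Y) 0 := by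
    convert! hasDerivAt_exp_smul_const (X+Y) (0:ℝ) using 1
    simp
  have hd : HasDerivAt (fun t => g t - h t) 0 0 := by
    have := hg.sub hh
    rw [sub_self] at this
    exact this
  have hg0 : g 0 = 1 := by simp [g]
  have hh0 : h 0 = 1 := by simp [h]
  have hsl := (hasDerivAt_iff_tendsto_slope_zero.1 hd).comp hs
  simp only [Function.comp_def, zero_add, hg0, hh0, sub_self, sub_zero, inv_inv] at hsl
  obtain ⟨C1, hC1⟩ := (hg.isBigO_sub).bound
  obtain ⟨C2, hC2⟩ := (hh.isBigO_sub).bound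
  set C := max (max C1 C2) 0 with hC
  have hC0 : 0 ≤ C := le_max_right _ _
  have hb : ∀ᶠ j : ℕ in atTop, ‖g ((2^j)⁻¹) ^ (2^j) - h ((2^j)⁻¹) ^ (2^j)‖
      ≤ ‖((2:ℝ)^j) • (g ((2^j)⁻¹) - h ((2^j)⁻¹))‖ * Real.exp C := by
    filter_upwards [hs0.eventually hC1, hs0.eventually hC2] with j h1 h2
    rw [hg0, sub_zero] at h1
    rw [hh0, sub_zero] at h2
    have hp : (0:ℝ) < (2^j)⁻¹ := by positivity
    rw [Real.norm_of_nonneg hp.le] at h1 h2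
    have b1 : ‖g ((2^j)⁻¹)‖ ≤ 1 + C * (2^j)⁻¹ := by
      calc ‖g ((2^j)⁻¹)‖ = ‖1 + (g ((2^j)⁻¹) - 1)‖ := by congr 1; abel
        _ ≤ ‖(1:A)‖ + ‖g ((2^j)⁻¹) - 1‖ := norm_add_le _ _
        _ ≤ 1 + C * (2^j)⁻¹ := by
          rw [norm_one]
          have : C1 * (2^j)⁻¹ ≤ C * (2^j)⁻¹ := by gcongr; simp [hC]
          linarith
    have b2 : ‖h ((2^j)⁻¹)‖ ≤ 1 + C * (2^j)⁻¹ := by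
      calc ‖h ((2^j)⁻¹)‖ = ‖1 + (h ((2^j)⁻¹) - 1)‖ := by congr 1; abel
        _ ≤ ‖(1:A)‖ + ‖h ((2^j)⁻¹) - 1‖ := norm_add_le _ _
        _ ≤ 1 + C * (2^j)⁻¹ := by
          rw [norm_one]
          have : C2 * (2^j)⁻¹ ≤ C * (2^j)⁻¹ := by gcongr; simp [hC]
          linarith
    refine (aux_pow_sub _ _ _ (by have := mul_nonneg hC0 hp.le; linarith) b1 b2 _).trans ?_
    rw [norm_smul, Real.norm_of_nonneg (by positivity)]
    push_cast
    gcongr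
    calc (1 + C * (2^j)⁻¹) ^ (2^j) ≤ (Real.exp (C * (2^j)⁻¹)) ^ (2^j) := by
          gcongr
          have := Real.add_one_le_exp (C * (2^j)⁻¹)
          linarith
      _ = Real.exp C := by
          rw [← Real.exp_nat_mul]; congr 1; push_cast; field_simp
  have hlim : Tendsto (fun j : ℕ => g ((2^j)⁻¹) ^ (2^j) - h ((2^j)⁻¹) ^ (2^j)) atTop (𝓝 0) := by
    refine squeeze_zero_norm' hb ?_
    simpa using hsl.norm.mul_const (Real.exp C)
  have hhe : ∀ j : ℕ, h ((2^j)⁻¹) ^ (2^j) = exp (X + Y) := by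
    intro j
    let _ : NormedAlgebra ℚ A := NormedAlgebra.restrictScalars ℚ ℝ A
    simp only [h]
    rw [← NormedSpace.exp_nsmul]
    congr 1
    rw [← Nat.cast_smul_eq_nsmul ℝ, smul_smul]
    push_cast
    rw [mul_inv_cancel₀ (by positivity), one_smul]
  simp only [hhe] at hlim
  simpa using! hlim.add_const (exp (X + Y))

section

set_option linter.unusedSectionVars false

variable {ι : Type*} [Fintype ι] [DecidableEq ι]

theorem aux_tr_nonneg (X : Matrix ι ι ℝ) : 0 ≤ trace (X * Xᵀ) := by
  simp only [trace, diag, mul_apply, transpose_apply]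
  exact Finset.sum_nonneg fun i _ => Finset.sum_nonneg fun j _ => mul_self_nonneg _

theorem aux_cyc (A B : Matrix ι ι ℝ) (n : ℕ) : trace ((A * B) ^ n) = trace ((B * A) ^ n) := by
  cases n with
  | zero => simp
  | succ n =>
    have : (A * B) ^ (n+1) = A * ((B * A) ^ n * B) := by
      induction n with
      | zero => simp
      | succ n ih => rw [pow_succ, ih, pow_succ]; simp only [Matrix.mul_assoc]
    rw [this, trace_mul_comm, Matrix.mul_assoc, ← pow_succ]

theorem aux_PQ (j : ℕ) :
    (∀ X : Matrix ι ι ℝ, trace (X ^ (2 ^ (j+1))) ≤ trace ((Xᵀ * X) ^ (2 ^ j))) ∧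
    (∀ P Q : Matrix ι ι ℝ, Pᵀ = P → Qᵀ = Q →
      trace ((P * Q) ^ (2 ^ j)) ≤ trace (P ^ (2 ^ j) * Q ^ (2 ^ j))) := by
  induction j with
  | zero =>
    constructor
    · intro X
      have := aux_tr_nonneg (X - Xᵀ)
      simp only [transpose_sub, transpose_transpose, sub_mul, mul_sub, trace_sub] at this
      have h2 : trace (Xᵀ * Xᵀ) = trace (X * X) := by
        rw [← transpose_mul, trace_transpose]
      have h3 : trace (X * Xᵀ) = trace (Xᵀ * X) := trace_mul_comm _ _
      simp only [zero_add, pow_one, pow_zero, pow_two]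
      linarith
    · intro P Q _ _; simp
  | succ j ih =>
    obtain ⟨ihP, ihQ⟩ := ih
    constructor
    · intro X
      have e : X ^ (2 ^ (j+1+1)) = (X * X) ^ (2 ^ (j+1)) := by
        rw [← pow_two, ← pow_mul]; congr 1; ring
      rw [e]
      refine (ihP _).trans ?_
      have e2 : trace (((X * X)ᵀ * (X * X)) ^ 2 ^ j)
          = trace (((X * Xᵀ) * (Xᵀ * X)) ^ 2 ^ j) := by
        have := aux_cyc X (Xᵀ * (Xᵀ * X)) (2 ^ j)
        rw [transpose_mul]
        simp only [Matrix.mul_assoc] at this ⊢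
        exact this.symm
      rw [e2]
      refine (ihQ _ _ (by simp) (by simp)).trans ?_
      set P := (X * Xᵀ) ^ 2 ^ j with hP
      set Q := (Xᵀ * X) ^ 2 ^ j with hQ
      have hPs : Pᵀ = P := by rw [hP, transpose_pow]; simp
      have hQs : Qᵀ = Q := by rw [hQ, transpose_pow]; simp
      have h0 := aux_tr_nonneg (P - Q)
      simp only [transpose_sub, hPs, hQs, sub_mul, mul_sub, trace_sub] at h0
      have h1 : trace (Q * P) = trace (P * Q) := trace_mul_comm _ _
      have h2 : trace (P * P) = trace ((Xᵀ * X) ^ 2 ^ (j+1)) := by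
        rw [hP, ← pow_add, ← two_mul, ← pow_succ', aux_cyc]
      have h3 : trace (Q * Q) = trace ((Xᵀ * X) ^ 2 ^ (j+1)) := by
        rw [hQ, ← pow_add, ← two_mul, ← pow_succ']
      linarith
    · intro P Q hP hQ
      refine (ihP _).trans ?_
      have e2 : trace (((P * Q)ᵀ * (P * Q)) ^ 2 ^ j) = trace (((P * P) * (Q * Q)) ^ 2 ^ j) := by
        rw [transpose_mul, hP, hQ]
        have := aux_cyc Q (P * P * Q) (2 ^ j)
        simp only [Matrix.mul_assoc] at this ⊢
        exact this
      rw [e2]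
      refine (ihQ _ _ (by simp [hP]) (by simp [hQ])).trans ?_
      rw [← pow_two, ← pow_two, ← pow_mul, ← pow_mul, ← pow_succ']

open NormedSpace Filter Topology in
theorem aux_trotter_mat [Nonempty ι] (X Y : Matrix ι ι ℝ) :
    Tendsto (fun j : ℕ => (exp (((2:ℝ)^j)⁻¹ • X) * exp (((2:ℝ)^j)⁻¹ • Y)) ^ (2 ^ j)) atTop
      (𝓝 (exp (X + Y))) := by
  open scoped Matrix.Norms.Operator in exact aux_trotter X Y

open NormedSpace Filter Topology in
theorem aux_gt [Nonempty ι] (X Y : Matrix ι ι ℝ) (hX : Xᵀ = X) (hY : Yᵀ = Y) :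
    trace (exp (X + Y)) ≤ trace (exp X * exp Y) := by
  have hc : Continuous (trace : Matrix ι ι ℝ → ℝ) := continuous_id.matrix_trace
  have ht := (hc.tendsto _).comp (aux_trotter_mat X Y)
  refine le_of_tendsto ht (Eventually.of_forall fun j => ?_)
  have e : ∀ Z : Matrix ι ι ℝ, exp (((2:ℝ)^j)⁻¹ • Z) ^ (2^j) = exp Z := by
    intro Z
    rw [← Matrix.exp_nsmul]
    congr 1
    rw [← Nat.cast_smul_eq_nsmul ℝ, smul_smul]
    push_cast
    rw [mul_inv_cancel₀ (by positivity), one_smul]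
  refine ((aux_PQ j).2 _ _ ?_ ?_).trans (by rw [e, e])
  · rw [← exp_transpose, transpose_smul, hX]
  · rw [← exp_transpose, transpose_smul, hY]

theorem aux_conj (U : Matrix ι ι ℝ) (hU : U * U = 1) (d : ι → ℝ) :
    NormedSpace.exp (U * diagonal d * U) = U * diagonal (fun i => Real.exp (d i)) * U := by
  have hi : U⁻¹ = U := inv_eq_right_inv hU
  have hu : IsUnit U := IsUnit.of_mul_eq_one U hU
  have := Matrix.exp_conj U (diagonal d) hu
  rw [hi, Matrix.exp_diagonal] at this
  rw [this]
  congr 3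
  ext i
  rw [Pi.coe_exp, Real.exp_eq_exp_ℝ]

theorem aux_gt2 [Nonempty ι] (S U : Matrix ι ι ℝ) (hS : Sᵀ = S) (hUs : Uᵀ = U) (hU : U * U = 1)
    (d : ι → ℝ) :
    trace (NormedSpace.exp (S + U * diagonal d * U)) ≤
      ∑ v, (U * NormedSpace.exp S * U) v v * Real.exp (d v) := by
  refine (aux_gt _ _ hS ?_).trans (le_of_eq ?_)
  · simp [hUs, Matrix.mul_assoc]
  · rw [aux_conj U hU, ← Matrix.mul_assoc, trace_mul_comm, ← Matrix.mul_assoc, ← Matrix.mul_assoc]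
    simp [trace, mul_diagonal]

theorem aux_nonneg (S U : Matrix ι ι ℝ) (hS : Sᵀ = S) (hUs : Uᵀ = U) (v : ι) :
    0 ≤ (U * NormedSpace.exp S * U) v v := by
  have h1 : S = (1/2:ℝ) • S + (1/2:ℝ) • S := by rw [← add_smul]; norm_num
  have h2 : NormedSpace.exp S = NormedSpace.exp ((1/2:ℝ) • S) * NormedSpace.exp ((1/2:ℝ) • S) := by
    conv_lhs => rw [h1]
    exact Matrix.exp_add_of_commute _ _ (Commute.refl _)
  set E := NormedSpace.exp ((1/2:ℝ) • S) with hE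
  have hEs : Eᵀ = E := by rw [hE, ← exp_transpose, transpose_smul, hS]
  have h3 : U * NormedSpace.exp S * U = (U * E) * (U * E)ᵀ := by
    rw [transpose_mul, hEs, hUs, h2]; simp only [Matrix.mul_assoc]
  rw [h3, mul_apply]
  exact Finset.sum_nonneg fun i _ => mul_self_nonneg _

theorem aux_sum (S U : Matrix ι ι ℝ) (hU : U * U = 1) :
    ∑ v, (U * NormedSpace.exp S * U) v v = trace (NormedSpace.exp S) := by
  change trace (U * NormedSpace.exp S * U) = _
  rw [trace_mul_comm, ← Matrix.mul_assoc, hU, Matrix.one_mul]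

theorem aux_eig (A : Matrix ι ι ℝ) (hA : Aᵀ = A) (w : ι → ℝ) (hw : w ≠ 0) (t : ℝ)
    (h : t * (w ⬝ᵥ w) ≤ w ⬝ᵥ (A *ᵥ w)) : Real.exp t ≤ trace (NormedSpace.exp A) := by
  have hH : A.IsHermitian := by rw [IsHermitian, conjTranspose_eq_transpose_of_trivial, hA]
  set V : Matrix ι ι ℝ := (hH.eigenvectorUnitary : Matrix ι ι ℝ) with hV
  have hV1 : Vᵀ * V = 1 := by
    have := Unitary.coe_star_mul_self hH.eigenvectorUnitary
    rwa [star_eq_conjTranspose, conjTranspose_eq_transpose_of_trivial] at this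
  have hV2 : V * Vᵀ = 1 := mul_eq_one_comm.1 hV1
  have hsp : A = V * diagonal hH.eigenvalues * Vᵀ := by
    have := hH.spectral_theorem
    rw [Unitary.conjStarAlgAut_apply, star_eq_conjTranspose,
      conjTranspose_eq_transpose_of_trivial] at this
    simpa using! this
  set l := hH.eigenvalues
  have hex : trace (NormedSpace.exp A) = ∑ i, Real.exp (l i) := by
    have hi : V⁻¹ = Vᵀ := inv_eq_right_inv hV2
    have := Matrix.exp_conj V (diagonal l) (IsUnit.of_mul_eq_one _ hV2)
    rw [hi, ← hsp, Matrix.exp_diagonal] at this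
    rw [this, trace_mul_comm, ← Matrix.mul_assoc, hV1, Matrix.one_mul, trace_diagonal]
    refine Finset.sum_congr rfl fun i _ => ?_
    rw [Pi.coe_exp, Real.exp_eq_exp_ℝ]
  set y := Vᵀ *ᵥ w with hy
  have hwy : w = V *ᵥ y := by rw [hy, mulVec_mulVec, hV2, one_mulVec]
  have hyn : y ≠ 0 := by rintro h0; rw [h0, mulVec_zero] at hwy; exact hw hwy
  have e1 : w ⬝ᵥ w = ∑ i, y i * y i := by
    change _ = y ⬝ᵥ y
    rw [hy, dotProduct_mulVec, vecMul_transpose, mulVec_mulVec, hV2, one_mulVec]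
  have e2 : w ⬝ᵥ (A *ᵥ w) = ∑ i, l i * (y i * y i) := by
    have : w ⬝ᵥ (A *ᵥ w) = y ⬝ᵥ (diagonal l *ᵥ y) := by
      rw [hsp, ← mulVec_mulVec, ← mulVec_mulVec, ← hy, dotProduct_mulVec, hy, mulVec_transpose]
    rw [this]
    simp only [dotProduct, mulVec_diagonal]
    exact Finset.sum_congr rfl fun i _ => by ring
  have hex2 : ∃ i, t ≤ l i := by
    by_contra! hc
    obtain ⟨i0, hi0⟩ := Function.ne_iff.1 hyn
    rw [e1, e2, Finset.mul_sum] at h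
    refine absurd h (not_le.2 (Finset.sum_lt_sum (fun i _ => ?_) ⟨i0, Finset.mem_univ _, ?_⟩))
    · exact mul_le_mul_of_nonneg_right (hc i).le (mul_self_nonneg _)
    · exact mul_lt_mul_of_pos_right (hc i0) (mul_self_pos.2 hi0)
  obtain ⟨i, hi⟩ := hex2
  rw [hex]
  exact (Real.exp_le_exp.2 hi).trans
    (Finset.single_le_sum (f := fun i => Real.exp (l i)) (fun i _ => (Real.exp_pos _).le)
      (Finset.mem_univ i))

theorem aux_opNorm {m n : ℕ} (B : Matrix (Fin m) (Fin n) ℝ) (t θ : ℝ) (ht : 0 ≤ t) (hθ : 0 ≤ θ)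
    (h : t < opNorm B) :
    Real.exp (θ * t) ≤ trace (NormedSpace.exp (fromBlocks 0 (θ • B) (θ • B)ᵀ 0)) := by
  have hv : ∃ v : EuclideanSpace ℝ (Fin n), t * ‖v‖ < ‖Matrix.toEuclideanLin B v‖ := by
    by_contra! hc
    exact absurd h (not_lt.2 (ContinuousLinearMap.opNorm_le_bound _ ht hc))
  obtain ⟨v, hv⟩ := hv
  set u : Fin n → ℝ := WithLp.ofLp v with hu
  have hn1 : ‖v‖ ^ 2 = u ⬝ᵥ u := by
    rw [EuclideanSpace.real_norm_sq_eq]; simp [dotProduct, pow_two, hu]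
  have hn2 : ‖Matrix.toEuclideanLin B v‖ ^ 2 = (B *ᵥ u) ⬝ᵥ (B *ᵥ u) := by
    rw [EuclideanSpace.real_norm_sq_eq]; simp [dotProduct, pow_two, hu]
  set a := ‖v‖
  set c := ‖Matrix.toEuclideanLin B v‖
  have ha : 0 ≤ a := norm_nonneg _
  have hc : 0 < c := lt_of_le_of_lt (by positivity) hv
  have ha' : 0 < a := by
    refine lt_of_le_of_ne ha fun h0 => ?_
    have : v = 0 := norm_eq_zero.1 h0.symm
    have : c = 0 := by simp [c, this]
    linarith
  have hww : (Sum.elim (a • B *ᵥ u) (c • u)) ⬝ᵥ (Sum.elim (a • B *ᵥ u) (c • u))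
      = 2 * (a ^ 2 * c ^ 2) := by
    rw [sumElim_dotProduct_sumElim]
    simp only [smul_dotProduct, dotProduct_smul, smul_eq_mul, ← hn1, ← hn2]
    ring
  apply aux_eig _ _ (Sum.elim (a • B *ᵥ u) (c • u))
  · intro h0
    rw [h0] at hww
    simp at hww
    rcases hww with h | h <;> linarith
  · rw [hww, fromBlocks_mulVec]
    have e : (θ • B)ᵀ *ᵥ (a • B *ᵥ u) = (θ * a) • (Bᵀ *ᵥ (B *ᵥ u)) := by
      rw [transpose_smul, smul_mulVec, mulVec_smul, smul_smul]
    have e' : u ⬝ᵥ (Bᵀ *ᵥ (B *ᵥ u)) = c ^ 2 := by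
      rw [dotProduct_mulVec, vecMul_transpose, hn2]
    simp only [Sum.elim_comp_inl, Sum.elim_comp_inr, zero_mulVec, zero_add, add_zero,
      sumElim_dotProduct_sumElim, e]
    simp only [smul_mulVec, mulVec_smul, smul_dotProduct, dotProduct_smul, smul_eq_mul, ← hn2, e']
    have : (θ * a * c ^ 2) * (t * a) ≤ (θ * a * c ^ 2) * c := by gcongr
    nlinarith
  · simp [fromBlocks_transpose]

theorem aux_match {m n : ℕ} (K : Matrix (Fin m) (Fin n) ℝ) (hK : Kᵀ * K = 1) :
    ∃ U : Matrix (Fin m ⊕ Fin n) (Fin m ⊕ Fin n) ℝ, Uᵀ = U ∧ U * U = 1 ∧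
      ∀ (d : Fin n → ℝ) (e : Fin m → ℝ), K * diagonal d * Kᵀ = diagonal e →
      fromBlocks 0 (K * diagonal d) (K * diagonal d)ᵀ 0 =
        U * diagonal (Sum.elim e (-d)) * U := by
  set s : ℝ := (√2)⁻¹ with hs
  have hss : s * s = 1 / 2 := by
    rw [hs, ← mul_inv, Real.mul_self_sqrt (by norm_num)]; norm_num
  set Q : Matrix (Fin m) (Fin m) ℝ := 1 + (s - 1) • (K * Kᵀ) with hQ
  have hK2 : ∀ Z : Matrix (Fin n) (Fin m) ℝ, Kᵀ * (K * Z) = Z := fun Z => by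
    rw [← Matrix.mul_assoc, hK, Matrix.one_mul]
  have hQt : Qᵀ = Q := by simp [hQ]
  have hQK : Q * K = s • K := by
    rw [hQ, Matrix.add_mul, Matrix.smul_mul, Matrix.mul_assoc, hK, Matrix.mul_one, Matrix.one_mul,
      sub_smul, one_smul]; abel
  have hKQ : Kᵀ * Q = s • Kᵀ := by
    have := congrArg transpose hQK
    simpa [hQt] using this
  have hQQ : Q * Q + (1/2 : ℝ) • (K * Kᵀ) = 1 := by
    have : Q * Q = Q + (s - 1) • (s • (K * Kᵀ)) := by
      conv_lhs => rw [hQ, Matrix.add_mul, Matrix.smul_mul, Matrix.mul_assoc, hKQ, Matrix.one_mul]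
      rw [Matrix.mul_smul]
    rw [this, smul_smul, hQ, add_assoc, add_assoc, ← add_smul, ← add_smul]
    have : s - 1 + ((s - 1) * s + 1 / 2) = 0 := by linear_combination hss
    rw [this]; simp
  refine ⟨fromBlocks Q (s • K) (s • Kᵀ) (-(s • 1)), ?_, ?_, ?_⟩
  · simp [fromBlocks_transpose, hQt]
  · rw [fromBlocks_multiply, ← fromBlocks_one]
    congr 1
    · simp only [Matrix.smul_mul, Matrix.mul_smul, smul_smul, hss]; exact hQQ
    · simp only [Matrix.smul_mul, Matrix.mul_smul, smul_smul, hss, hQK, Matrix.mul_neg, Matrix.mul_one]; simp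
    · simp only [Matrix.smul_mul, Matrix.mul_smul, smul_smul, hss, hKQ, Matrix.neg_mul, Matrix.one_mul]; simp [smul_smul, hss]
    · simp only [Matrix.smul_mul, Matrix.mul_smul, smul_smul, hss, hK, Matrix.neg_mul, Matrix.mul_neg,
        Matrix.one_mul, neg_neg]
      rw [smul_neg, neg_neg, smul_smul, hss, ← add_smul]; norm_num
  · intro d e he
    have hD : diagonal (Sum.elim e (-d)) = fromBlocks (K * diagonal d * Kᵀ) 0 0 (-diagonal d) := by
      rw [he, diagonal_neg, fromBlocks_diagonal]; rfl
    have q1 : Q * (K * diagonal d * Kᵀ) = s • (K * diagonal d * Kᵀ) := by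
      rw [Matrix.mul_assoc K, ← Matrix.mul_assoc, hQK, Matrix.smul_mul]
    have q2 : Kᵀ * (K * diagonal d * Kᵀ) = diagonal d * Kᵀ := by
      rw [Matrix.mul_assoc K, hK2]
    have q3 : K * diagonal d * Kᵀ * Q = s • (K * diagonal d * Kᵀ) := by
      rw [Matrix.mul_assoc, hKQ, Matrix.mul_smul]
    have q4 : K * diagonal d * Kᵀ * K = K * diagonal d := by
      rw [Matrix.mul_assoc, hK, Matrix.mul_one]
    have q5 : diagonal d * Kᵀ * K = diagonal d := by
      rw [Matrix.mul_assoc, hK, Matrix.mul_one]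
    have q6 : diagonal d * Kᵀ * Q = s • (diagonal d * Kᵀ) := by
      rw [Matrix.mul_assoc, hKQ, Matrix.mul_smul]
    rw [hD, fromBlocks_multiply, fromBlocks_multiply]
    simp only [Matrix.mul_zero, add_zero, zero_add, Matrix.smul_mul, Matrix.mul_smul, q1, q2, q3, q4, q5, q6,
      Matrix.mul_neg, Matrix.neg_mul, Matrix.mul_one, Matrix.one_mul, neg_neg, smul_neg, smul_smul,
      hss, ← add_smul, add_neg_cancel, transpose_mul, diagonal_transpose]
    norm_num

/-- Dilation of the part of a matrix supported on the diagonals indexed by `s`. -/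
noncomputable def auxM {m n : ℕ} [NeZero m] (hmn : n ≤ m) (s : Finset (Fin m))
    (x : Fin m × Fin n → ℝ) : Matrix (Fin m ⊕ Fin n) (Fin m ⊕ Fin n) ℝ :=
  fromBlocks 0 (of fun i j => if i - Fin.castLE hmn j ∈ s then x (i, j) else 0)
    (of fun i j => if i - Fin.castLE hmn j ∈ s then x (i, j) else 0)ᵀ 0

theorem auxM_symm {m n : ℕ} [NeZero m] (hmn : n ≤ m) (s : Finset (Fin m))
    (x : Fin m × Fin n → ℝ) : (auxM hmn s x)ᵀ = auxM hmn s x := by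
  simp [auxM, fromBlocks_transpose]

theorem auxM_insert {m n : ℕ} [NeZero m] (hmn : n ≤ m) (s : Finset (Fin m)) (k : Fin m)
    (hk : k ∉ s) (x : Fin m × Fin n → ℝ) :
    auxM hmn (insert k s) x = auxM hmn s x + auxM hmn {k} x := by
  rw [auxM, auxM, auxM, fromBlocks_add, ← transpose_add, add_zero, add_zero]
  have : (of fun i j => if i - Fin.castLE hmn j ∈ insert k s then x (i, j) else 0)
      = (of fun i j => if i - Fin.castLE hmn j ∈ s then x (i, j) else 0) +
        (of fun i j => if i - Fin.castLE hmn j ∈ ({k} : Finset (Fin m)) then x (i, j) else 0) := by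
    ext i j
    simp only [of_apply, Matrix.add_apply, Finset.mem_insert, Finset.mem_singleton]
    by_cases h1 : i - Fin.castLE hmn j = k
    · simp [h1, hk]
    · simp [h1]
  rw [this]

theorem auxM_singleton {m n : ℕ} [NeZero m] (hmn : n ≤ m) (k : Fin m) :
    ∃ U : Matrix (Fin m ⊕ Fin n) (Fin m ⊕ Fin n) ℝ, Uᵀ = U ∧ U * U = 1 ∧
      ∃ d : (Fin m × Fin n → ℝ) → Fin m ⊕ Fin n → ℝ,
      (∀ x, auxM hmn {k} x = U * diagonal (d x) * U) ∧
      ∀ v, (∀ x, d x v = 0) ∨ ∃ p : Fin m × Fin n, p.1 - Fin.castLE hmn p.2 = k ∧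
        ∃ ε : ℝ, ε ^ 2 = 1 ∧ ∀ x, d x v = ε * x p := by
  set K : Matrix (Fin m) (Fin n) ℝ := of fun i j => if i = k + Fin.castLE hmn j then 1 else 0
    with hK
  have hKK : Kᵀ * K = 1 := by
    ext j j'
    simp only [hK, mul_apply, transpose_apply, of_apply, one_apply]
    by_cases h : j = j'
    · subst h; simp
    · have : ∀ i, i = k + Fin.castLE hmn j → ¬ i = k + Fin.castLE hmn j' := by
        intro i h1 h2
        exact h (Fin.castLE_injective hmn (add_left_cancel (h1.symm.trans h2)))
      rw [if_neg h]
      refine Finset.sum_eq_zero fun i _ => ?_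
      by_cases h1 : i = k + Fin.castLE hmn j
      · rw [if_neg (this i h1), mul_zero]
      · rw [if_neg h1, zero_mul]
  obtain ⟨U, hU1, hU2, hU3⟩ := aux_match K hKK
  refine ⟨U, hU1, hU2, fun x => Sum.elim
    (fun i => ∑ j, if i = k + Fin.castLE hmn j then x (k + Fin.castLE hmn j, j) else 0)
    (-fun j => x (k + Fin.castLE hmn j, j)), ?_, ?_⟩
  · intro x
    rw [← hU3]
    · have : (of fun i j => if i - Fin.castLE hmn j ∈ ({k} : Finset (Fin m)) then x (i, j) else 0)
        = K * diagonal (fun j => x (k + Fin.castLE hmn j, j)) := by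
        ext i j
        simp only [hK, mul_diagonal, of_apply, Finset.mem_singleton, sub_eq_iff_eq_add]
        by_cases h : i = k + Fin.castLE hmn j
        · simp [h]
        · simp [h]
      rw [auxM, this]
    · ext i i'
      rw [mul_apply, diagonal_apply]
      simp only [mul_diagonal, transpose_apply, hK, of_apply]
      by_cases h : i = i'
      · subst h
        rw [if_pos rfl]
        refine Finset.sum_congr rfl fun j _ => ?_
        split_ifs <;> simp
      · rw [if_neg h]
        refine Finset.sum_eq_zero fun j _ => ?_
        by_cases h1 : i = k + Fin.castLE hmn j
        · have : ¬ i' = k + Fin.castLE hmn j := fun h2 => h (h1.trans h2.symm)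
          simp [this]
        · simp [h1]
  · rintro (i | j)
    · by_cases h : ∃ j, i = k + Fin.castLE hmn j
      · obtain ⟨j, rfl⟩ := h
        refine Or.inr ⟨(k + Fin.castLE hmn j, j), by simp, 1, by norm_num, fun x => ?_⟩
        simp only [Sum.elim_inl, add_right_inj, (Fin.castLE_injective hmn).eq_iff]
        simp
      · left
        intro x
        push Not at h
        simp only [Sum.elim_inl]
        exact Finset.sum_eq_zero fun j _ => if_neg (h j)
    · exact Or.inr ⟨(k + Fin.castLE hmn j, j), by simp, -1, by norm_num, fun x => by simp⟩

theorem aux_exp_cont : Continuous (NormedSpace.exp : Matrix ι ι ℝ → Matrix ι ι ℝ) := by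
  open scoped Matrix.Norms.Operator in exact NormedSpace.exp_continuous

theorem auxM_cont {m n : ℕ} [NeZero m] (hmn : n ≤ m) (s : Finset (Fin m)) :
    Continuous (auxM (n := n) hmn s) := by
  have : Continuous fun x : Fin m × Fin n → ℝ =>
    (of fun i j => if i - Fin.castLE hmn j ∈ s then x (i, j) else 0 : Matrix (Fin m) (Fin n) ℝ) := by
    refine continuous_matrix fun i j => ?_
    simp only [of_apply]
    split_ifs <;> fun_prop
  exact Continuous.matrix_fromBlocks continuous_const this this.matrix_transpose continuous_const

theorem aux_ind {m n : ℕ} [NeZero m] (hmn : n ≤ m) {Ω : Type*} [MeasurableSpace Ω]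
    (μ : Measure Ω) [IsProbabilityMeasure μ]
    (X : Fin m × Fin n → Ω → ℝ) (hmeas : ∀ p, Measurable (X p))
    (hindep : iIndepFun X μ) (b θ : ℝ)
    (hmgf : ∀ p, ∀ θ : ℝ, ∫⁻ ω, ENNReal.ofReal (Real.exp (θ * X p ω)) ∂μ ≤
      ENNReal.ofReal (Real.exp (b ^ 2 * θ ^ 2 / 2))) (s : Finset (Fin m)) :
    ∫⁻ ω, ENNReal.ofReal (trace (NormedSpace.exp (auxM hmn s (fun p => θ * X p ω)))) ∂μ ≤
      ENNReal.ofReal (m + n) * ENNReal.ofReal (Real.exp (b ^ 2 * θ ^ 2 / 2)) ^ s.card := by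
  induction s using Finset.induction_on with
  | empty =>
    have : ∀ x : Fin m × Fin n → ℝ, auxM hmn ∅ x = 0 := by
      intro x; ext (i | i) (j | j) <;> simp [auxM]
    simp [this, NormedSpace.exp_zero, trace_one]
  | insert k s hk ih =>
    obtain ⟨U, hU1, hU2, d, hd, hdv⟩ := auxM_singleton (n := n) hmn k
    set c := ENNReal.ofReal (Real.exp (b ^ 2 * θ ^ 2 / 2)) with hc
    have hc1 : 1 ≤ c := by
      rw [hc, ← ENNReal.ofReal_one]
      exact ENNReal.ofReal_le_ofReal (Real.one_le_exp (by positivity))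
    let F : Fin m ⊕ Fin n → (Fin m × Fin n → ℝ) → ℝ := fun v x =>
      (U * NormedSpace.exp (auxM hmn s x) * U) v v
    have hF0 : ∀ v x, 0 ≤ F v x := fun v x => aux_nonneg _ _ (auxM_symm _ _ _) hU1 v
    have hFc : ∀ v, Continuous (F v) := fun v => by
      have h1 := aux_exp_cont.comp (auxM_cont (n := n) hmn s)
      have h2 := (continuous_const (y := U)).matrix_mul h1 |>.matrix_mul (continuous_const (y := U))
      exact h2.matrix_elem v v
    have hXm : Measurable fun ω p => θ * X p ω :=
      measurable_pi_lambda _ fun p => (hmeas p).const_mul θ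
    have hFm : ∀ v, Measurable fun ω => ENNReal.ofReal (F v (fun p => θ * X p ω)) := fun v =>
      ((hFc v).measurable.comp hXm).ennreal_ofReal
    have key : ∀ v, ∫⁻ ω, ENNReal.ofReal (F v (fun p => θ * X p ω)) *
        ENNReal.ofReal (Real.exp (d (fun p => θ * X p ω) v)) ∂μ ≤
        (∫⁻ ω, ENNReal.ofReal (F v (fun p => θ * X p ω)) ∂μ) * c := by
      intro v
      rcases hdv v with h0 | ⟨p, hp, ε, hε, h⟩
      · simp only [h0, Real.exp_zero, ENNReal.ofReal_one, mul_one]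
        exact le_mul_of_one_le_right' hc1
      · have hb : ∫⁻ ω, ENNReal.ofReal (Real.exp (d (fun p => θ * X p ω) v)) ∂μ ≤ c := by
          have := hmgf p (ε * θ)
          simp only [h]
          rw [mul_pow, hε, one_mul] at this
          simpa only [mul_assoc] using this
        let T : Finset (Fin m × Fin n) :=
          Finset.univ.filter fun q => q.1 - Fin.castLE hmn q.2 ∈ s
        have hdisj : Disjoint T {p} := by
          rw [Finset.disjoint_singleton_right]
          simp [T, hp, hk]
        have hI := hindep.indepFun_finset T {p} hdisj hmeas
        let φ : (T → ℝ) → ENNReal := fun z =>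
          ENNReal.ofReal (F v (fun q => if hq : q ∈ T then θ * z ⟨q, hq⟩ else 0))
        let ψ : (({p} : Finset (Fin m × Fin n)) → ℝ) → ENNReal := fun z =>
          ENNReal.ofReal (Real.exp (ε * (θ * z ⟨p, Finset.mem_singleton_self p⟩)))
        have hφ : Measurable φ := by
          refine ((hFc v).measurable.comp (measurable_pi_lambda _ fun q => ?_)).ennreal_ofReal
          by_cases hq : q ∈ T
          · simp only [hq, dif_pos]; fun_prop
          · simp only [hq, dif_neg, not_false_eq_true]; fun_prop
        have hψ : Measurable ψ := by fun_prop
        have hI2 := hI.comp hφ hψ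
        have e1 : (φ ∘ fun a (i : T) => X i a) =
            fun ω => ENNReal.ofReal (F v (fun p => θ * X p ω)) := by
          funext ω
          simp only [φ, Function.comp]
          congr 1
          simp only [F]
          have : ∀ x y : Fin m × Fin n → ℝ, (∀ q ∈ T, x q = y q) → auxM hmn s x = auxM hmn s y := by
            intro x y hxy
            have : (of fun i j => if i - Fin.castLE hmn j ∈ s then x (i, j) else 0)
              = (of fun i j => if i - Fin.castLE hmn j ∈ s then y (i, j) else 0) := by
              ext i j
              simp only [of_apply]
              split_ifs with h
              · exact hxy _ (by simp [T, h])
              · rfl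
            rw [auxM, auxM, this]
          rw [this _ (fun p => θ * X p ω)]
          intro q hq
          simp [hq]
        have e2 : (ψ ∘ fun a (i : ({p} : Finset (Fin m × Fin n))) => X i a) =
            fun ω => ENNReal.ofReal (Real.exp (d (fun p => θ * X p ω) v)) := by
          funext ω
          simp only [ψ, Function.comp, h]
        rw [e1, e2] at hI2
        have hm2 : Measurable fun ω => ENNReal.ofReal (Real.exp (d (fun p => θ * X p ω) v)) := by
          rw [← e2]
          exact hψ.comp (measurable_pi_lambda _ fun i => hmeas i)
        have := lintegral_mul_eq_lintegral_mul_lintegral_of_indepFun (hFm v) hm2 hI2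
        simp only [Pi.mul_apply] at this
        rw [this]
        gcongr
    calc ∫⁻ ω, ENNReal.ofReal (trace (NormedSpace.exp (auxM hmn (insert k s)
          (fun p => θ * X p ω)))) ∂μ
        ≤ ∫⁻ ω, ∑ v, ENNReal.ofReal (F v (fun p => θ * X p ω)) *
            ENNReal.ofReal (Real.exp (d (fun p => θ * X p ω) v)) ∂μ := by
          refine lintegral_mono fun ω => ?_
          simp only
          rw [auxM_insert hmn s k hk, hd]
          refine (ENNReal.ofReal_le_ofReal
            (aux_gt2 _ U (auxM_symm _ _ _) hU1 hU2 _)).trans (le_of_eq ?_)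
          rw [ENNReal.ofReal_sum_of_nonneg fun v _ =>
            mul_nonneg (hF0 v _) (Real.exp_pos _).le]
          exact Finset.sum_congr rfl fun v _ => ENNReal.ofReal_mul (hF0 v _)
      _ = ∑ v, ∫⁻ ω, ENNReal.ofReal (F v (fun p => θ * X p ω)) *
            ENNReal.ofReal (Real.exp (d (fun p => θ * X p ω) v)) ∂μ := by
          refine lintegral_finsetSum _ fun v _ => (hFm v).mul ?_
          rcases hdv v with h0 | ⟨p, hp, ε, hε, h⟩
          · simp only [h0]; fun_prop
          · simp only [h]; fun_prop
      _ ≤ ∑ v, (∫⁻ ω, ENNReal.ofReal (F v (fun p => θ * X p ω)) ∂μ) * c :=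
          Finset.sum_le_sum fun v _ => key v
      _ = (∫⁻ ω, ∑ v, ENNReal.ofReal (F v (fun p => θ * X p ω)) ∂μ) * c := by
          rw [lintegral_finsetSum _ fun v _ => hFm v, Finset.sum_mul]
      _ = (∫⁻ ω, ENNReal.ofReal (trace (NormedSpace.exp (auxM hmn s
            (fun p => θ * X p ω)))) ∂μ) * c := by
          congr 2
          funext ω
          rw [← ENNReal.ofReal_sum_of_nonneg fun v _ => hF0 v _]
          congr 1
          exact aux_sum _ U hU2
      _ ≤ (ENNReal.ofReal (m + n) * c ^ s.card) * c := by gcongr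
      _ = ENNReal.ofReal (m + n) * c ^ (insert k s).card := by
          rw [Finset.card_insert_of_notMem hk, pow_succ, mul_assoc]

end

/-- **Theorem 3.5.** Let `B` be an `m × n` random matrix with `m ≥ n` whose entries are
i.i.d. centered random variables with sub-Gaussian mgf parameter `b`. Then for all `t ≥ 0`,
`P(‖B‖ > t) ≤ (m + n) · exp(-t²/(2 b² m))`. -/
theorem subGaussian_matrix_opNorm_tail_series
    {m n : ℕ} (hmn : n ≤ m) {Ω : Type*} [MeasurableSpace Ω]
    (μ : Measure Ω) [IsProbabilityMeasure μ]
    (X : Fin m × Fin n → Ω → ℝ) (hmeas : ∀ p, Measurable (X p))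
    (hindep : iIndepFun X μ)
    (hid : ∀ p q, IdentDistrib (X p) (X q) μ μ)
    (hcent : ∀ p, ∫ ω, X p ω ∂μ = 0)
    (b : ℝ) (hb : 0 < b)
    (hmgf : ∀ p, ∀ θ : ℝ, ∫⁻ ω, ENNReal.ofReal (Real.exp (θ * X p ω)) ∂μ ≤
      ENNReal.ofReal (Real.exp (b ^ 2 * θ ^ 2 / 2))) :
    ∀ t ≥ 0,
      μ {ω | opNorm (Matrix.of fun i j => X (i, j) ω) > t} ≤
        ENNReal.ofReal ((m + n) * Real.exp (-t ^ 2 / (2 * b ^ 2 * m))) := by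
  intro t ht
  rcases Nat.eq_zero_or_pos m with hm | hm
  · have hn : n = 0 := by omega
    subst hm hn
    have : {ω | opNorm (Matrix.of fun i j => X (i, j) ω) > t} = ∅ := by
      ext ω
      have h0 : (Matrix.of fun i j => X (i, j) ω) = 0 := by ext i; exact i.elim0
      simp only [Set.mem_setOf_eq, Set.mem_empty_iff_false, iff_false, h0]
      simpa [opNorm] using ht
    rw [this]; simp
  · haveI : NeZero m := ⟨hm.ne'⟩
    have hmR : (0:ℝ) < m := by exact_mod_cast hm
    set θ : ℝ := t / (b ^ 2 * m) with hθ
    have hθ0 : 0 ≤ θ := by positivity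
    have hI := aux_ind hmn μ X hmeas hindep b θ hmgf Finset.univ
    have hsub : {ω | opNorm (Matrix.of fun i j => X (i, j) ω) > t} ⊆
        {ω | ENNReal.ofReal (Real.exp (θ * t)) ≤ ENNReal.ofReal (trace (NormedSpace.exp
          (auxM hmn Finset.univ (fun p => θ * X p ω))))} := by
      intro ω hω
      refine ENNReal.ofReal_le_ofReal ?_
      refine (aux_opNorm _ t θ ht hθ0 hω).trans (le_of_eq ?_)
      have : (θ • (Matrix.of fun i j => X (i, j) ω)) = (of fun i j =>
          if i - Fin.castLE hmn j ∈ Finset.univ then θ * X (i, j) ω else 0) := by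
        ext i j; simp
      rw [this, auxM]
    have hmk := meas_ge_le_lintegral_div (μ := μ) (f := fun ω => ENNReal.ofReal (trace
      (NormedSpace.exp (auxM hmn Finset.univ (fun p => θ * X p ω))))) (by
        have hXm : Measurable fun ω p => θ * X p ω :=
          measurable_pi_lambda _ fun p => (hmeas p).const_mul θ
        have h1 := (aux_exp_cont.comp (auxM_cont (n := n) hmn Finset.univ)).matrix_trace
        exact (h1.measurable.comp hXm).ennreal_ofReal.aemeasurable)
      (ε := ENNReal.ofReal (Real.exp (θ * t)))
      (by simp [Real.exp_pos]) ENNReal.ofReal_ne_top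
    refine (measure_mono hsub).trans (hmk.trans ?_)
    refine (ENNReal.div_le_div_right hI _).trans (le_of_eq ?_)
    rw [Finset.card_univ, Fintype.card_fin, ← ENNReal.ofReal_pow (Real.exp_pos _).le,
      ← ENNReal.ofReal_mul (by positivity), ← ENNReal.ofReal_div_of_pos (Real.exp_pos _),
      mul_div_assoc, ← Real.exp_nat_mul, ← Real.exp_sub]
    congr 3
    rw [hθ]
    field_simp
    ring
end

section
/- Let γ_{-(d-1)}, …, γ_{-1}, γ_0, γ_1, …, γ_{d-1} be independent standard normal random variables, and let T be the d×d random Toeplitz matrix with (i,k) entry γ_{k-i}, i.e., T = γ₀·I_d + Σ_{j=1}^{d-1} γ_j·C^j + Σ_{j=1}^{d-1} γ_{-j}·(C^j)^T, where C is the d×d upper shift matrix. Then for all t ≥ 0, P(‖T‖ > t) ≤ 2d·exp( -t²/(2d) ), where ‖T‖ denotes the operator (spectral) norm. -/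
open MeasureTheory ProbabilityTheory Real Matrix

/-- Fourier character -/
noncomputable def fch (d : ℕ) (m : ℕ) (r : ℤ) : ℂ :=
  Complex.exp ((((r : ℝ) * ((2 * m + 1) * π / (2 * d)) : ℝ) : ℂ) * Complex.I)

lemma fch_add (d m : ℕ) (r s : ℤ) : fch d m (r + s) = fch d m r * fch d m s := by
  rw [fch, fch, fch, ← Complex.exp_add]; congr 1; push_cast; ring

lemma fch_zero (d m : ℕ) : fch d m 0 = 1 := by simp [fch]

lemma fch_conj (d m : ℕ) (r : ℤ) : (starRingEnd ℂ) (fch d m r) = fch d m (-r) := by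
  rw [fch, fch, ← Complex.exp_conj]; congr 1
  rw [map_mul, Complex.conj_ofReal, Complex.conj_I]; push_cast; ring

lemma fch_pow (d m : ℕ) (r : ℤ) (n : ℕ) : fch d m (n * r) = fch d m r ^ n := by
  rw [fch, fch, ← Complex.exp_nat_mul]; congr 1; push_cast; ring

lemma fch_two_mul (d m : ℕ) (hd : 0 < d) : fch d m (2 * d) = -1 := by
  have hd' : (d : ℂ) ≠ 0 := by exact_mod_cast hd.ne'
  have : fch d m (2 * d) = Complex.exp (π * Complex.I + m * (2 * π * Complex.I)) := by
    rw [fch]; congr 1; push_cast; field_simp; ring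
  rw [this, Complex.exp_add, Complex.exp_nat_mul_two_pi_mul_I, Complex.exp_pi_mul_I]; simp

lemma fch_two_ne (d m : ℕ) (hd : 0 < d) : fch d m 2 ≠ 1 := by
  intro h
  have h1 : fch d m (2 * d) = 1 := by
    rw [mul_comm]
    rw [fch_pow, h, one_pow]
  rw [fch_two_mul d m hd] at h1
  norm_num at h1

lemma sum_fch_two (d m : ℕ) (hd : 0 < d) :
    ∑ j ∈ Finset.Icc (-(d : ℤ) + 1) ((d : ℤ) - 1), fch d m (2 * j) = 1 := by
  have h1 : ∑ j ∈ Finset.Icc (-(d : ℤ) + 1) ((d : ℤ) - 1), fch d m (2 * j)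
      = ∑ n ∈ Finset.range (2 * d - 1), fch d m (2 * (-(d : ℤ) + 1)) * fch d m 2 ^ n := by
    symm
    refine Finset.sum_bij' (fun n _ => (n : ℤ) + (-(d : ℤ) + 1))
      (fun j _ => (j - (-(d : ℤ) + 1)).toNat) ?_ ?_ ?_ ?_ ?_
    · intro n hn; simp at hn ⊢; omega
    · intro n hn; simp at hn ⊢; omega
    · intro n hn; simp
    · intro n hn; simp at hn ⊢; omega
    · intro n hn
      rw [← fch_pow, ← fch_add]; congr 1; ring
  have hz := fch_two_ne d m hd
  have e1 : fch d m 2 ^ (2 * d - 1) * fch d m 2 = 1 := by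
    rw [← pow_succ, show 2 * d - 1 + 1 = d * 2 by omega, pow_mul, ← fch_pow, mul_comm,
      fch_two_mul d m hd]; norm_num
  have e2 : fch d m (2 * (-(d : ℤ) + 1)) = - fch d m 2 := by
    have : fch d m (2 * (-(d : ℤ) + 1)) * fch d m (2 * d) = fch d m 2 := by
      rw [← fch_add]; congr 1; ring
    rw [fch_two_mul d m hd] at this
    linear_combination -this
  rw [h1, ← Finset.mul_sum, geom_sum_eq hz, e2, mul_div_assoc', div_eq_iff (sub_ne_zero.2 hz)]
  linear_combination -e1

lemma sum_fch_freq (d : ℕ) (hd : 0 < d) (r : ℤ) (h1 : r < 2 * d) (h2 : -(2 * d : ℤ) < r) :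
    ∑ m ∈ Finset.range (2 * d), fch d m r = if r = 0 then (2 * d : ℂ) else 0 := by
  split_ifs with hr
  · subst hr; simp [fch_zero]
  · have hd' : (d : ℂ) ≠ 0 := by exact_mod_cast hd.ne'
    set w : ℂ := Complex.exp (r * π / d * Complex.I) with hw
    have hm : ∀ m, fch d m r = fch d 0 r * w ^ m := by
      intro m
      rw [hw, ← Complex.exp_nat_mul, fch, fch, ← Complex.exp_add]
      congr 1; push_cast; field_simp; ring
    have hwN : w ^ (2 * d) = 1 := by
      rw [hw, ← Complex.exp_nat_mul, ← Complex.exp_int_mul_two_pi_mul_I r]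
      congr 1; push_cast; field_simp
    have hw1 : w ≠ 1 := by
      intro h
      rw [hw, Complex.exp_eq_one_iff] at h
      obtain ⟨n, hn⟩ := h
      have hpi : (π : ℂ) ≠ 0 := by exact_mod_cast Real.pi_ne_zero
      have : (r : ℂ) = n * (2 * d) := by
        field_simp at hn
        linear_combination hn
      have : r = n * (2 * d) := by exact_mod_cast this
      have hn0 : n = 0 := by
        by_contra hn0
        rcases lt_or_gt_of_ne hn0 with h | h
        · nlinarith
        · nlinarith
      simp [hn0] at this; exact hr this
    rw [Finset.sum_congr rfl (fun m _ => hm m)]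
    rw [← Finset.mul_sum, geom_sum_eq hw1, hwN]; simp

lemma lintegral_rayleigh (r : ℝ) (hr : 0 ≤ r) :
    ∫⁻ x in Set.Ioi r, ENNReal.ofReal (x * rexp (-x ^ 2 / 2)) = ENNReal.ofReal (rexp (-r ^ 2 / 2)) := by
  have hderiv : ∀ x : ℝ, HasDerivAt (fun x => -rexp (-x ^ 2 / 2)) (x * rexp (-x ^ 2 / 2)) x := by
    intro x
    have h1 : HasDerivAt (fun x : ℝ => -x ^ 2 / 2) (-x) x := by
      have := ((hasDerivAt_pow 2 x).neg.div_const 2)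
      convert! this using 1
      simp; ring
    convert! h1.exp.neg using 1
    ring
  have hcont : ContinuousWithinAt (fun x => -rexp (-x ^ 2 / 2)) (Set.Ici r) r :=
    (hderiv r).continuousAt.continuousWithinAt
  have htend : Filter.Tendsto (fun x => -rexp (-x ^ 2 / 2)) Filter.atTop (nhds 0) := by
    rw [← neg_zero]
    refine Filter.Tendsto.neg ?_
    refine Real.tendsto_exp_atBot.comp ?_
    have : Filter.Tendsto (fun x : ℝ => x ^ 2 / 2) Filter.atTop Filter.atTop :=
      (Filter.tendsto_pow_atTop two_ne_zero).atTop_div_const (by norm_num)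
    refine (Filter.tendsto_neg_atTop_atBot.comp this).congr ?_
    intro x; simp; ring
  have hnn : ∀ x ∈ Set.Ioi r, 0 ≤ x * rexp (-x ^ 2 / 2) := fun x hx =>
    mul_nonneg (hr.trans (le_of_lt hx)) (exp_pos _).le
  have hint := integrableOn_Ioi_deriv_of_nonneg hcont (fun x _ => hderiv x) hnn htend
  rw [← ofReal_integral_eq_lintegral_ofReal hint
    ((ae_restrict_iff' measurableSet_Ioi).2 (Filter.Eventually.of_forall hnn)),
    integral_Ioi_of_hasDerivAt_of_tendsto hcont (fun x _ => hderiv x) hint htend]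
  simp

lemma std_gauss_tail (r : ℝ) (hr : 0 ≤ r) :
    ((gaussianReal 0 1).prod (gaussianReal 0 1)) {p : ℝ × ℝ | r ^ 2 < p.1 ^ 2 + p.2 ^ 2}
      ≤ ENNReal.ofReal (rexp (-r ^ 2 / 2)) := by
  have hS : MeasurableSet {p : ℝ × ℝ | r ^ 2 < p.1 ^ 2 + p.2 ^ 2} :=
    measurableSet_lt (by fun_prop) (by fun_prop)
  rw [gaussianReal_of_var_ne_zero 0 one_ne_zero,
    prod_withDensity (measurable_gaussianPDF _ _) (measurable_gaussianPDF _ _),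
    withDensity_apply _ hS, ← lintegral_indicator hS, ← Measure.volume_eq_prod,
    ← lintegral_comp_polarCoord_symm]
  have hpt : ∀ p ∈ polarCoord.target,
      ENNReal.ofReal p.1 • ({p : ℝ × ℝ | r ^ 2 < p.1 ^ 2 + p.2 ^ 2}.indicator
        (fun z => gaussianPDF 0 1 z.1 * gaussianPDF 0 1 z.2)) (polarCoord.symm p)
      = ((Set.Ioi r).indicator (fun x => ENNReal.ofReal (x * rexp (-x ^ 2 / 2))) p.1)
          * ENNReal.ofReal (1 / (2 * π)) := by
    rintro ⟨x, θ⟩ hp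
    rw [polarCoord_target] at hp
    have hx : 0 < x := hp.1
    have hsq : (x * cos θ) ^ 2 + (x * sin θ) ^ 2 = x ^ 2 := by
      linear_combination x ^ 2 * (Real.sin_sq_add_cos_sq θ)
    simp only [polarCoord_symm_apply]
    by_cases hxr : r < x
    · rw [Set.indicator_of_mem (by
        simp only [Set.mem_ofPred_eq]; rw [hsq]; exact pow_lt_pow_left₀ hxr hr two_ne_zero),
        Set.indicator_of_mem (by exact hxr)]
      rw [gaussianPDF_def]
      simp only [smul_eq_mul, gaussianPDFReal]
      rw [← ENNReal.ofReal_mul (by positivity), ← ENNReal.ofReal_mul hx.le,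
        ← ENNReal.ofReal_mul (by positivity)]
      congr 1
      have e : rexp (-x ^ 2 / 2) = rexp (-(x * cos θ) ^ 2 / 2) * rexp (-(x * sin θ) ^ 2 / 2) := by
        rw [← Real.exp_add]; congr 1; rw [← hsq]; ring
      rw [e]
      have hs : (√(2 * π))⁻¹ * (√(2 * π))⁻¹ = 1 / (2 * π) := by
        rw [← mul_inv, Real.mul_self_sqrt (by positivity), one_div]
      simp only [NNReal.coe_one, mul_one, sub_zero]
      rw [← hs]; ring
    · rw [Set.indicator_of_notMem (by
        simp only [Set.mem_ofPred_eq]; rw [hsq]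
        exact not_lt.2 (pow_le_pow_left₀ hx.le (not_lt.1 hxr) 2)),
        Set.indicator_of_notMem (by exact hxr)]
      simp
  rw [setLIntegral_congr_fun polarCoord.open_target.measurableSet hpt, polarCoord_target,
    Measure.volume_eq_prod, ← Measure.prod_restrict, lintegral_prod_mul
      (f := (Set.Ioi r).indicator (fun x => ENNReal.ofReal (x * rexp (-x ^ 2 / 2))))
      (g := fun _ => ENNReal.ofReal (1 / (2 * π))) (by
      refine AEMeasurable.indicator ?_ measurableSet_Ioi
      fun_prop) (by fun_prop)]
  rw [lintegral_const, Measure.restrict_apply_univ, Real.volume_Ioo,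
    ← ENNReal.ofReal_mul (by positivity)]
  have : 1 / (2 * π) * (π - -π) = 1 := by have := Real.pi_ne_zero; field_simp; ring
  rw [this, ENNReal.ofReal_one, mul_one, lintegral_indicator measurableSet_Ioi,
    Measure.restrict_restrict measurableSet_Ioi, ← lintegral_rayleigh r hr]
  exact lintegral_mono' (Measure.restrict_mono Set.inter_subset_left le_rfl) le_rfl

lemma gauss_pair_tail {Ω : Type*} [MeasurableSpace Ω] (μ : Measure Ω) [IsProbabilityMeasure μ]
    (U V : Ω → ℝ) (h : HasGaussianLaw (fun ω => (U ω, V ω)) μ) (hU : μ[U] = 0) (hV : μ[V] = 0)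
    (hc : cov[U, V; μ] = 0) (v : ℝ) (hv : 0 < v) (hvU : Var[U; μ] ≤ v) (hvV : Var[V; μ] ≤ v)
    (t : ℝ) (ht : 0 ≤ t) :
    μ {ω | t ^ 2 < U ω ^ 2 + V ω ^ 2} ≤ ENNReal.ofReal (rexp (-t ^ 2 / (2 * v))) := by
  have hind := h.indepFun_of_covariance_eq_zero hc
  have hS : MeasurableSet {p : ℝ × ℝ | t ^ 2 < p.1 ^ 2 + p.2 ^ 2} :=
    measurableSet_lt (by fun_prop) (by fun_prop)
  have key : ∀ W : Ω → ℝ, HasGaussianLaw W μ → μ[W] = 0 →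
      μ.map W = (gaussianReal 0 1).map (fun x => √(Var[W; μ]) * x) := by
    intro W hW h0
    rw [hW.map_eq_gaussianReal, h0, gaussianReal_map_const_mul, mul_zero, mul_one]
    congr 1
    ext
    simp [Real.sq_sqrt (variance_nonneg W μ), variance_nonneg W μ]
  have h2 := (indepFun_iff_map_prod_eq_prod_map_map h.fst.aemeasurable h.snd.aemeasurable).1 hind
  rw [key U h.fst hU, key V h.snd hV, Measure.map_prod_map _ _ (by fun_prop) (by fun_prop)] at h2
  have h3 : μ {ω | t ^ 2 < U ω ^ 2 + V ω ^ 2}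
      = μ.map (fun ω => (U ω, V ω)) {p : ℝ × ℝ | t ^ 2 < p.1 ^ 2 + p.2 ^ 2} := by
    rw [Measure.map_apply_of_aemeasurable h.aemeasurable hS]; rfl
  rw [h3, h2, Measure.map_apply (by fun_prop) hS]
  have h4 := std_gauss_tail (t / √v) (by positivity)
  have h5 : -(t / √v) ^ 2 / 2 = -t ^ 2 / (2 * v) := by
    rw [div_pow, Real.sq_sqrt hv.le]; field_simp
  rw [h5] at h4
  refine le_trans (measure_mono ?_) h4
  rintro ⟨x, y⟩ hp
  simp only [Set.mem_preimage, Set.mem_ofPred_eq, Prod.map_apply, mul_pow,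
    Real.sq_sqrt (variance_nonneg U μ), Real.sq_sqrt (variance_nonneg V μ), div_pow,
    Real.sq_sqrt hv.le] at hp ⊢
  rw [div_lt_iff₀ hv]
  nlinarith [mul_le_mul_of_nonneg_right hvU (sq_nonneg x),
    mul_le_mul_of_nonneg_right hvV (sq_nonneg y)]

lemma cov_lin {Ω ι : Type*} [Fintype ι] [MeasurableSpace Ω] (μ : Measure Ω)
    [IsProbabilityMeasure μ] (X : ι → Ω → ℝ) (hm : ∀ i, Measurable (X i))
    (hX : iIndepFun X μ) (hg : ∀ i, μ.map (X i) = gaussianReal 0 1) (a b : ι → ℝ) :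
    cov[fun ω => ∑ i, a i * X i ω, fun ω => ∑ i, b i * X i ω; μ] = ∑ i, a i * b i := by
  classical
  have hG : ∀ i, HasGaussianLaw (X i) μ := fun i => ⟨by rw [hg i]; infer_instance⟩
  have hL : ∀ i, MemLp (X i) 2 μ := fun i => (hG i).memLp_two
  rw [covariance_fun_sum_fun_sum (fun i => (hL i).const_mul _) (fun i => (hL i).const_mul _)]
  refine Finset.sum_congr rfl fun i _ => ?_
  rw [Finset.sum_eq_single i]
  · rw [covariance_const_mul_left, covariance_const_mul_right, covariance_self (hm i).aemeasurable]
    have : Var[X i; μ] = 1 := by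
      have := variance_map (X := id) (μ := μ) (Y := X i) (by fun_prop) (hm i).aemeasurable
      rw [hg i, variance_id_gaussianReal] at this
      simpa using this.symm
    rw [this]; ring
  · intro j _ hj
    rw [covariance_const_mul_left, covariance_const_mul_right,
      (hX.indepFun hj.symm).covariance_eq_zero (hL i) (hL j)]; ring
  · simp

lemma lin_pair_tail {Ω ι : Type*} [Fintype ι] [MeasurableSpace Ω] (μ : Measure Ω)
    [IsProbabilityMeasure μ] (X : ι → Ω → ℝ) (hm : ∀ i, Measurable (X i))
    (hX : iIndepFun X μ) (hg : ∀ i, μ.map (X i) = gaussianReal 0 1) (a b : ι → ℝ)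
    (v : ℝ) (hv : 0 < v) (ha : ∑ i, a i * a i ≤ v) (hb : ∑ i, b i * b i ≤ v)
    (hab : ∑ i, a i * b i = 0) (t : ℝ) (ht : 0 ≤ t) :
    μ {ω | t ^ 2 < (∑ i, a i * X i ω) ^ 2 + (∑ i, b i * X i ω) ^ 2}
      ≤ ENNReal.ofReal (rexp (-t ^ 2 / (2 * v))) := by
  have hG : ∀ i, HasGaussianLaw (X i) μ := fun i => ⟨by rw [hg i]; infer_instance⟩
  have h0 : ∀ i, μ[X i] = 0 := by
    intro i
    have := integral_map (μ := μ) (hm i).aemeasurable (f := id) (by fun_prop)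
    rw [hg i] at this
    simpa using this.symm
  have hmean : ∀ a : ι → ℝ, μ[fun ω => ∑ i, a i * X i ω] = 0 := by
    intro a
    rw [integral_finsetSum _ (fun i _ => (hG i).integrable.const_mul _)]
    simp [integral_const_mul, h0]
  have hvar : ∀ a : ι → ℝ, Var[fun ω => ∑ i, a i * X i ω; μ] = ∑ i, a i * a i := by
    intro a
    rw [← cov_lin μ X hm hX hg a a, covariance_self]
    exact (Finset.measurable_sum _ (fun i _ => (hm i).const_mul _)).aemeasurable
  have hjoint := hX.hasGaussianLaw hG
  let L : (ι → ℝ) →L[ℝ] ℝ × ℝ :=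
    (∑ i, a i • ContinuousLinearMap.proj (R := ℝ) (φ := fun _ : ι => ℝ) i).prod
      (∑ i, b i • ContinuousLinearMap.proj (R := ℝ) (φ := fun _ : ι => ℝ) i)
  have hp : HasGaussianLaw (fun ω => (∑ i, a i * X i ω, ∑ i, b i * X i ω)) μ := by
    convert! hjoint.map_fun L using 2
    simp [L]
  exact gauss_pair_tail μ _ _ hp (hmean a) (hmean b) ((cov_lin μ X hm hX hg a b).trans hab) v hv
    ((hvar a).le.trans ha) ((hvar b).le.trans hb) t ht

lemma parseval (d : ℕ) (hd : 0 < d) (x : Fin d → ℝ) :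
    ∑ m ∈ Finset.range (2 * d), ‖∑ k : Fin d, (x k : ℂ) * fch d m (k : ℤ)‖ ^ 2
      = 2 * d * ∑ k, x k ^ 2 := by
  have : ∀ m, ((‖∑ k : Fin d, (x k : ℂ) * fch d m (k : ℤ)‖ ^ 2 : ℝ) : ℂ)
      = ∑ k : Fin d, ∑ l : Fin d, (x k * x l : ℂ) * fch d m ((k : ℤ) - l) := by
    intro m
    push_cast
    rw [← Complex.mul_conj', map_sum, Finset.sum_mul_sum]
    refine Finset.sum_congr rfl fun k _ => Finset.sum_congr rfl fun l _ => ?_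
    rw [map_mul, Complex.conj_ofReal, fch_conj, sub_eq_add_neg, fch_add]; ring
  apply Complex.ofReal_injective
  rw [Complex.ofReal_sum, Finset.sum_congr rfl (fun m _ => this m), Finset.sum_comm]
  push_cast
  rw [Finset.mul_sum]
  refine Finset.sum_congr rfl fun k _ => ?_
  rw [Finset.sum_comm]
  simp_rw [← Finset.mul_sum]
  rw [Finset.sum_eq_single k]
  · simp [fch_zero]; ring
  · intro l _ hl
    rw [sum_fch_freq d hd _ (by omega) (by omega), if_neg (by omega), mul_zero]
  · simp

lemma bilin_bound (d : ℕ) (hd : 0 < d) (g : ℤ → ℝ) (M : ℝ)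
    (hM : ∀ m ∈ Finset.range (2 * d),
      ‖∑ j ∈ Finset.Icc (-(d : ℤ) + 1) ((d : ℤ) - 1), (g j : ℂ) * fch d m j‖ ≤ M)
    (hM0 : 0 ≤ M) (x y : Fin d → ℝ) :
    ∑ i : Fin d, ∑ k : Fin d, y i * (g ((k : ℤ) - i) * x k)
      ≤ M * (√(∑ k, y k ^ 2) * √(∑ k, x k ^ 2)) := by
  have hid : (2 * d : ℂ) * ((∑ i : Fin d, ∑ k : Fin d, y i * (g ((k : ℤ) - i) * x k) : ℝ) : ℂ)
      = ∑ m ∈ Finset.range (2 * d),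
        (∑ j ∈ Finset.Icc (-(d : ℤ) + 1) ((d : ℤ) - 1), (g j : ℂ) * fch d m j)
        * ((∑ i : Fin d, (y i : ℂ) * fch d m (i : ℤ))
          * (starRingEnd ℂ) (∑ k : Fin d, (x k : ℂ) * fch d m (k : ℤ))) := by
    have e1 : ∀ m, (∑ j ∈ Finset.Icc (-(d : ℤ) + 1) ((d : ℤ) - 1), (g j : ℂ) * fch d m j)
        * ((∑ i : Fin d, (y i : ℂ) * fch d m (i : ℤ))
          * (starRingEnd ℂ) (∑ k : Fin d, (x k : ℂ) * fch d m (k : ℤ)))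
        = ∑ i : Fin d, ∑ k : Fin d, ∑ j ∈ Finset.Icc (-(d : ℤ) + 1) ((d : ℤ) - 1),
          (g j * y i * x k : ℂ) * fch d m (j + i - k) := by
      intro m
      rw [map_sum, Finset.sum_mul_sum, mul_comm, Finset.sum_mul]
      refine Finset.sum_congr rfl fun i _ => ?_
      rw [Finset.sum_mul]
      refine Finset.sum_congr rfl fun k _ => ?_
      rw [Finset.mul_sum]
      refine Finset.sum_congr rfl fun j _ => ?_
      rw [map_mul, Complex.conj_ofReal, fch_conj, sub_eq_add_neg, fch_add, fch_add]; ring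
    rw [Finset.sum_congr rfl (fun m _ => e1 m)]
    conv_rhs => rw [Finset.sum_comm]
    push_cast
    rw [Finset.mul_sum]
    refine Finset.sum_congr rfl fun i _ => ?_
    conv_rhs => rw [Finset.sum_comm]
    rw [Finset.mul_sum]
    refine Finset.sum_congr rfl fun k _ => ?_
    rw [Finset.sum_comm]
    simp_rw [← Finset.mul_sum]
    rw [Finset.sum_eq_single ((k : ℤ) - i)]
    · simp [fch_zero]; ring
    · intro j hj hne
      rw [Finset.mem_Icc] at hj
      rw [sum_fch_freq d hd _ (by omega) (by omega), if_neg (by omega), mul_zero]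
    · intro h
      exact (h (Finset.mem_Icc.2 ⟨by omega, by omega⟩)).elim
  set B := ∑ i : Fin d, ∑ k : Fin d, y i * (g ((k : ℤ) - i) * x k) with hB
  have hdpos : (0 : ℝ) < 2 * d := by positivity
  have h1 : 2 * d * |B| ≤ M * (√(2 * d * ∑ k, y k ^ 2) * √(2 * d * ∑ k, x k ^ 2)) := by
    have : 2 * d * |B| = ‖(2 * d : ℂ) * (B : ℂ)‖ := by
      rw [norm_mul, Complex.norm_real, Real.norm_eq_abs]; simp
    rw [this, hid, ← parseval d hd y, ← parseval d hd x]
    refine (norm_sum_le _ _).trans ?_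
    refine le_trans ?_ (mul_le_mul_of_nonneg_left (Real.sum_mul_le_sqrt_mul_sqrt _ _ _) hM0)
    rw [Finset.mul_sum]
    refine Finset.sum_le_sum fun m hm => ?_
    rw [norm_mul, norm_mul, RCLike.norm_conj]
    exact mul_le_mul_of_nonneg_right (hM m hm) (by positivity)
  have h2 : √(2 * d * ∑ k, y k ^ 2) * √(2 * d * ∑ k, x k ^ 2)
      = 2 * d * (√(∑ k, y k ^ 2) * √(∑ k, x k ^ 2)) := by
    rw [Real.sqrt_mul hdpos.le, Real.sqrt_mul hdpos.le]
    linear_combination (√(∑ k, y k ^ 2) * √(∑ k, x k ^ 2)) * Real.mul_self_sqrt hdpos.le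
  rw [h2] at h1
  have h3 : |B| ≤ M * (√(∑ k, y k ^ 2) * √(∑ k, x k ^ 2)) := by
    refine le_of_mul_le_mul_left ?_ hdpos
    linarith
  exact (le_abs_self _).trans h3

lemma opNorm_toeplitz_le (d : ℕ) (hd : 0 < d) (g : ℤ → ℝ) (M : ℝ)
    (hM : ∀ m ∈ Finset.range (2 * d),
      ‖∑ j ∈ Finset.Icc (-(d : ℤ) + 1) ((d : ℤ) - 1), (g j : ℂ) * fch d m j‖ ≤ M)
    (hM0 : 0 ≤ M) :
    opNorm (Matrix.of fun i k : Fin d => g ((k : ℤ) - (i : ℤ))) ≤ M := by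
  refine ContinuousLinearMap.opNorm_le_bound _ hM0 fun x => ?_
  set A : Matrix (Fin d) (Fin d) ℝ := Matrix.of fun i k : Fin d => g ((k : ℤ) - (i : ℤ)) with hA
  set z := Matrix.toEuclideanLin A x with hz
  change ‖z‖ ≤ _
  have hzi : ∀ i, z i = ∑ k : Fin d, g ((k : ℤ) - (i : ℤ)) * x k := by
    intro i
    simp [hz, hA, Matrix.mulVec, dotProduct]
  have h := bilin_bound d hd g M hM hM0 (fun k => x k) (fun i => z i)
  have hl : ∑ i : Fin d, ∑ k : Fin d, z i * (g ((k : ℤ) - i) * x k) = ‖z‖ ^ 2 := by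
    rw [EuclideanSpace.real_norm_sq_eq]
    refine Finset.sum_congr rfl fun i _ => ?_
    rw [← Finset.mul_sum, ← hzi]; ring
  have hn : ∀ u : EuclideanSpace ℝ (Fin d), √(∑ k, u k ^ 2) = ‖u‖ := by
    intro u
    rw [← EuclideanSpace.real_norm_sq_eq, Real.sqrt_sq (norm_nonneg _)]
  rw [hl, hn, hn] at h
  rcases (norm_nonneg z).eq_or_lt with h0 | h0
  · rw [← h0]; positivity
  · refine le_of_mul_le_mul_left ?_ h0
    linarith

/-- **Tail bound for the Gaussian Toeplitz matrix (Section 4).** Let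
`γ_{-(d-1)}, …, γ_{d-1}` be independent standard normal random variables and let `T` be the
`d × d` random Toeplitz matrix with `(i, k)` entry `γ_{k - i}`. Then for all `t ≥ 0`,
`P(‖T‖ > t) ≤ 2 d · exp(-t²/(2d))`. -/
theorem gaussian_toeplitz_opNorm_tail
    {d : ℕ} {Ω : Type*} [MeasurableSpace Ω] (μ : Measure Ω) [IsProbabilityMeasure μ]
    (γ : ℤ → Ω → ℝ)
    (hmeas : ∀ j ∈ Finset.Icc (-(d : ℤ) + 1) ((d : ℤ) - 1), Measurable (γ j))
    (hindep : iIndepFun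
      (fun j : (Finset.Icc (-(d : ℤ) + 1) ((d : ℤ) - 1) : Finset ℤ) => γ j) μ)
    (hgauss : ∀ j ∈ Finset.Icc (-(d : ℤ) + 1) ((d : ℤ) - 1),
      Measure.map (γ j) μ = gaussianReal 0 1) :
    ∀ t ≥ 0,
      μ {ω | opNorm (Matrix.of fun i k : Fin d => γ ((k : ℤ) - (i : ℤ)) ω) > t} ≤
        ENNReal.ofReal (2 * d * Real.exp (-t ^ 2 / (2 * d))) := by
  intro t ht
  rcases Nat.eq_zero_or_pos d with hd | hd
  · subst hd
    have : {ω | opNorm (Matrix.of fun i k : Fin 0 => γ ((k : ℤ) - (i : ℤ)) ω) > t} = ∅ := by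
      ext ω
      simp only [Set.mem_ofPred_eq, Set.mem_empty_iff_false, iff_false, gt_iff_lt, not_lt]
      refine ContinuousLinearMap.opNorm_le_bound _ ht fun x => ?_
      rw [Subsingleton.elim x 0]; simp
    rw [this]; simp
  set S := Finset.Icc (-(d : ℤ) + 1) ((d : ℤ) - 1) with hS
  have hsumS : ∀ f : ℤ → ℝ, ∑ j : S, f j = ∑ j ∈ S, f j := fun f => Finset.sum_coe_sort S f
  have hsub : {ω | opNorm (Matrix.of fun i k : Fin d => γ ((k : ℤ) - (i : ℤ)) ω) > t} ⊆
      ⋃ m ∈ Finset.range (2 * d), {ω | t ^ 2 < (∑ j : S, (fch d m j).re * γ j ω) ^ 2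
        + (∑ j : S, (fch d m j).im * γ j ω) ^ 2} := by
    intro ω hω
    by_contra hcon
    simp only [Set.mem_iUnion, Set.mem_ofPred_eq, not_exists, not_lt] at hcon
    refine absurd hω (not_lt.2 (opNorm_toeplitz_le d hd (fun j => γ j ω) t ?_ ht))
    intro m hm
    have h1 := hcon m hm
    rw [hsumS (fun j => (fch d m j).re * γ j ω), hsumS (fun j => (fch d m j).im * γ j ω)] at h1
    refine le_of_sq_le_sq ?_ ht
    rw [← Complex.normSq_eq_norm_sq, Complex.normSq_apply]
    simp only [Complex.re_sum, Complex.im_sum, Complex.re_ofReal_mul, Complex.im_ofReal_mul]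
    simp only [mul_comm (γ _ ω)]
    rw [← sq, ← sq]
    exact h1
  have hdR : (0 : ℝ) < d := by exact_mod_cast hd
  refine (measure_mono hsub).trans ((measure_biUnion_finset_le _ _).trans ?_)
  have hm : ∀ m ∈ Finset.range (2 * d), μ {ω | t ^ 2 < (∑ j : S, (fch d m j).re * γ j ω) ^ 2
        + (∑ j : S, (fch d m j).im * γ j ω) ^ 2} ≤ ENNReal.ofReal (rexp (-t ^ 2 / (2 * d))) := by
    intro m _
    have hs := sum_fch_two d m hd
    rw [← hS] at hs
    have hre : ∑ j ∈ S, ((fch d m j).re * (fch d m j).re - (fch d m j).im * (fch d m j).im) = 1 := by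
      have := congrArg Complex.re hs
      rw [Complex.re_sum] at this
      simpa only [two_mul, fch_add, Complex.mul_re, Complex.one_re] using this
    have him : ∑ j ∈ S, ((fch d m j).re * (fch d m j).im + (fch d m j).im * (fch d m j).re) = 0 := by
      have := congrArg Complex.im hs
      rw [Complex.im_sum] at this
      simpa only [two_mul, fch_add, Complex.mul_im, Complex.one_im] using this
    have hnorm : ∑ j ∈ S, ((fch d m j).re * (fch d m j).re + (fch d m j).im * (fch d m j).im)
        = 2 * d - 1 := by
      have : ∀ j ∈ S, (fch d m j).re * (fch d m j).re + (fch d m j).im * (fch d m j).im = 1 := by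
        intro j _
        rw [← Complex.normSq_apply, Complex.normSq_eq_norm_sq, fch, Complex.norm_exp_ofReal_mul_I]
        norm_num
      rw [Finset.sum_congr rfl this, Finset.sum_const, hS, Int.card_Icc, nsmul_eq_mul, mul_one]
      have : (((d : ℤ) - 1 + 1 - (-(d : ℤ) + 1)).toNat : ℤ) = 2 * d - 1 := by omega
      exact_mod_cast congrArg (Int.cast (R := ℝ)) this
    rw [Finset.sum_sub_distrib] at hre
    rw [Finset.sum_add_distrib] at him hnorm
    have hsw : ∑ j ∈ S, (fch d m j).im * (fch d m j).re
        = ∑ j ∈ S, (fch d m j).re * (fch d m j).im :=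
      Finset.sum_congr rfl fun _ _ => mul_comm _ _
    refine lin_pair_tail μ (fun j : S => γ j) (fun j => hmeas j j.2) hindep
      (fun j => hgauss j j.2) (fun j => (fch d m j).re) (fun j => (fch d m j).im) d hdR ?_ ?_ ?_ t ht
    · rw [hsumS (fun j => (fch d m j).re * (fch d m j).re)]; linarith
    · rw [hsumS (fun j => (fch d m j).im * (fch d m j).im)]; linarith
    · rw [hsumS (fun j => (fch d m j).re * (fch d m j).im)]; linarith
  refine (Finset.sum_le_sum hm).trans ?_
  rw [Finset.sum_const, Finset.card_range, nsmul_eq_mul, ENNReal.ofReal_mul (by positivity)]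
  gcongr
  rw [show (2 * d : ℝ) = ((2 * d : ℕ) : ℝ) by push_cast; ring, ENNReal.ofReal_natCast]
end

section
/- Let {H_k : k = 1, …, K} be fixed d×d Hermitian matrices and {γ_k : k = 1, …, K} independent standard normal random variables, and set ρ = ‖Σ_k H_k²‖. Then for all t ≥ 0, P( λ_max(Σ_k γ_k·H_k) ≥ t ) ≤ d·exp( -t²/(2ρ) ). -/
open MeasureTheory ProbabilityTheory Real Matrix

namespace MGS
section LA
variable {n : Type*} [Fintype n] [DecidableEq n]

/-- spectral function -/
def P (U : Matrix n n ℝ) (a : n → ℝ) : Matrix n n ℝ := U * diagonal a * Uᵀ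

lemma P_mul {U : Matrix n n ℝ} (hU : Uᵀ * U = 1) (a b : n → ℝ) :
    P U a * P U b = P U (a * b) := by
  have : U * diagonal a * Uᵀ * (U * diagonal b * Uᵀ)
      = U * diagonal a * (Uᵀ * U) * diagonal b * Uᵀ := by noncomm_ring
  unfold P
  rw [this, hU, mul_one, mul_assoc U, diagonal_mul_diagonal]
  rfl

lemma P_one {U : Matrix n n ℝ} (hU : U * Uᵀ = 1) : P U 1 = 1 := by
  unfold P
  rw [show diagonal (1 : n → ℝ) = 1 from diagonal_one, mul_one, hU]

lemma trace_P {U : Matrix n n ℝ} (hU : Uᵀ * U = 1) (S : Matrix n n ℝ) (a : n → ℝ) :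
    (S * P U a).trace = ∑ i, a i * (Uᵀ * S * U) i i := by
  unfold P
  rw [← mul_assoc, trace_mul_comm, ← mul_assoc, ← mul_assoc]
  simp [trace, mul_diagonal, mul_comm]

lemma trace_P_P (U V : Matrix n n ℝ) (a b : n → ℝ) :
    (P U a * P V b).trace = ∑ i, ∑ j, a i * b j * (Uᵀ * V) i j ^ 2 := by
  have : (P U a * P V b).trace = (diagonal a * (Uᵀ * V) * diagonal b * (Uᵀ * V)ᵀ).trace := by
    unfold P
    rw [transpose_mul, transpose_transpose]
    rw [show U * diagonal a * Uᵀ * (V * diagonal b * Vᵀ)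
      = U * (diagonal a * Uᵀ * (V * diagonal b * Vᵀ)) by noncomm_ring, trace_mul_comm]
    congr 1
    noncomm_ring
  rw [this]
  simp only [trace, diag, mul_apply (M := _ * _ * _)]
  refine Finset.sum_congr rfl fun i _ => Finset.sum_congr rfl fun j _ => ?_
  rw [mul_diagonal, diagonal_mul, transpose_apply]
  ring

lemma spectral {A : Matrix n n ℝ} (hA : A.IsHermitian) :
    ∃ (U : Matrix n n ℝ) (l : n → ℝ), U * Uᵀ = 1 ∧ Uᵀ * U = 1 ∧ A = P U l ∧
      spectrum ℝ A = Set.range l ∧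
      ∀ θ : ℝ, NormedSpace.exp (θ • A) = P U (fun i => Real.exp (θ * l i)) := by
  have hs : star (hA.eigenvectorUnitary : Matrix n n ℝ)
      = (hA.eigenvectorUnitary : Matrix n n ℝ)ᵀ := by
    ext i j; simp
  have h1 : (hA.eigenvectorUnitary : Matrix n n ℝ) * (hA.eigenvectorUnitary : Matrix n n ℝ)ᵀ = 1 := by
    rw [← hs]; exact Unitary.coe_mul_star_self _
  have h2 : (hA.eigenvectorUnitary : Matrix n n ℝ)ᵀ * (hA.eigenvectorUnitary : Matrix n n ℝ) = 1 := by
    rw [← hs]; exact Unitary.coe_star_mul_self _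
  have h3 : A = P (hA.eigenvectorUnitary : Matrix n n ℝ) hA.eigenvalues := by
    have := hA.spectral_theorem
    rw [Unitary.conjStarAlgAut_apply] at this
    rw [P, ← hs]
    exact this
  refine ⟨hA.eigenvectorUnitary, hA.eigenvalues, h1, h2, h3,
    hA.spectrum_real_eq_range_eigenvalues, fun θ => ?_⟩
  generalize (hA.eigenvectorUnitary : Matrix n n ℝ) = U at *
  generalize hA.eigenvalues = l at *
  have hinv : U⁻¹ = Uᵀ := inv_eq_right_inv h1
  have hu : IsUnit U := ⟨⟨U, Uᵀ, h1, h2⟩, rfl⟩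
  rw [h3, show θ • P U l = U * diagonal (θ • l) * U⁻¹ by
    rw [hinv, diagonal_smul]; simp [P], exp_conj _ _ hu, exp_diagonal, hinv]
  unfold P
  congr 3
  ext i
  rw [Pi.coe_exp, ← Real.exp_eq_exp_ℝ]
  simp

lemma scalar0 {w : ℝ} (hw : 0 ≤ w) : Real.exp w - 1 ≤ w * (Real.exp w + 1) / 2 := by
  have hm : MonotoneOn (fun w : ℝ => w * (Real.exp w + 1) / 2 - (Real.exp w - 1)) (Set.Ici 0) := by
    apply monotoneOn_of_deriv_nonneg (convex_Ici 0)
    · fun_prop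
    · fun_prop
    · intro x hx
      have : HasDerivAt (fun w : ℝ => w * (Real.exp w + 1) / 2 - (Real.exp w - 1))
          ((1 * (Real.exp x + 1) + x * Real.exp x) / 2 - Real.exp x) x :=
        ((((hasDerivAt_id x).mul ((Real.hasDerivAt_exp x).add_const 1)).div_const 2).sub
          ((Real.hasDerivAt_exp x).sub_const 1))
      rw [this.deriv]
      have h1 := Real.add_one_le_exp (-x)
      have h2 : Real.exp x * Real.exp (-x) = 1 := by rw [← Real.exp_add]; simp
      nlinarith [Real.exp_pos x]
  have := hm (Set.mem_Ici.2 le_rfl) (Set.mem_Ici.2 hw) hw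
  simp at this
  linarith

lemma scalar1 {u v : ℝ} (h : v ≤ u) :
    Real.exp u - Real.exp v ≤ (u - v) * (Real.exp u + Real.exp v) / 2 := by
  have h0 := scalar0 (sub_nonneg.2 h)
  have e : Real.exp u = Real.exp v * Real.exp (u - v) := by rw [← Real.exp_add]; ring_nf
  have := mul_le_mul_of_nonneg_left h0 (Real.exp_pos v).le
  rw [e]; linarith

lemma scalar2 (u v : ℝ) : (u - v) * (Real.exp u - Real.exp v)
    ≤ (u - v) ^ 2 * (Real.exp u + Real.exp v) / 2 := by
  rcases le_total v u with h | h
  · have := mul_le_mul_of_nonneg_left (scalar1 h) (sub_nonneg.2 h)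
    linarith
  · have := mul_le_mul_of_nonneg_left (scalar1 h) (sub_nonneg.2 h)
    linarith

lemma scalar3 {θ : ℝ} (hθ : 0 < θ) (a b : ℝ) :
    (a - b) * (Real.exp (θ * a) - Real.exp (θ * b))
    ≤ θ / 2 * ((a - b) ^ 2 * (Real.exp (θ * a) + Real.exp (θ * b))) := by
  have := scalar2 (θ * a) (θ * b)
  have h2 : θ * ((a - b) * (Real.exp (θ * a) - Real.exp (θ * b))) ≤
    θ * (θ / 2 * ((a - b) ^ 2 * (Real.exp (θ * a) + Real.exp (θ * b)))) := by linarith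
  exact le_of_mul_le_mul_left h2 hθ

lemma mv_trace {X Y : Matrix n n ℝ} (hX : X.IsHermitian) (hY : Y.IsHermitian) {θ : ℝ}
    (hθ : 0 < θ) :
    ((X - Y) * NormedSpace.exp (θ • X)).trace + ((Y - X) * NormedSpace.exp (θ • Y)).trace ≤
      θ / 2 * (((X - Y) * (X - Y) * NormedSpace.exp (θ • X)).trace
        + ((Y - X) * (Y - X) * NormedSpace.exp (θ • Y)).trace) := by
  obtain ⟨U, l, hU1, hU2, hXU, -, hXe⟩ := spectral hX
  obtain ⟨V, m, hV1, hV2, hYV, -, hYe⟩ := spectral hY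
  rw [hXe, hYe]
  have hX1 : ∀ a, (P U a).trace = ∑ i, ∑ j, a i * (Uᵀ * V) i j ^ 2 := by
    intro a
    have := trace_P_P U V a 1
    rw [P_one hV1] at this
    simpa using this
  have hY1 : ∀ b, (P V b).trace = ∑ i, ∑ j, b j * (Uᵀ * V) i j ^ 2 := by
    intro b
    have := trace_P_P U V 1 b
    rw [P_one hU1] at this
    simpa using this
  set eX := P U (fun i => Real.exp (θ * l i))
  set eY := P V (fun i => Real.exp (θ * m i))
  have c1 : ((X - Y) * eX).trace = (X * eX).trace - (eX * Y).trace := by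
    rw [sub_mul, trace_sub, trace_mul_comm Y]
  have c2 : ((Y - X) * eY).trace = (Y * eY).trace - (X * eY).trace := by
    rw [sub_mul, trace_sub]
  have c3 : ((X - Y) * (X - Y) * eX).trace = (X * X * eX).trace - ((X * eX) * Y).trace
      - ((eX * X) * Y).trace + (eX * (Y * Y)).trace := by
    rw [show (X - Y) * (X - Y) * eX = X * X * eX - X * (Y * eX) - Y * (X * eX) + (Y * Y) * eX by
      noncomm_ring, trace_add, trace_sub, trace_sub, trace_mul_comm Y, trace_mul_comm (Y * Y),
      trace_mul_comm X, show Y * eX * X = Y * (eX * X) by noncomm_ring, trace_mul_comm Y]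
    ring
  have c4 : ((Y - X) * (Y - X) * eY).trace = (Y * Y * eY).trace - (X * (Y * eY)).trace
      - (X * (eY * Y)).trace + ((X * X) * eY).trace := by
    rw [show (Y - X) * (Y - X) * eY = Y * Y * eY - Y * (X * eY) - X * (Y * eY) + (X * X) * eY by
      noncomm_ring, trace_add, trace_sub, trace_sub, trace_mul_comm Y (X * eY),
      show X * eY * Y = X * (eY * Y) by noncomm_ring]
    ring
  rw [c1, c2, c3, c4, hXU, hYV]
  simp only [eX, eY, P_mul hU2, P_mul hV2, trace_P_P, hX1, hY1]
  simp only [← Finset.sum_sub_distrib, ← Finset.sum_add_distrib, Finset.mul_sum]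
  refine Finset.sum_le_sum fun i _ => Finset.sum_le_sum fun j _ => ?_
  simp only [Pi.mul_apply]
  have := mul_le_mul_of_nonneg_right (scalar3 hθ (l i) (m j)) (sq_nonneg ((Uᵀ * V) i j))
  linarith

lemma trace_le_opNorm (S : Matrix n n ℝ) {X : Matrix n n ℝ} (hX : X.IsHermitian) (θ : ℝ) :
    (S * NormedSpace.exp (θ • X)).trace ≤ opNorm S * (NormedSpace.exp (θ • X)).trace := by
  obtain ⟨U, l, hU1, hU2, hXU, -, hXe⟩ := spectral hX
  rw [hXe, trace_P hU2]
  have h1 := trace_P hU2 1 (fun i => Real.exp (θ * l i))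
  rw [one_mul] at h1
  rw [h1, Finset.mul_sum]
  refine Finset.sum_le_sum fun i _ => ?_
  rw [mul_one, hU2, one_apply_eq, mul_one, mul_comm]
  refine mul_le_mul_of_nonneg_right ?_ (Real.exp_pos _).le
  set u : EuclideanSpace ℝ n := WithLp.toLp 2 (fun k => U k i) with hu
  have hn : ‖u‖ ^ 2 = 1 := by
    rw [EuclideanSpace.norm_sq_eq]
    have := congrFun (congrFun hU2 i) i
    simp only [mul_apply, transpose_apply, one_apply_eq] at this
    rw [← this]
    simp [hu, sq]
  have hn1 : ‖u‖ = 1 := by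
    exact (pow_eq_one_iff_of_nonneg (norm_nonneg u) two_ne_zero).1 hn
  set T := LinearMap.toContinuousLinearMap (Matrix.toEuclideanLin S) with hT
  have hi : (Uᵀ * S * U) i i = inner ℝ u (T u) := by
    rw [mul_assoc]
    simp [PiLp.inner_apply, hT, hu, Matrix.toLpLin_apply, mul_apply, mulVec, dotProduct,
      mul_comm]
  rw [hi]
  calc inner ℝ u (T u) ≤ ‖u‖ * ‖T u‖ := real_inner_le_norm _ _
    _ ≤ ‖u‖ * (‖T‖ * ‖u‖) := by gcongr; exact T.le_opNorm u
    _ = opNorm S := by rw [hn1]; simp [opNorm, hT]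

lemma trace_exp_ge [Nonempty n] {X : Matrix n n ℝ} (hX : X.IsHermitian) {θ t : ℝ} (hθ : 0 ≤ θ)
    (h : t ≤ lambdaMax X) : Real.exp (θ * t) ≤ (NormedSpace.exp (θ • X)).trace := by
  obtain ⟨U, l, hU1, hU2, hXU, hs, hXe⟩ := spectral hX
  rw [hXe]
  have h1 := trace_P hU2 1 (fun i => Real.exp (θ * l i))
  simp only [one_mul, mul_one, hU2, one_apply_eq] at h1
  rw [h1]
  have hm : sSup (Set.range l) ∈ Set.range l :=
    (Set.range_nonempty l).csSup_mem (Set.finite_range l)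
  obtain ⟨i, hi⟩ := hm
  have hl : t ≤ l i := by rw [hi, ← hs]; exact h
  calc Real.exp (θ * t) ≤ Real.exp (θ * l i) := by gcongr
    _ ≤ _ := Finset.single_le_sum (f := fun i => Real.exp (θ * l i))
        (fun _ _ => (Real.exp_pos _).le) (Finset.mem_univ i)

lemma trace_exp_nonneg {X : Matrix n n ℝ} (hX : X.IsHermitian) (θ : ℝ) :
    0 ≤ (NormedSpace.exp (θ • X)).trace := by
  obtain ⟨U, l, hU1, hU2, hXU, hs, hXe⟩ := spectral hX
  rw [hXe]
  have h1 := trace_P hU2 1 (fun i => Real.exp (θ * l i))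
  simp only [one_mul, mul_one, hU2, one_apply_eq] at h1
  rw [h1]
  exact Finset.sum_nonneg fun _ _ => (Real.exp_pos _).le

end LA
end MGS

namespace MGS
section Growth
open scoped Matrix.Norms.Operator
variable {Z : Type*} [NormedAddCommGroup Z] [NormedSpace ℝ Z]

/-- continuous, at most exponential growth -/
def Gr {R : Type*} [NormedAddCommGroup R] (f : Z → R) : Prop :=
  Continuous f ∧ ∃ C a : ℝ, 0 ≤ C ∧ 0 ≤ a ∧ ∀ z, ‖f z‖ ≤ C * Real.exp (a * ‖z‖)

variable {R : Type*} [NormedRing R] [NormedAlgebra ℝ R]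

lemma Gr.add {R : Type*} [NormedAddCommGroup R] {f g : Z → R} (hf : Gr f) (hg : Gr g) :
    Gr (fun z => f z + g z) := by
  obtain ⟨hf, C, a, hC, ha, h⟩ := hf
  obtain ⟨hg, D, b, hD, hb, k⟩ := hg
  refine ⟨hf.add hg, C + D, a + b, by positivity, by positivity, fun z => ?_⟩
  have h1 : Real.exp (a * ‖z‖) ≤ Real.exp ((a + b) * ‖z‖) := by gcongr; linarith
  have h2 : Real.exp (b * ‖z‖) ≤ Real.exp ((a + b) * ‖z‖) := by gcongr; linarith
  calc ‖f z + g z‖ ≤ ‖f z‖ + ‖g z‖ := norm_add_le _ _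
    _ ≤ C * Real.exp (a * ‖z‖) + D * Real.exp (b * ‖z‖) := add_le_add (h z) (k z)
    _ ≤ C * Real.exp ((a + b) * ‖z‖) + D * Real.exp ((a + b) * ‖z‖) := by gcongr
    _ = _ := by ring

lemma Gr.mul {f g : Z → R} (hf : Gr f) (hg : Gr g) : Gr (fun z => f z * g z) := by
  obtain ⟨hf, C, a, hC, ha, h⟩ := hf
  obtain ⟨hg, D, b, hD, hb, k⟩ := hg
  refine ⟨hf.mul hg, C * D, a + b, by positivity, by positivity, fun z => ?_⟩
  calc ‖f z * g z‖ ≤ ‖f z‖ * ‖g z‖ := norm_mul_le _ _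
    _ ≤ (C * Real.exp (a * ‖z‖)) * (D * Real.exp (b * ‖z‖)) := by
        gcongr
        · exact h z
        · exact k z
    _ = _ := by rw [add_mul, Real.exp_add]; ring

lemma Gr.clm {R S : Type*} [NormedAddCommGroup R] [NormedAddCommGroup S] [NormedSpace ℝ R]
    [NormedSpace ℝ S] (L : R →L[ℝ] S) {f : Z → R} (hf : Gr f) : Gr (fun z => L (f z)) := by
  obtain ⟨hf, C, a, hC, ha, h⟩ := hf
  refine ⟨L.continuous.comp hf, ‖L‖ * C, a, by positivity, ha, fun z => ?_⟩
  calc ‖L (f z)‖ ≤ ‖L‖ * ‖f z‖ := L.le_opNorm _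
    _ ≤ ‖L‖ * (C * Real.exp (a * ‖z‖)) := by gcongr; exact h z
    _ = _ := by ring

lemma Gr.id : Gr (fun z : Z => z) := by
  refine ⟨continuous_id, 1, 1, by positivity, by positivity, fun z => ?_⟩
  have := Real.add_one_le_exp ‖z‖
  rw [one_mul, one_mul]; linarith

lemma Gr.lin {S : Type*} [NormedAddCommGroup S] [NormedSpace ℝ S] (L : Z →L[ℝ] S) :
    Gr (fun z => L z) := Gr.id.clm L

lemma norm_exp_le [NormOneClass R] [CompleteSpace R] (x : R) :
    ‖NormedSpace.exp x‖ ≤ Real.exp ‖x‖ := by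
  have h : Summable fun k : ℕ => ‖x‖ ^ k / (k.factorial : ℝ) := Real.summable_pow_div_factorial _
  rw [NormedSpace.exp_eq_tsum ℝ, Real.exp_eq_exp_ℝ, NormedSpace.exp_eq_tsum_div]
  refine tsum_of_norm_bounded h.hasSum fun k => ?_
  rw [norm_smul, norm_inv, RCLike.norm_natCast, div_eq_inv_mul]
  gcongr
  exact norm_pow_le _ _

lemma Gr.exp [NormOneClass R] [CompleteSpace R] (L : Z →L[ℝ] R) :
    Gr (fun z => NormedSpace.exp (L z)) := by
  refine ⟨?_, 1, ‖L‖, by positivity, by positivity, fun z => ?_⟩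
  · have : Continuous (NormedSpace.exp : R → R) := by
      let := NormedAlgebra.restrictScalars ℚ ℝ R
      exact NormedSpace.exp_continuous
    exact this.comp L.continuous
  · rw [one_mul]
    refine (norm_exp_le _).trans ?_
    gcongr
    exact L.le_opNorm z

lemma Gr.integrable {R : Type*} [NormedAddCommGroup R] [CompleteSpace Z]
    [SecondCountableTopology Z] [MeasurableSpace Z] [BorelSpace Z]
    (ν : Measure Z) [IsGaussian ν] {f : Z → R} (hf : Gr f) : Integrable f ν := by
  obtain ⟨hf, C, a, hC, ha, h⟩ := hf
  obtain ⟨c, hc, hi⟩ := IsGaussian.exists_integrable_exp_sq ν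
  refine (hi.const_mul (C * Real.exp (a ^ 2 / c))).mono' hf.aestronglyMeasurable
    (Filter.Eventually.of_forall fun z => (h z).trans ?_)
  rw [mul_assoc, ← Real.exp_add]
  gcongr
  have : 0 ≤ (c * ‖z‖ - a / 2) ^ 2 / c := by positivity
  have h2 : (c * ‖z‖ - a / 2) ^ 2 / c = c * ‖z‖ ^ 2 - a * ‖z‖ + a ^ 2 / c / 4 := by
    field_simp; ring
  have h3 : 0 ≤ a ^ 2 / c := by positivity
  linarith

end Growth
end MGS

namespace MGS
section Gauss
open scoped Matrix.Norms.Operator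
variable {E : Type*} [NormedAddCommGroup E] [NormedSpace ℝ E] [CompleteSpace E]
  [SecondCountableTopology E] [MeasurableSpace E] [BorelSpace E]
  {ν : Measure E} [IsGaussian ν]
variable {n : Type*} [Fintype n] [DecidableEq n] [Nonempty n]

lemma int_neg (hneg : ν.map (fun x => -x) = ν) {G : E × E → ℝ} (hG : Continuous G) :
    ∫ z, G (z.1, -z.2) ∂(ν.prod ν) = ∫ z, G z ∂(ν.prod ν) := by
  have h : (ν.prod ν).map (fun z : E × E => (z.1, -z.2)) = ν.prod ν := by
    have := Measure.map_prod_map ν ν (f := fun x : E => x) (g := fun x : E => -x)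
      measurable_id measurable_neg
    rw [hneg, Measure.map_id'] at this
    exact this.symm
  conv_rhs => rw [← h]
  rw [integral_map (by fun_prop) hG.aestronglyMeasurable]

lemma int_odd (hneg : ν.map (fun x => -x) = ν) {G : E × E → ℝ} (hG : Continuous G)
    (ho : ∀ z, G (z.1, -z.2) = - G z) : ∫ z, G z ∂(ν.prod ν) = 0 := by
  have := int_neg hneg hG
  simp only [ho, integral_neg] at this
  linarith

lemma int_swap (hneg : ν.map (fun x => -x) = ν) {g : E × E → ℝ} (hg : Continuous g) (φ : ℝ) :
    ∫ z, g (z.1, cos φ • z.1 + sin φ • z.2) ∂(ν.prod ν)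
      = ∫ z, g (cos φ • z.1 + sin φ • z.2, z.1) ∂(ν.prod ν) := by
  have h0 : ν[id] = 0 := by
    have h1 : ∫ x, x ∂ν = ∫ x, -x ∂ν := by
      conv_lhs => rw [← hneg]
      rw [integral_map (by fun_prop) (by fun_prop)]
    rw [integral_neg] at h1
    have h2 : (2 : ℝ) • ∫ x, x ∂ν = 0 := by
      rw [two_smul]
      nth_rewrite 1 [h1]
      exact neg_add_cancel _
    simpa using h2
  have hr := IsGaussian.map_rotation_eq_self h0 (-φ)
  conv_lhs => rw [← hr]
  rw [integral_map (by fun_prop) (Continuous.aestronglyMeasurable (by fun_prop)),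
    ← int_neg hneg (G := fun z => g (((ContinuousLinearMap.rotation (-φ)) z).1,
          cos φ • ((ContinuousLinearMap.rotation (-φ)) z).1 +
            sin φ • ((ContinuousLinearMap.rotation (-φ)) z).2)) (by fun_prop)]
  refine integral_congr_ae (Filter.Eventually.of_forall fun z => ?_)
  simp only [ContinuousLinearMap.rotation_apply, Real.cos_neg, Real.sin_neg, Function.comp]
  congr 2
  · module
  · have := Real.sin_sq_add_cos_sq φ
    have h2 : cos φ • (cos φ • z.1 + -sin φ • -z.2) + sin φ • (- -sin φ • z.1 + cos φ • -z.2)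
      = (sin φ ^ 2 + cos φ ^ 2) • z.1 := by module
    rw [h2, this, one_smul]

/-- trace as a continuous linear map -/
noncomputable def trL (n : Type*) [Fintype n] [DecidableEq n] : Matrix n n ℝ →L[ℝ] ℝ :=
  LinearMap.toContinuousLinearMap (traceLinearMap n ℝ ℝ)

lemma trL_apply (A : Matrix n n ℝ) : trL n A = A.trace := rfl

lemma Gr.trace {Z : Type*} [NormedAddCommGroup Z] [NormedSpace ℝ Z] {f : Z → Matrix n n ℝ}
    (hf : Gr f) : Gr (fun z => (f z).trace) := hf.clm (trL n)

variable (M : E →L[ℝ] Matrix n n ℝ)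

lemma stein (hneg : ν.map (fun x => -x) = ν) (hM : ∀ x, (M x).IsHermitian)
    (S : Matrix n n ℝ)
    (hS : ∀ B : Matrix n n ℝ, ∫ y, (M y * M y * B).trace ∂ν = (S * B).trace)
    {θ : ℝ} (hθ : 0 < θ) (φ : ℝ) (hφ : cos φ < 1) :
    ∫ x, (M x * NormedSpace.exp (θ • M x)).trace ∂ν ≤
      θ / 2 * ((1 - cos φ) * ∫ x, (M x * M x * NormedSpace.exp (θ • M x)).trace ∂ν
        + (1 + cos φ) * ∫ x, (S * NormedSpace.exp (θ • M x)).trace ∂ν) := by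
  set c := cos φ with hc
  set s := sin φ with hs
  have hcs : s ^ 2 = (1 - c) * (1 + c) := by
    have := Real.sin_sq_add_cos_sq φ
    linarith
  let M1 : E × E →L[ℝ] Matrix n n ℝ := M.comp (ContinuousLinearMap.fst ℝ E E)
  let M2 : E × E →L[ℝ] Matrix n n ℝ := M.comp (ContinuousLinearMap.snd ℝ E E)
  have gE : ∀ L : E × E →L[ℝ] Matrix n n ℝ, Gr (fun z => NormedSpace.exp (θ • L z)) :=
    fun L => Gr.exp (θ • L)
  have g1 := Gr.lin M1
  have g2 := Gr.lin M2
  let g : E × E → ℝ := fun z => ((M z.1 - M z.2) * NormedSpace.exp (θ • M z.1)).trace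
  let k : E × E → ℝ := fun z =>
    ((M z.1 - M z.2) * (M z.1 - M z.2) * NormedSpace.exp (θ • M z.1)).trace
  have gg : Gr g := ((Gr.lin (M1 - M2)).mul (gE M1)).trace
  have gk : Gr k := (((Gr.lin (M1 - M2)).mul (Gr.lin (M1 - M2))).mul (gE M1)).trace
  let N : E × E →L[ℝ] Matrix n n ℝ := c • M1 + s • M2
  have hN : ∀ z, M (c • z.1 + s • z.2) = N z := fun z => by simp [N, M1, M2]
  have i1 : Integrable (fun z : E × E => g (z.1, c • z.1 + s • z.2)) (ν.prod ν) := by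
    refine Gr.integrable _ ?_
    simp only [g, hN]
    exact ((Gr.lin (M1 - N)).mul (gE M1)).trace
  have i2 : Integrable (fun z : E × E => g (c • z.1 + s • z.2, z.1)) (ν.prod ν) := by
    refine Gr.integrable _ ?_
    simp only [g, hN]
    exact ((Gr.lin (N - M1)).mul (gE N)).trace
  have i3 : Integrable (fun z : E × E => k (z.1, c • z.1 + s • z.2)) (ν.prod ν) := by
    refine Gr.integrable _ ?_
    simp only [k, hN]
    exact (((Gr.lin (M1 - N)).mul (Gr.lin (M1 - N))).mul (gE M1)).trace
  have i4 : Integrable (fun z : E × E => k (c • z.1 + s • z.2, z.1)) (ν.prod ν) := by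
    refine Gr.integrable _ ?_
    simp only [k, hN]
    exact (((Gr.lin (N - M1)).mul (Gr.lin (N - M1))).mul (gE N)).trace
  have key : ∫ z, (g (z.1, c • z.1 + s • z.2) + g (c • z.1 + s • z.2, z.1)) ∂(ν.prod ν) ≤
      ∫ z, θ / 2 * (k (z.1, c • z.1 + s • z.2) + k (c • z.1 + s • z.2, z.1)) ∂(ν.prod ν) := by
    refine integral_mono (i1.add i2) ((i3.add i4).const_mul _) fun z => ?_
    exact mv_trace (hM _) (hM _) hθ
  rw [integral_add i1 i2, integral_const_mul, integral_add i3 i4,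
    ← int_swap hneg gg.1, ← int_swap hneg gk.1] at key
  -- compute
  have hfst : ∀ {f : E → ℝ}, Continuous f → ∫ z : E × E, f z.1 ∂(ν.prod ν) = ∫ x, f x ∂ν := by
    intro f hf
    have h : (ν.prod ν).map Prod.fst = ν := by simp [Measure.map_fst_prod]
    conv_rhs => rw [← h]
    rw [integral_map (by fun_prop) hf.aestronglyMeasurable]
  have cE : Continuous fun x => NormedSpace.exp (θ • M x) := (Gr.exp (θ • M)).1
  have e1 : ∫ z, g (z.1, c • z.1 + s • z.2) ∂(ν.prod ν)
      = (1 - c) * ∫ x, (M x * NormedSpace.exp (θ • M x)).trace ∂ν := by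
    have r : ∀ z : E × E, g (z.1, c • z.1 + s • z.2) =
        (1 - c) * (M1 z * NormedSpace.exp (θ • M1 z)).trace
          - s * (M2 z * NormedSpace.exp (θ • M1 z)).trace := by
      intro z
      simp only [g, hN]
      have : M z.1 - N z = (1 - c) • M1 z - s • M2 z := by
        simp only [N, M1, M2, ContinuousLinearMap.comp_apply, ContinuousLinearMap.add_apply,
          ContinuousLinearMap.smul_apply, ContinuousLinearMap.coe_fst',
          ContinuousLinearMap.coe_snd']
        module
      rw [this, sub_mul, smul_mul_assoc, smul_mul_assoc, trace_sub, trace_smul, trace_smul]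
      rfl
    have j1 : Gr fun z => (M1 z * NormedSpace.exp (θ • M1 z)).trace := (g1.mul (gE M1)).trace
    have j2 : Gr fun z => (M2 z * NormedSpace.exp (θ • M1 z)).trace := (g2.mul (gE M1)).trace
    have k1 : Integrable (fun z => (1 - c) * (M1 z * NormedSpace.exp (θ • M1 z)).trace)
      (ν.prod ν) := (j1.integrable _).const_mul _
    have k2 : Integrable (fun z => s * (M2 z * NormedSpace.exp (θ • M1 z)).trace)
      (ν.prod ν) := (j2.integrable _).const_mul _
    simp only [r]
    rw [integral_sub k1 k2,
      integral_const_mul, integral_const_mul, int_odd hneg j2.1, mul_zero, sub_zero]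
    · congr 1
      exact hfst (f := fun x => (M x * NormedSpace.exp (θ • M x)).trace)
        (((Gr.lin M).mul (Gr.exp (θ • M))).trace).1
    · intro z
      simp [M1, M2]
  have e2 : ∫ z, k (z.1, c • z.1 + s • z.2) ∂(ν.prod ν)
      = (1 - c) ^ 2 * ∫ x, (M x * M x * NormedSpace.exp (θ • M x)).trace ∂ν
        + s ^ 2 * ∫ x, (S * NormedSpace.exp (θ • M x)).trace ∂ν := by
    have r : ∀ z : E × E, k (z.1, c • z.1 + s • z.2) =
        (1 - c) ^ 2 * (M1 z * M1 z * NormedSpace.exp (θ • M1 z)).trace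
          + s ^ 2 * (M2 z * M2 z * NormedSpace.exp (θ • M1 z)).trace
          - (1 - c) * s * ((M1 z * M2 z + M2 z * M1 z) * NormedSpace.exp (θ • M1 z)).trace := by
      intro z
      simp only [k, hN]
      have : M z.1 - N z = (1 - c) • M1 z - s • M2 z := by
        simp only [N, M1, M2, ContinuousLinearMap.comp_apply, ContinuousLinearMap.add_apply,
          ContinuousLinearMap.smul_apply, ContinuousLinearMap.coe_fst',
          ContinuousLinearMap.coe_snd']
        module
      have h2 : ((1 - c) • M1 z - s • M2 z) * ((1 - c) • M1 z - s • M2 z)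
          = (1 - c) ^ 2 • (M1 z * M1 z) + s ^ 2 • (M2 z * M2 z)
            - ((1 - c) * s) • (M1 z * M2 z + M2 z * M1 z) := by
        rw [sub_mul, mul_sub, mul_sub]
        simp only [smul_mul_assoc, mul_smul_comm]
        module
      rw [this, h2, sub_mul, add_mul, smul_mul_assoc, smul_mul_assoc, smul_mul_assoc, trace_sub,
        trace_add, trace_smul, trace_smul, trace_smul]
      rfl
    have j1 : Gr fun z => (M1 z * M1 z * NormedSpace.exp (θ • M1 z)).trace :=
      ((g1.mul g1).mul (gE M1)).trace
    have j2 : Gr fun z => (M2 z * M2 z * NormedSpace.exp (θ • M1 z)).trace :=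
      ((g2.mul g2).mul (gE M1)).trace
    have j3 : Gr fun z => ((M1 z * M2 z + M2 z * M1 z) * NormedSpace.exp (θ • M1 z)).trace :=
      (((g1.mul g2).add (g2.mul g1)).mul (gE M1)).trace
    have k1 : Integrable (fun z => (1 - c) ^ 2 * (M1 z * M1 z * NormedSpace.exp (θ • M1 z)).trace)
      (ν.prod ν) := (j1.integrable _).const_mul _
    have k2 : Integrable (fun z => s ^ 2 * (M2 z * M2 z * NormedSpace.exp (θ • M1 z)).trace)
      (ν.prod ν) := (j2.integrable _).const_mul _
    have k3 : Integrable (fun z => (1 - c) * s *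
        ((M1 z * M2 z + M2 z * M1 z) * NormedSpace.exp (θ • M1 z)).trace)
      (ν.prod ν) := (j3.integrable _).const_mul _
    simp only [r]
    have k12 : Integrable (fun z => (1 - c) ^ 2 * (M1 z * M1 z * NormedSpace.exp (θ • M1 z)).trace
        + s ^ 2 * (M2 z * M2 z * NormedSpace.exp (θ • M1 z)).trace) (ν.prod ν) := k1.add k2
    rw [integral_sub k12 k3, integral_add k1 k2,
      integral_const_mul, integral_const_mul, integral_const_mul, int_odd hneg j3.1, mul_zero,
      sub_zero]
    · congr 2
      · exact hfst (f := fun x => (M x * M x * NormedSpace.exp (θ • M x)).trace)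
          ((((Gr.lin M).mul (Gr.lin M)).mul (Gr.exp (θ • M))).trace).1
      · rw [integral_prod _ (j2.integrable _)]
        refine integral_congr_ae (Filter.Eventually.of_forall fun x => ?_)
        exact hS (NormedSpace.exp (θ • M x))
    · intro z
      simp only [M1, M2, ContinuousLinearMap.comp_apply, ContinuousLinearMap.coe_fst',
          ContinuousLinearMap.coe_snd', map_neg, mul_neg, neg_mul, ← neg_add, trace_neg]
  rw [e1, e2, hcs] at key
  have hp : 0 < 1 - c := by linarith
  refine le_of_mul_le_mul_left (a := 2 * (1 - c)) ?_ (by positivity)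
  linarith

lemma stein' (hneg : ν.map (fun x => -x) = ν) (hM : ∀ x, (M x).IsHermitian)
    (S : Matrix n n ℝ)
    (hS : ∀ B : Matrix n n ℝ, ∫ y, (M y * M y * B).trace ∂ν = (S * B).trace)
    {θ : ℝ} (hθ : 0 < θ) :
    ∫ x, (M x * NormedSpace.exp (θ • M x)).trace ∂ν ≤
      θ * (opNorm S * ∫ x, (NormedSpace.exp (θ • M x)).trace ∂ν) := by
  have h1 : ∫ x, (M x * NormedSpace.exp (θ • M x)).trace ∂ν ≤
      θ * ∫ x, (S * NormedSpace.exp (θ • M x)).trace ∂ν := by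
    set D := ∫ x, (M x * NormedSpace.exp (θ • M x)).trace ∂ν
    set Q := ∫ x, (M x * M x * NormedSpace.exp (θ • M x)).trace ∂ν with hQ
    set T := ∫ x, (S * NormedSpace.exp (θ • M x)).trace ∂ν with hT
    have hlim : Filter.Tendsto (fun c : ℝ => θ / 2 * ((1 - c) * Q + (1 + c) * T))
        (nhdsWithin 1 (Set.Iio 1)) (nhds (θ * T)) := by
      have : ContinuousAt (fun c : ℝ => θ / 2 * ((1 - c) * Q + (1 + c) * T)) 1 := by fun_prop
      have h := this.tendsto
      rw [show θ / 2 * ((1 - 1) * Q + (1 + 1) * T) = θ * T by ring] at h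
      exact h.mono_left nhdsWithin_le_nhds
    refine ge_of_tendsto hlim ?_
    filter_upwards [self_mem_nhdsWithin, Ioo_mem_nhdsLT (show (0:ℝ) < 1 by norm_num)] with c h1 h2
    have := stein M hneg hM S hS hθ (arccos c)
    rw [Real.cos_arccos (by linarith [h2.1]) h2.2.le] at this
    exact this h2.2
  refine h1.trans ?_
  gcongr
  rw [← integral_const_mul]
  refine integral_mono ?_ ?_ fun x => trace_le_opNorm S (hM x) θ
  · exact (((Gr.exp (θ • M)).clm (ContinuousLinearMap.mul ℝ _ S)).trace).integrable ν
  · exact (((Gr.exp (θ • M))).trace.integrable ν).const_mul _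

lemma deriv_gen {R : Type*} [NormedRing R] [NormedAlgebra ℝ R] [NormOneClass R] [CompleteSpace R]
    (M : E →L[ℝ] R) (τ : R →L[ℝ] ℝ) (θ : ℝ) :
    HasDerivAt (fun θ : ℝ => ∫ x, τ (NormedSpace.exp (θ • M x)) ∂ν)
      (∫ x, τ (M x * NormedSpace.exp (θ • M x)) ∂ν) θ := by
  refine (hasDerivAt_integral_of_dominated_loc_of_deriv_le
    (s := Metric.ball θ 1)
    (F := fun θ x => τ (NormedSpace.exp (θ • M x)))
    (F' := fun θ x => τ (M x * NormedSpace.exp (θ • M x)))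
    (bound := fun x => ‖τ‖ * ((‖M‖ * ‖x‖) * Real.exp ((|θ| + 1) * ‖M‖ * ‖x‖)))
    (Metric.ball_mem_nhds _ one_pos) ?_ ?_ ?_ ?_ ?_ ?_).2
  · exact Filter.Eventually.of_forall fun θ => ((Gr.exp (θ • M)).clm τ).1.aestronglyMeasurable
  · exact ((Gr.exp (θ • M)).clm τ).integrable ν
  · exact (((Gr.lin M).mul (Gr.exp (θ • M))).clm τ).1.aestronglyMeasurable
  · refine Filter.Eventually.of_forall fun x t ht => ?_
    have ht' : |t| ≤ |θ| + 1 := by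
      rw [Metric.mem_ball, Real.dist_eq] at ht
      have := abs_sub_abs_le_abs_sub t θ
      linarith
    refine (τ.le_opNorm _).trans ?_
    gcongr
    refine (norm_mul_le _ _).trans ?_
    gcongr
    · exact M.le_opNorm x
    · refine (norm_exp_le _).trans ?_
      gcongr
      rw [norm_smul, mul_assoc, Real.norm_eq_abs]
      gcongr
      exact M.le_opNorm x
  · refine Gr.integrable ν ?_
    have hb : Gr (fun x : E => ‖M‖ * ‖x‖ * Real.exp ((|θ| + 1) * ‖M‖ * ‖x‖)) := by
      refine ⟨by fun_prop, ‖M‖, 1 + (|θ| + 1) * ‖M‖, by positivity, by positivity, fun x => ?_⟩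
      have h1 := Real.add_one_le_exp ‖x‖
      have h2 : ‖x‖ ≤ Real.exp ‖x‖ := by linarith
      rw [Real.norm_of_nonneg (by positivity), add_mul 1, Real.exp_add, one_mul, ← mul_assoc]
      exact mul_le_mul_of_nonneg_right (mul_le_mul_of_nonneg_left h2 (norm_nonneg _))
        (Real.exp_pos _).le
    exact hb.clm (ContinuousLinearMap.mul ℝ _ ‖τ‖)
  · refine Filter.Eventually.of_forall fun x t ht => ?_
    exact τ.hasFDerivAt.comp_hasDerivAt t (hasDerivAt_exp_smul_const' (𝕂 := ℝ) (M x) t)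

lemma deriv_m (θ : ℝ) :
    HasDerivAt (fun θ : ℝ => ∫ x, (NormedSpace.exp (θ • M x)).trace ∂ν)
      (∫ x, (M x * NormedSpace.exp (θ • M x)).trace ∂ν) θ :=
  deriv_gen M (trL n) θ

lemma m_bound (hneg : ν.map (fun x => -x) = ν) (hM : ∀ x, (M x).IsHermitian)
    (S : Matrix n n ℝ)
    (hS : ∀ B : Matrix n n ℝ, ∫ y, (M y * M y * B).trace ∂ν = (S * B).trace)
    {θ : ℝ} (hθ : 0 ≤ θ) :
    ∫ x, (NormedSpace.exp (θ • M x)).trace ∂ν ≤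
      Fintype.card n * Real.exp (opNorm S * θ ^ 2 / 2) := by
  set m : ℝ → ℝ := fun θ => ∫ x, (NormedSpace.exp (θ • M x)).trace ∂ν with hm
  set ρ := opNorm S
  have hd : ∀ t, HasDerivAt (fun t => m t * Real.exp (-(ρ * t ^ 2 / 2)))
      ((∫ x, (M x * NormedSpace.exp (t • M x)).trace ∂ν) * Real.exp (-(ρ * t ^ 2 / 2))
        + m t * (Real.exp (-(ρ * t ^ 2 / 2)) * (-(ρ * (2 * t) / 2)))) t := by
    intro t
    refine (deriv_m M t).mul (HasDerivAt.exp ?_)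
    have := ((((hasDerivAt_id t).pow 2).const_mul ρ).div_const 2).neg
    refine this.congr_deriv ?_
    simp
  have hanti : AntitoneOn (fun t => m t * Real.exp (-(ρ * t ^ 2 / 2))) (Set.Ici 0) := by
    apply antitoneOn_of_deriv_nonpos (convex_Ici 0)
    · exact fun t _ => (hd t).continuousAt.continuousWithinAt
    · exact fun t _ => (hd t).differentiableAt.differentiableWithinAt
    · intro t ht
      rw [interior_Ici, Set.mem_Ioi] at ht
      rw [(hd t).deriv]
      have h1 := stein' M hneg hM S hS ht
      have h2 := mul_le_mul_of_nonneg_right h1 (Real.exp_pos (-(ρ * t ^ 2 / 2))).le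
      simp only [hm]
      linarith
  have h := hanti (Set.mem_Ici.2 le_rfl) (Set.mem_Ici.2 hθ) hθ
  simp only at h
  have h0 : m 0 = Fintype.card n := by simp [hm]
  rw [h0] at h
  norm_num at h
  rw [Real.exp_neg, ← div_eq_mul_inv, div_le_iff₀ (Real.exp_pos _)] at h
  exact h

end Gauss
end MGS

namespace MGS
section Final
open scoped Matrix.Norms.Operator

lemma isHermitian_sum {K d : ℕ} (H : Fin K → Matrix (Fin d) (Fin d) ℝ)
    (hH : ∀ k, (H k).IsHermitian) (x : Fin K → ℝ) : (∑ k, x k • H k).IsHermitian := by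
  unfold Matrix.IsHermitian
  rw [conjTranspose_sum]
  refine Finset.sum_congr rfl fun k _ => ?_
  rw [conjTranspose_smul, (hH k).eq]
  simp

/-- the linear map -/
noncomputable def Mlin {K d : ℕ} (H : Fin K → Matrix (Fin d) (Fin d) ℝ) :
    (Fin K → ℝ) →L[ℝ] Matrix (Fin d) (Fin d) ℝ :=
  LinearMap.toContinuousLinearMap (Fintype.linearCombination ℝ H)

lemma Mlin_apply {K d : ℕ} (H : Fin K → Matrix (Fin d) (Fin d) ℝ) (x : Fin K → ℝ) :
    Mlin H x = ∑ k, x k • H k := by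
  simp [Mlin, Fintype.linearCombination_apply]

lemma mgf_bound {K d : ℕ} (hd : 0 < d) {Ω : Type*} [MeasurableSpace Ω]
    (μ : Measure Ω) [IsProbabilityMeasure μ]
    (H : Fin K → Matrix (Fin d) (Fin d) ℝ) (hH : ∀ k, (H k).IsHermitian)
    (γ : Fin K → Ω → ℝ) (hmeas : ∀ k, Measurable (γ k))
    (hindep : iIndepFun γ μ)
    (hgauss : ∀ k, Measure.map (γ k) μ = gaussianReal 0 1) {θ : ℝ} (hθ : 0 ≤ θ) :
    Integrable (fun ω => (NormedSpace.exp (θ • ∑ k, γ k ω • H k)).trace) μ ∧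
    ∫ ω, (NormedSpace.exp (θ • ∑ k, γ k ω • H k)).trace ∂μ
      ≤ d * Real.exp (opNorm (∑ k, H k ^ 2) * θ ^ 2 / 2) := by
  have : Nonempty (Fin d) := ⟨⟨0, hd⟩⟩
  have hlaw : ∀ k, HasLaw (γ k) (gaussianReal 0 1) μ := fun k => ⟨(hmeas k).aemeasurable, hgauss k⟩
  have hgl : ∀ k, HasGaussianLaw (γ k) μ := fun k => ⟨by rw [hgauss k]; infer_instance⟩
  set Γ : Ω → Fin K → ℝ := fun ω k => γ k ω with hΓ
  have hΓm : Measurable Γ := measurable_pi_iff.2 hmeas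
  set ν := μ.map Γ with hν
  have hνG : IsGaussian ν := (iIndepFun.hasGaussianLaw hgl hindep).isGaussian_map
  have hνpi : ν = Measure.pi (fun _ => gaussianReal 0 1) := by
    rw [hν, (iIndepFun_iff_map_fun_eq_pi_map (fun k => (hmeas k).aemeasurable)).1 hindep]
    simp only [hgauss]
  have hneg : ν.map (fun x => -x) = ν := by
    have h1 : (gaussianReal 0 1).map (fun x => -x) = gaussianReal 0 1 := by
      rw [gaussianReal_map_neg, neg_zero]
    have h2 := (measurePreserving_pi (fun _ : Fin K => gaussianReal 0 1)
      (fun _ : Fin K => gaussianReal 0 1) (f := fun _ x => -x)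
      (fun _ => ⟨measurable_neg, h1⟩)).map_eq
    rw [hνpi]
    exact h2
  have hmem : ∀ k, MemLp (γ k) 2 μ := fun k => (hgl k).memLp_two
  have hmean : ∀ k, ∫ ω, γ k ω ∂μ = 0 := fun k => by
    rw [(hlaw k).integral_eq]; simp
  have hcov : ∀ k l, ∫ ω, γ k ω * γ l ω ∂μ = if k = l then 1 else 0 := by
    intro k l
    split_ifs with h
    · subst h
      have hv : Var[γ k; μ] = 1 := by rw [(hlaw k).variance_eq]; simp
      rw [variance_of_integral_eq_zero (hmeas k).aemeasurable (hmean k)] at hv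
      rw [← hv]
      simp [sq]
    · have := (hindep.indepFun h).integral_mul_eq_mul_integral
        (hmeas k).aestronglyMeasurable (hmeas l).aestronglyMeasurable
      rw [hmean, zero_mul] at this
      exact this
  have hS : ∀ B : Matrix (Fin d) (Fin d) ℝ,
      ∫ y, (Mlin H y * Mlin H y * B).trace ∂ν = ((∑ k, H k ^ 2) * B).trace := by
    intro B
    rw [hν, integral_map hΓm.aemeasurable
      (by
        apply Continuous.aestronglyMeasurable
        have := (Mlin H).continuous
        exact Continuous.matrix_trace ((this.matrix_mul this).matrix_mul continuous_const))]
    have e : ∀ ω, (Mlin H (Γ ω) * Mlin H (Γ ω) * B).trace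
        = ∑ k, ∑ l, γ k ω * γ l ω * (H k * H l * B).trace := by
      intro ω
      rw [Mlin_apply]
      simp only [Finset.sum_mul, Finset.mul_sum, trace_sum, smul_mul_assoc, mul_smul_comm,
        trace_smul, hΓ, smul_eq_mul]
      rw [Finset.sum_comm]
      refine Finset.sum_congr rfl fun k _ => Finset.sum_congr rfl fun l _ => ?_
      ring
    have hint : ∀ k l, Integrable (fun ω => γ k ω * γ l ω * (H k * H l * B).trace) μ :=
      fun k l => ((hmem k).integrable_mul (hmem l)).mul_const _
    simp only [e]
    rw [integral_finsetSum _ (fun k _ => integrable_finsetSum _ fun l _ => hint k l)]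
    simp only [integral_finsetSum _ (fun l _ => hint _ l), integral_mul_const, hcov]
    simp [Finset.sum_mul, trace_sum, sq]
  have hb := m_bound (ν := ν) (Mlin H) hneg
    (fun x => by rw [Mlin_apply]; exact isHermitian_sum H hH x) _ hS hθ
  have hg : Gr (fun x => (NormedSpace.exp (θ • Mlin H x)).trace) := (Gr.exp (θ • Mlin H)).trace
  have hI := hg.integrable ν
  rw [hν, integral_map hΓm.aemeasurable hg.1.aestronglyMeasurable] at hb
  rw [hν, integrable_map_measure hg.1.aestronglyMeasurable hΓm.aemeasurable] at hI
  simp only [Mlin_apply, Fintype.card_fin] at hb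
  simp only [Function.comp_def, Mlin_apply] at hI
  exact ⟨hI, hb⟩

end Final
end MGS

/-- **Gaussian matrix series (Gaussian case of Theorem 3.3).** Let `H₁, …, H_K` be fixed
`d × d` Hermitian matrices and `γ₁, …, γ_K` independent standard normal random variables.
With `ρ = ‖Σ_k H_k²‖`, for all `t ≥ 0` we have
`P(λ_max(Σ_k γ_k H_k) ≥ t) ≤ d · exp(-t²/(2ρ))`. -/
theorem matrix_gaussian_series_tail
    {K d : ℕ} (hd : 0 < d) {Ω : Type*} [MeasurableSpace Ω]
    (μ : Measure Ω) [IsProbabilityMeasure μ]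
    (H : Fin K → Matrix (Fin d) (Fin d) ℝ) (hH : ∀ k, (H k).IsHermitian)
    (γ : Fin K → Ω → ℝ) (hmeas : ∀ k, Measurable (γ k))
    (hindep : iIndepFun γ μ)
    (hgauss : ∀ k, Measure.map (γ k) μ = gaussianReal 0 1) :
    ∀ t ≥ 0,
      μ {ω | lambdaMax (∑ k, γ k ω • H k) ≥ t} ≤
        ENNReal.ofReal (d * Real.exp (-t ^ 2 / (2 * opNorm (∑ k, H k ^ 2)))) := by
  intro t ht
  have : Nonempty (Fin d) := ⟨⟨0, hd⟩⟩
  set ρ := opNorm (∑ k, H k ^ 2) with hρ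
  have hρ0 : 0 ≤ ρ := norm_nonneg _
  rcases hρ0.eq_or_lt with h0 | hpos
  · rw [← h0]
    refine prob_le_one.trans ?_
    rw [← ENNReal.ofReal_one]
    refine ENNReal.ofReal_le_ofReal ?_
    have : (1 : ℝ) ≤ d := by exact_mod_cast hd
    simpa using this
  have hb := MGS.mgf_bound hd μ H hH γ hmeas hindep hgauss (θ := t / ρ) (by positivity)
  obtain ⟨hi, hb⟩ := hb
  have hher : ∀ ω, (∑ k, γ k ω • H k).IsHermitian := fun ω => MGS.isHermitian_sum H hH _
  have hm := mul_meas_ge_le_integral_of_nonneg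
    (Filter.Eventually.of_forall fun ω => MGS.trace_exp_nonneg (hher ω) (t / ρ)) hi
    (Real.exp (t / ρ * t))
  have hsub : {ω | lambdaMax (∑ k, γ k ω • H k) ≥ t} ⊆
      {ω | Real.exp (t / ρ * t) ≤ (NormedSpace.exp ((t / ρ) • ∑ k, γ k ω • H k)).trace} :=
    fun ω hω => MGS.trace_exp_ge (hher ω) (by positivity) hω
  refine (measure_mono hsub).trans ?_
  rw [← ofReal_measureReal]
  refine ENNReal.ofReal_le_ofReal ?_
  have h2 := hm.trans hb
  rw [← hρ] at h2
  rw [mul_comm, ← le_div_iff₀ (Real.exp_pos _), mul_div_assoc, ← Real.exp_sub] at h2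
  refine h2.trans_eq ?_
  congr 2
  field_simp
  ring
end
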